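/- Let L be a finitely generated S-module and 𝔞 a standard ideal for L (an 𝔪-primary ideal of S such that every system of parameters of L contained in 𝔞 is standard). Then for almost all α, the specialized ideal 𝔞_α is a standard ideal for L_α. -/

import Mathlib

set_option maxHeartbeats 1000000
set_option synthInstance.maxHeartbeats 1000000

noncomputable section

namespace Spl

open MvPolynomial

/-- "Q(α) holds for almost all α ∈ K^m", i.e. away from a proper algebraic
subvariety of `K^m`. -/
def AlmostAll (K : Type) [Field K] (m : ℕ) (Q : (Fin m → K) → Prop) : Prop :=
  ∃ c : MvPolynomial (Fin m) K, c ≠ 0 ∧ ∀ α : Fin m → K, MvPolynomial.eval α c ≠ 0 → Q α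

variable (k K : Type) [Field k] [Field K] [Algebra k K]

/-- the field k(u) of rational functions in u = (u_1, ..., u_m) -/
abbrev kU (m : ℕ) := FractionRing (MvPolynomial (Fin m) k)

/-- the polynomial ring R = k(u)[X_1, ..., X_n] -/
abbrev Rg (m n : ℕ) := MvPolynomial (Fin n) (kU k m)

/-- the subfield k(α) ⊆ K generated by α = (α_1, ..., α_m) over k -/
abbrev kA {m : ℕ} (α : Fin m → K) := IntermediateField.adjoin k (Set.range α)

/-- the polynomial ring R_α = k(α)[X_1, ..., X_n] -/
abbrev Ra {m : ℕ} (n : ℕ) (α : Fin m → K) := MvPolynomial (Fin n) (kA k K α)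

/-- evaluation u ↦ α, from k[u] to k(α) -/
def evalα {m : ℕ} (α : Fin m → K) : MvPolynomial (Fin m) k →+* kA k K α :=
  (MvPolynomial.aeval fun i =>
    (⟨α i, IntermediateField.subset_adjoin k (Set.range α) ⟨i, rfl⟩⟩ : kA k K α)).toRingHom

/-- the inclusion k[u][X] → R = k(u)[X] -/
def toR (m n : ℕ) : MvPolynomial (Fin n) (MvPolynomial (Fin m) k) →+* Rg k m n :=
  MvPolynomial.map (algebraMap (MvPolynomial (Fin m) k) (kU k m))

/-- substitution u ↦ α, from k[u][X] to R_α = k(α)[X] -/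
def toRa {m : ℕ} (n : ℕ) (α : Fin m → K) :
    MvPolynomial (Fin n) (MvPolynomial (Fin m) k) →+* Ra k K n α :=
  MvPolynomial.map (evalα k K α)

/-- Krull's specialization I_α = { f(α,X) | f(u,X) ∈ I ∩ k[u,X] } of an ideal I ⊆ R
(as an ideal of R_α, i.e. the ideal spanned by the specialized elements). -/
def idealSpec {m : ℕ} (n : ℕ) (α : Fin m → K) (I : Ideal (Rg k m n)) :
    Ideal (Ra k K n α) :=
  Ideal.span (toRa k K n α '' { f | toR k m n f ∈ I })

/-- `ElemSpec k K n α f fα` : fα is the specialization of f ∈ R at α, i.e. writing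
f = p(u,X)/q(u) with q(α) ≠ 0 one has fα = p(α,X)/q(α). -/
def ElemSpec {m : ℕ} (n : ℕ) (α : Fin m → K) (f : Rg k m n) (fα : Ra k K n α) : Prop :=
  ∃ (p : MvPolynomial (Fin n) (MvPolynomial (Fin m) k)) (q : MvPolynomial (Fin m) k),
    evalα k K α q ≠ 0 ∧
    MvPolynomial.C (algebraMap (MvPolynomial (Fin m) k) (kU k m) q) * f = toR k m n p ∧
    MvPolynomial.C (evalα k K α q) * fα = toRa k K n α p

variable {k K}

/-- `LocElemSpec P ℘ a aα` : aα ∈ S_α = (R_α)_℘ is the specialization of a ∈ S = R_P,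
i.e. writing a = f/g with f, g ∈ R, g ∉ P, one has g_α ∉ ℘ and aα = f_α/g_α. -/
def LocElemSpec {m n : ℕ} {α : Fin m → K} (P : Ideal (Rg k m n)) [P.IsPrime]
    (℘ : Ideal (Ra k K n α)) [℘.IsPrime]
    {S : Type} [CommRing S] [Algebra (Rg k m n) S] [IsLocalization.AtPrime S P]
    {Sα : Type} [CommRing Sα] [Algebra (Ra k K n α) Sα] [IsLocalization.AtPrime Sα ℘]
    (a : S) (aα : Sα) : Prop :=
  ∃ (f g : Rg k m n) (fα gα : Ra k K n α) (hg : g ∈ P.primeCompl)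
    (hgα : gα ∈ ℘.primeCompl),
    ElemSpec k K n α f fα ∧ ElemSpec k K n α g gα ∧
    a = IsLocalization.mk' S f ⟨g, hg⟩ ∧
    aα = IsLocalization.mk' Sα fα ⟨gα, hgα⟩

/-- entrywise specialization of matrices, relative to an element-specialization
relation `E`. -/
def MatSpec {S T : Type} (E : S → T → Prop) {r s : ℕ}
    (A : Matrix (Fin r) (Fin s) S) (B : Matrix (Fin r) (Fin s) T) : Prop :=
  ∀ i j, E (A i j) (B i j)

/-- the cokernel of the linear map attached to a matrix A, i.e. the module
presented by A. -/
abbrev MatCoker {S : Type} [CommRing S] {r s : ℕ} (A : Matrix (Fin r) (Fin s) S) :=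
  (Fin r → S) ⧸ LinearMap.range A.mulVecLin

/-- a finite free presentation F_1 → F_0 → L → 0 of the module L, where the map
F_1 → F_0 is given by the matrix A and the map F_0 → L is π. -/
structure Present (S : Type) [CommRing S] (r s : ℕ) (L : Type) [AddCommGroup L]
    [Module S L] where
  A : Matrix (Fin r) (Fin s) S
  π : (Fin r → S) →ₗ[S] L
  surj : Function.Surjective π
  ker_eq : LinearMap.ker π = LinearMap.range A.mulVecLin

theorem comm_le {S : Type} [CommRing S] {r s r' s' : ℕ} {B : Matrix (Fin r) (Fin s) S}
    {C : Matrix (Fin r') (Fin s') S} {W : Matrix (Fin r') (Fin r) S}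
    {W1 : Matrix (Fin s') (Fin s) S} (h : W * B = C * W1) :
    LinearMap.range B.mulVecLin ≤ (LinearMap.range C.mulVecLin).comap W.mulVecLin := by
  rintro x ⟨y, rfl⟩
  exact ⟨W1.mulVecLin y, by
    simp only [Matrix.mulVecLin_apply, Matrix.mulVec_mulVec, h]⟩

/-- the map between the modules presented by B and C induced by the matrix W
(a specialization of a lift of a map between the presented modules). -/
def cokerMap {S : Type} [CommRing S] {r s r' s' : ℕ} {B : Matrix (Fin r) (Fin s) S}
    {C : Matrix (Fin r') (Fin s') S} (W : Matrix (Fin r') (Fin r) S)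
    (h : LinearMap.range B.mulVecLin ≤ (LinearMap.range C.mulVecLin).comap W.mulVecLin) :
    MatCoker B →ₗ[S] MatCoker C :=
  Submodule.mapQ _ _ W.mulVecLin h

/-- a lift of a homomorphism v : L → M to given finite free presentations of L and M:
a commutative diagram whose vertical maps are given by the matrices V1, V0. -/
structure MapLift {S : Type} [CommRing S] {rL sL rM sM : ℕ} {L M : Type}
    [AddCommGroup L] [Module S L] [AddCommGroup M] [Module S M]
    (pL : Present S rL sL L) (pM : Present S rM sM M) (v : L →ₗ[S] M) where
  V0 : Matrix (Fin rM) (Fin rL) S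
  V1 : Matrix (Fin sM) (Fin sL) S
  comm0 : pM.π ∘ₗ V0.mulVecLin = v ∘ₗ pL.π
  comm1 : V0 * pL.A = pM.A * V1

/-- Krull dimension of a module, dim L = dim S/Ann L. -/
def moduleDim (S : Type) [CommRing S] (L : Type) [AddCommGroup L] [Module S L] :
    WithBot ℕ∞ :=
  ringKrullDim (S ⧸ Module.annihilator S L)

/-- height of an ideal: the infimum of dim S_p over the primes p ⊇ I. -/
def idealHeight {S : Type} [CommRing S] (I : Ideal S) : WithBot ℕ∞ :=
  sInf { d | ∃ (p : Ideal S) (hp : p.IsPrime), I ≤ p ∧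
    d = ringKrullDim (Localization (@Ideal.primeCompl _ _ p hp)) }

/-- length of a module: the longest chain of submodules. -/
def moduleLength (S : Type) [CommRing S] (L : Type) [AddCommGroup L] [Module S L] :
    WithBot ℕ∞ :=
  Order.krullDim (Submodule S L)

/-- grade(𝔞, L) ≥ t : there is an L-regular sequence of length t in 𝔞. -/
def GradeGE {S : Type} [CommRing S] (𝔞 : Ideal S) (L : Type) [AddCommGroup L]
    [Module S L] (t : ℕ) : Prop :=
  ∃ rs : List S, rs.length = t ∧ (∀ x ∈ rs, x ∈ 𝔞) ∧ RingTheory.Sequence.IsRegular L rs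

/-- grade(𝔞, L) : the length of a maximal L-regular sequence in 𝔞. -/
def grade {S : Type} [CommRing S] (𝔞 : Ideal S) (L : Type) [AddCommGroup L]
    [Module S L] : ℕ∞ :=
  sSup { t : ℕ∞ | ∃ t' : ℕ, t = (t' : ℕ∞) ∧ GradeGE 𝔞 L t' }

/-- depth of a module over a local ring: grade(𝔪, L). -/
def depth (S : Type) [CommRing S] [IsLocalRing S] (L : Type) [AddCommGroup L]
    [Module S L] : ℕ∞ :=
  grade (IsLocalRing.maximalIdeal S) L

/-- proj dim L ≤ d : L admits a finite free resolution of length ≤ d, encoded as a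
(possibly infinite) free resolution ⋯ → F_1 → F_0 → L → 0 with F_j = 0 for j > d. -/
def ProjDimLE (S : Type) [CommRing S] (L : Type) [AddCommGroup L] [Module S L]
    (d : ℕ) : Prop :=
  ∃ (r : ℕ → ℕ) (A : ∀ j : ℕ, Matrix (Fin (r j)) (Fin (r (j + 1))) S)
    (π : (Fin (r 0) → S) →ₗ[S] L),
    Function.Surjective π ∧ LinearMap.ker π = LinearMap.range (A 0).mulVecLin ∧
    (∀ j : ℕ, LinearMap.ker (A j).mulVecLin = LinearMap.range (A (j + 1)).mulVecLin) ∧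
    ∀ j : ℕ, d < j → r j = 0

/-- projective dimension of a module, as an extended natural number. -/
def projDim (S : Type) [CommRing S] (L : Type) [AddCommGroup L] [Module S L] : ℕ∞ :=
  sInf { d : ℕ∞ | ∃ d' : ℕ, d = (d' : ℕ∞) ∧ ProjDimLE S L d' }

/-- the i-th local cohomology module H^i_𝔞(L) as a module. -/
abbrev localCoh {S : Type} [CommRing S] (𝔞 : Ideal S) (i : ℕ) (L : Type)
    [AddCommGroup L] [Module S L] : ModuleCat S :=
  (localCohomology 𝔞 i).obj (ModuleCat.of S L)

/-- the colon submodule (0 :_L 𝔞) = { x ∈ L | 𝔞 x = 0 }. -/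
def colonSubmodule {S : Type} [CommRing S] (𝔞 : Ideal S) (L : Type) [AddCommGroup L]
    [Module S L] : Submodule S L where
  carrier := { x | ∀ c ∈ 𝔞, c • x = 0 }
  add_mem' := by
    intro a b ha hb c hc
    rw [smul_add, ha c hc, hb c hc, add_zero]
  zero_mem' := by
    intro c _
    rw [smul_zero]
  smul_mem' := by
    intro s x hx c hc
    rw [smul_comm, hx c hc, smul_zero]

/-- a (partial) system of parameters: the d = dim L elements a_1, ..., a_d lie in the
maximal ideal and L/(a_1, ..., a_d)L has dimension ≤ 0. -/
def IsSOP (S : Type) [CommRing S] [IsLocalRing S] (L : Type) [AddCommGroup L]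
    [Module S L] {d : ℕ} (a : Fin d → S) : Prop :=
  (∀ i, a i ∈ IsLocalRing.maximalIdeal S) ∧
  moduleDim S L = (d : ℕ∞) ∧
  moduleDim S (L ⧸ (Ideal.span (Set.range a) • (⊤ : Submodule S L))) ≤ 0

/-- a standard system of parameters: (a_1, ..., a_d) H^i_𝔪(L/(a_1, ..., a_j)L) = 0
for all i + j < d. -/
def IsStandardSOP (S : Type) [CommRing S] [IsLocalRing S] (L : Type) [AddCommGroup L]
    [Module S L] {d : ℕ} (a : Fin d → S) : Prop :=
  IsSOP S L a ∧
  ∀ i j : ℕ, i + j < d →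
    Ideal.span (Set.range a) ≤ Module.annihilator S
      (localCoh (IsLocalRing.maximalIdeal S) i
        (L ⧸ (Ideal.span (a '' { x : Fin d | (x : ℕ) < j }) • (⊤ : Submodule S L))))

/-- a standard ideal for L: an 𝔪-primary ideal 𝔞 such that every system of
parameters of L contained in 𝔞 is standard. -/
def IsStandardIdeal (S : Type) [CommRing S] [IsLocalRing S] (L : Type) [AddCommGroup L]
    [Module S L] (𝔞 : Ideal S) : Prop :=
  𝔞.radical = IsLocalRing.maximalIdeal S ∧
  ∀ (d : ℕ) (a : Fin d → S), (∀ i, a i ∈ 𝔞) → IsSOP S L a → IsStandardSOP S L a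

section Saturation

variable {S : Type*} [CommRing S] {L : Type*} [AddCommGroup L] [Module S L]

/-- The `𝔞`-saturation of a submodule: the elements killed by a power of `𝔞` modulo `Q`. -/
def sat (𝔞 : Ideal S) (Q : Submodule S L) : Submodule S L where
  carrier := {z | ∃ N : ℕ, ∀ c ∈ 𝔞 ^ N, c • z ∈ Q}
  add_mem' := by
    rintro z w ⟨N, hN⟩ ⟨M, hM⟩
    refine ⟨N + M, fun c hc => ?_⟩
    rw [smul_add]
    exact Q.add_mem (hN c (Ideal.pow_le_pow_right (Nat.le_add_right _ _) hc))
      (hM c (Ideal.pow_le_pow_right (Nat.le_add_left _ _) hc))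
  zero_mem' := ⟨0, fun c _ => by simp⟩
  smul_mem' := by
    rintro s z ⟨N, hN⟩
    exact ⟨N, fun c hc => by rw [smul_comm]; exact Q.smul_mem s (hN c hc)⟩

theorem mem_sat {𝔞 : Ideal S} {Q : Submodule S L} {z : L} :
    z ∈ sat 𝔞 Q ↔ ∃ N : ℕ, ∀ c ∈ 𝔞 ^ N, c • z ∈ Q := Iff.rfl

theorem le_sat (𝔞 : Ideal S) (Q : Submodule S L) : Q ≤ sat 𝔞 Q :=
  fun _ hz => ⟨0, fun c _ => Q.smul_mem c hz⟩

theorem sat_mono (𝔞 : Ideal S) {Q Q' : Submodule S L} (h : Q ≤ Q') : sat 𝔞 Q ≤ sat 𝔞 Q' :=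
  fun _ ⟨N, hN⟩ => ⟨N, fun c hc => h (hN c hc)⟩

/-- `𝔞` kills the `𝔞`-power torsion of `L ⧸ Q`. -/
def Good (𝔞 : Ideal S) (Q : Submodule S L) : Prop :=
  ∀ z ∈ sat 𝔞 Q, ∀ c ∈ 𝔞, c • z ∈ Q

/-- `x` is filter regular on `L ⧸ Q` with respect to `𝔞`. -/
def FR (𝔞 : Ideal S) (x : S) (Q : Submodule S L) : Prop :=
  ∀ z : L, x • z ∈ Q → z ∈ sat 𝔞 Q

/-- The submodule `Q + x L`. -/
def adj (Q : Submodule S L) (x : S) : Submodule S L :=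
  Q ⊔ LinearMap.range (LinearMap.lsmul S L x)

theorem mem_adj {Q : Submodule S L} {x : S} {z : L} :
    z ∈ adj Q x ↔ ∃ l : L, z - x • l ∈ Q := by
  rw [adj, Submodule.mem_sup]
  constructor
  · rintro ⟨q, hq, _, ⟨l, rfl⟩, rfl⟩
    exact ⟨l, by simpa using hq⟩
  · rintro ⟨l, hl⟩
    exact ⟨_, hl, _, ⟨l, rfl⟩, by simp⟩

theorem le_adj (Q : Submodule S L) (x : S) : Q ≤ adj Q x := le_sup_left

theorem smul_mem_adj (Q : Submodule S L) (x : S) (l : L) : x • l ∈ adj Q x :=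
  mem_adj.2 ⟨l, by simp⟩

theorem adj_comm (Q : Submodule S L) (x y : S) : adj (adj Q x) y = adj (adj Q y) x := by
  simp only [adj, sup_assoc]
  rw [sup_comm (LinearMap.range (LinearMap.lsmul S L x))]

theorem adj_smul_top (J : Ideal S) (x : S) :
    adj (J • (⊤ : Submodule S L)) x = (J ⊔ Ideal.span {x}) • ⊤ := by
  rw [adj, Submodule.sup_smul]
  congr 1
  ext z
  rw [Submodule.ideal_span_singleton_smul, Submodule.mem_smul_pointwise_iff_exists]
  simp

theorem mem_sat_of_forall_pow {𝔞 : Ideal S} {Q : Submodule S L} {z : L} (N : ℕ)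
    (hfg : (𝔞 ^ N).FG) (h : ∀ c ∈ 𝔞 ^ N, c • z ∈ sat 𝔞 Q) : z ∈ sat 𝔞 Q := by
  obtain ⟨s, hs⟩ := hfg
  have : ∃ M : ℕ, ∀ c ∈ s, ∀ e ∈ 𝔞 ^ M, e • c • z ∈ Q := by
    have hs' : ∀ c ∈ s, c • z ∈ sat 𝔞 Q := fun c hc => h c (hs ▸ Ideal.subset_span hc)
    clear hs h
    induction s using Finset.cons_induction with
    | empty => exact ⟨0, by simp⟩
    | cons a s ha ih =>
      obtain ⟨M, hM⟩ := ih fun c hc => hs' c (by simp [hc])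
      obtain ⟨M', hM'⟩ := hs' a (by simp)
      refine ⟨M + M', fun c hc e he => ?_⟩
      rcases Finset.mem_cons.1 hc with rfl | hc
      · exact hM' e (Ideal.pow_le_pow_right (Nat.le_add_left _ _) he)
      · exact hM c hc e (Ideal.pow_le_pow_right (Nat.le_add_right _ _) he)
  obtain ⟨M, hM⟩ := this
  refine ⟨N + M, fun c hc => ?_⟩
  rw [pow_add] at hc
  refine Submodule.mul_induction_on hc (fun a ha e he => ?_) (fun x y hx hy => ?_)
  · rw [← hs] at ha
    rw [mul_comm, mul_smul]
    refine Submodule.span_induction (p := fun a _ => e • a • z ∈ Q)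
      (fun a ha => hM a ha e he) (by simp) (fun x y _ _ hx hy => ?_) (fun r x _ hx => ?_) ha
    · rw [add_smul, smul_add]; exact Q.add_mem hx hy
    · rw [smul_assoc, smul_comm e r]; exact Q.smul_mem _ hx
  · rw [add_smul]; exact Q.add_mem hx hy

theorem sat_sat [IsNoetherianRing S] {𝔞 : Ideal S} {Q : Submodule S L} {z : L}
    (h : z ∈ sat 𝔞 (sat 𝔞 Q)) : z ∈ sat 𝔞 Q := by
  obtain ⟨N, hN⟩ := h
  exact mem_sat_of_forall_pow N (IsNoetherian.noetherian _) hN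

variable {𝔞 : Ideal S} {Q : Submodule S L} {x y : S}

theorem FR.sat [IsNoetherianRing S] (h : FR 𝔞 x Q) {z : L} (hz : x • z ∈ Spl.sat 𝔞 Q) :
    z ∈ Spl.sat 𝔞 Q := by
  obtain ⟨N, hN⟩ := hz
  exact mem_sat_of_forall_pow N (IsNoetherian.noetherian _) fun c hc =>
    h _ (by rw [smul_comm]; exact hN c hc)

theorem FR.mul [IsNoetherianRing S] (hx : FR 𝔞 x Q) (hy : FR 𝔞 y Q) : FR 𝔞 (x * y) Q :=
  fun z hz => hy.sat (hx.sat (le_sat 𝔞 Q (by rwa [← mul_smul])))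

theorem FR.sq [IsNoetherianRing S] (hx : FR 𝔞 x Q) : FR 𝔞 (x ^ 2) Q := by
  rw [_root_.sq]; exact hx.mul hx

theorem FR.swap [IsNoetherianRing S] (hx : FR 𝔞 x Q) (hy : FR 𝔞 y (adj Q x)) :
    FR 𝔞 x (adj Q y) := by
  intro z hz
  obtain ⟨w, hw⟩ := mem_adj.1 hz
  have hw' : w ∈ Spl.sat 𝔞 (adj Q x) := hy _ (mem_adj.2 ⟨z, by
    rw [← neg_sub]; exact Q.neg_mem hw⟩)
  obtain ⟨N, hN⟩ := hw'
  refine mem_sat_of_forall_pow N (IsNoetherian.noetherian _) fun c hc => ?_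
  obtain ⟨l, hl⟩ := mem_adj.1 (hN c hc)
  have h1 : x • (c • z - y • l) ∈ Q := by
    have := Q.add_mem (Q.smul_mem c hw) (Q.smul_mem y hl)
    convert this using 1
    simp only [smul_sub, ← mul_smul, mul_comm]
    module
  have h2 := sat_mono 𝔞 (le_adj Q y) (hx _ h1)
  have h3 := Submodule.add_mem _ h2 (le_sat 𝔞 _ (smul_mem_adj Q y l))
  simpa using h3

theorem mem_sat_of_smul_sub_sq (hQ : FR 𝔞 x Q) (hx : x ∈ 𝔞) (hG : Good 𝔞 (adj Q (x ^ 2)))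
    {p : L} (hp : p ∈ Spl.sat 𝔞 (adj Q (x ^ 2))) : ∃ p' : L, p - x • p' ∈ Spl.sat 𝔞 Q := by
  obtain ⟨p', hp'⟩ := mem_adj.1 (hG p hp x hx)
  refine ⟨p', hQ _ ?_⟩
  rwa [smul_sub, ← mul_smul, ← _root_.sq]

theorem exists_smul_sub_mem_sat [IsNoetherianRing S] (hQ : FR 𝔞 x Q) (hx : x ∈ 𝔞)
    (hG : Good 𝔞 (adj Q (x ^ 2))) {b : S} (hbQ : FR 𝔞 b Q) {z : L}
    (hz : z ∈ Spl.sat 𝔞 (adj Q b)) (N : ℕ) :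
    ∀ p : L, x ^ (N + 1) • z - b • p ∈ Spl.sat 𝔞 Q → ∃ q : L, x • z - b • q ∈ Spl.sat 𝔞 Q := by
  induction N with
  | zero => exact fun p hp => ⟨p, by simpa using hp⟩
  | succ N ih =>
    intro p hp
    obtain ⟨M, hM⟩ := hz
    have hp' : p ∈ Spl.sat 𝔞 (adj Q (x ^ 2)) := by
      refine mem_sat_of_forall_pow M (IsNoetherian.noetherian _) fun c hc => ?_
      obtain ⟨pc, hpc⟩ := mem_adj.1 (hM c hc)
      have h1 : b • (c • p - x ^ (N + 1 + 1) • pc) ∈ Spl.sat 𝔞 Q := by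
        have := Submodule.sub_mem _ (Submodule.smul_mem _ (x ^ (N + 1 + 1)) (le_sat 𝔞 Q hpc))
          (Submodule.smul_mem _ c hp)
        convert this using 1
        module
      have h2 := Submodule.add_mem _ (sat_mono 𝔞 (le_adj Q (x ^ 2)) (hbQ.sat h1))
        (le_sat 𝔞 _ (smul_mem_adj Q (x ^ 2) (x ^ N • pc)))
      convert h2 using 1
      module
    obtain ⟨p', hp'⟩ := mem_sat_of_smul_sub_sq hQ hx hG hp'
    refine ih p' (hQ.sat ?_)
    have := Submodule.add_mem _ hp (Submodule.smul_mem _ b hp')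
    convert this using 1
    module

theorem Good.adj [IsNoetherianRing S] {ι : Type*} {x : ι → S} {I : Finset ι}
    (hspan : 𝔞 ≤ Ideal.span (x '' I)) (hx : ∀ i ∈ I, x i ∈ 𝔞) (hQ : Good 𝔞 Q)
    (hFR : ∀ i ∈ I, FR 𝔞 (x i) Q) (h1 : ∀ i ∈ I, Good 𝔞 (adj Q (x i)))
    (h2 : ∀ i ∈ I, Good 𝔞 (Spl.adj Q (x i ^ 2)))
    (h3 : ∀ i ∈ I, ∀ l ∈ I, l ≠ i → FR 𝔞 (x l) (Spl.adj Q (x i)))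
    {b : S} (hb : b ∈ 𝔞) (hbQ : FR 𝔞 b Q) : Good 𝔞 (Spl.adj Q b) := by
  intro z hz
  have key : ∀ i : ι, ∃ y : L, i ∈ I → x i • z - b • y ∈ Spl.sat 𝔞 Q := by
    intro i
    by_cases hi : i ∈ I
    · obtain ⟨M, hM⟩ := id hz
      obtain ⟨p, hp⟩ := mem_adj.1 (hM (x i ^ (M + 1))
        (Ideal.pow_le_pow_right (Nat.le_succ M) (Ideal.pow_mem_pow (hx i hi) _)))
      obtain ⟨q, hq⟩ := exists_smul_sub_mem_sat (hFR i hi) (hx i hi) (h2 i hi) hbQ hz M p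
        (le_sat 𝔞 Q hp)
      exact ⟨q, fun _ => hq⟩
    · exact ⟨0, fun h => absurd h hi⟩
  choose y hy using key
  have hw : ∀ i ∈ I, ∀ l ∈ I, x l • y i - x i • y l ∈ Q := by
    intro i hi l hl
    have hs : x l • y i - x i • y l ∈ Spl.sat 𝔞 Q := by
      refine hbQ.sat ?_
      have := Submodule.sub_mem _ (Submodule.smul_mem _ (x i) (hy l hl))
        (Submodule.smul_mem _ (x l) (hy i hi))
      convert this using 1
      module
    by_cases hil : l = i
    · subst hil; simp
    have hyi : y i ∈ Spl.sat 𝔞 (Spl.adj Q (x i)) := by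
      refine (h3 i hi l hl hil).sat ?_
      have := Submodule.add_mem _ (sat_mono 𝔞 (le_adj Q (x i)) hs)
        (le_sat 𝔞 _ (smul_mem_adj Q (x i) (y l)))
      simpa using this
    obtain ⟨p, hp⟩ := mem_adj.1 (h1 i hi _ hyi (x l) (hx l hl))
    have hsq : x i • x i • (p - y l) ∈ Q := by
      have := Q.sub_mem (hQ _ hs (x i) (hx i hi)) (Q.smul_mem (x i) hp)
      convert this using 1
      module
    have hps : p - y l ∈ Spl.sat 𝔞 Q := (hFR i hi).sat (hFR i hi _ hsq)
    have := Q.add_mem (hQ _ hps (x i) (hx i hi)) hp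
    convert this using 1
    module
  intro c hc
  have hall : ∀ i ∈ I, x i • z ∈ Spl.adj Q b := by
    intro i hi
    obtain ⟨e, he⟩ := (Submodule.mem_span_image_finset_iff_exists_fun' S).1 (hspan hb)
    have hw' : x i • (∑ l ∈ I, e l • y l) - b • y i ∈ Q := by
      rw [← he, Finset.smul_sum, Finset.sum_smul, ← Finset.sum_sub_distrib]
      refine Q.sum_mem fun l hl => ?_
      have := Q.smul_mem (-e l) (hw i hi l hl)
      convert this using 1
      simp only [smul_eq_mul]
      module
    have hz' : (∑ l ∈ I, e l • y l) - z ∈ Spl.sat 𝔞 Q := by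
      refine (hFR i hi).sat ?_
      have := Submodule.sub_mem _ (le_sat 𝔞 Q hw') (hy i hi)
      convert this using 1
      module
    refine mem_adj.2 ⟨y i, ?_⟩
    have := Q.sub_mem hw' (hQ _ hz' (x i) (hx i hi))
    convert this using 1
    module
  refine Submodule.span_induction (p := fun c _ => c • z ∈ Spl.adj Q b)
    ?_ (by simp) (fun _ _ _ _ h h' => ?_) (fun r _ _ h => ?_) (hspan hc)
  · rintro _ ⟨i, hi, rfl⟩
    exact hall i hi
  · rw [add_smul]; exact Submodule.add_mem _ h h'
  · rw [smul_assoc]; exact Submodule.smul_mem _ r h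

end Saturation

section Generic

variable {S : Type} [CommRing S] {L : Type} [AddCommGroup L] [Module S L] {𝔞 : Ideal S}

/-- `Φ` holds for all elements of `𝔞` outside finitely many primes not containing `𝔞`. -/
def Gen (𝔞 : Ideal S) (Φ : S → Prop) : Prop :=
  ∃ ps : Finset (Ideal S), (∀ p ∈ ps, p.IsPrime ∧ ¬ 𝔞 ≤ p) ∧
    ∀ y ∈ 𝔞, (∀ p ∈ ps, y ∉ p) → Φ y

theorem Gen.mono {Φ Ψ : S → Prop} (h : Gen 𝔞 Φ) (hΨ : ∀ y ∈ 𝔞, Φ y → Ψ y) : Gen 𝔞 Ψ := by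
  obtain ⟨ps, h1, h2⟩ := h
  exact ⟨ps, h1, fun y hy hp => hΨ y hy (h2 y hy hp)⟩

theorem Gen.of_forall {Φ : S → Prop} (h : ∀ y ∈ 𝔞, Φ y) : Gen 𝔞 Φ :=
  ⟨∅, by simp, fun y hy _ => h y hy⟩

theorem Gen.and {Φ Ψ : S → Prop} (h : Gen 𝔞 Φ) (h' : Gen 𝔞 Ψ) :
    Gen 𝔞 fun y => Φ y ∧ Ψ y := by
  classical
  obtain ⟨ps, h1, h2⟩ := h
  obtain ⟨ps', h1', h2'⟩ := h'
  refine ⟨ps ∪ ps', fun p hp => ?_, fun y hy hp => ⟨h2 y hy fun p hp' => ?_, h2' y hy fun p hp' => ?_⟩⟩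
  · rcases Finset.mem_union.1 hp with hp | hp
    exacts [h1 p hp, h1' p hp]
  · exact hp p (Finset.mem_union_left _ hp')
  · exact hp p (Finset.mem_union_right _ hp')

theorem Gen.ball {ι : Type*} (I : Finset ι) {Φ : ι → S → Prop} (h : ∀ i ∈ I, Gen 𝔞 (Φ i)) :
    Gen 𝔞 fun y => ∀ i ∈ I, Φ i y := by
  induction I using Finset.cons_induction with
  | empty => exact Gen.of_forall (by simp)
  | cons a s ha ih =>
    refine ((h a (by simp)).and (ih fun i hi => h i (by simp [hi]))).mono fun y _ hy => ?_
    intro i hi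
    rcases Finset.mem_cons.1 hi with rfl | hi
    exacts [hy.1, hy.2 i hi]

theorem Gen.sq {Φ : S → Prop} (h : Gen 𝔞 Φ) : Gen 𝔞 fun y => Φ (y ^ 2) := by
  obtain ⟨ps, h1, h2⟩ := h
  exact ⟨ps, h1, fun y hy hp => h2 _ (𝔞.pow_mem_of_mem hy 2 (by norm_num)) fun p hp' hc =>
    hp p hp' ((h1 p hp').1.mem_of_pow_mem 2 hc)⟩

theorem Gen.exists_notMem {Φ : S → Prop} (h : Gen 𝔞 Φ) {J : Ideal S} (hJ : ¬ 𝔞 ≤ J) :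
    ∃ y ∈ 𝔞, y ∉ J ∧ Φ y := by
  classical
  obtain ⟨ps, h1, h2⟩ := h
  by_contra! hc
  have hsub : (𝔞 : Set S) ⊆ ⋃ p ∈ (↑(insert J ps) : Set (Ideal S)), (p : Set S) := by
    intro y hy
    simp only [Set.mem_iUnion]
    by_cases hyJ : y ∈ J
    · exact ⟨J, by simp, hyJ⟩
    by_contra! hp
    exact hc y hy hyJ (h2 y hy fun p hp' => hp p (by simp [hp']))
  obtain ⟨p, hp, hle⟩ := (Ideal.subset_union_prime (s := insert J ps) (f := id) J J
    (fun p hp hne _ => (h1 p (Finset.mem_of_mem_insert_of_ne hp hne)).1)).1 hsub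
  rcases Finset.mem_insert.1 hp with rfl | hp
  exacts [hJ hle, (h1 p hp).2 hle]

theorem Gen.le_span {Φ : S → Prop} (h : Gen 𝔞 Φ) : 𝔞 ≤ Ideal.span {y | y ∈ 𝔞 ∧ Φ y} := by
  by_contra hc
  obtain ⟨y, hy, hyn, hΦ⟩ := h.exists_notMem hc
  exact hyn (Ideal.subset_span ⟨hy, hΦ⟩)

theorem not_le_of_mem_associatedPrimes_sat [IsNoetherianRing S] {Q : Submodule S L} {p : Ideal S}
    (hp : p ∈ associatedPrimes S (L ⧸ sat 𝔞 Q)) : ¬ 𝔞 ≤ p := by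
  intro hle
  obtain ⟨hpr, z, hz⟩ := isAssociatedPrime_iff.1 hp
  obtain ⟨z, rfl⟩ := Submodule.Quotient.mk_surjective _ z
  have hz' : ∀ c, c ∈ p ↔ c • z ∈ sat 𝔞 Q := fun c => by
    rw [hz, Submodule.mem_colon_singleton, Submodule.mem_bot, ← Submodule.Quotient.mk_smul,
      Submodule.Quotient.mk_eq_zero]
  have h1 : z ∈ sat 𝔞 Q :=
    sat_sat ⟨1, fun c hc => (hz' c).1 (hle (by simpa using hc))⟩
  exact hpr.ne_top ((Ideal.eq_top_iff_one p).2 ((hz' 1).2 (by simpa using h1)))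

theorem gen_FR [IsNoetherianRing S] [IsNoetherian S L] (Q : Submodule S L) :
    Gen 𝔞 fun y => FR 𝔞 y Q := by
  have hfin := associatedPrimes.finite S (L ⧸ sat 𝔞 Q)
  refine ⟨hfin.toFinset, fun p hp => ?_, fun y hy hp => ?_⟩
  · have hp : p ∈ associatedPrimes S (L ⧸ sat 𝔞 Q) := by simpa using hp
    exact ⟨hp.isPrime, not_le_of_mem_associatedPrimes_sat hp⟩
  · intro z hz
    by_contra hzn
    have h0 : (Submodule.Quotient.mk z : L ⧸ sat 𝔞 Q) ≠ 0 := by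
      rwa [Ne, Submodule.Quotient.mk_eq_zero]
    have : y ∈ ⋃ p ∈ associatedPrimes S (L ⧸ sat 𝔞 Q), (p : Set S) := by
      rw [biUnion_associatedPrimes_eq_zero_divisors]
      refine ⟨_, h0, ?_⟩
      rw [← Submodule.Quotient.mk_smul, Submodule.Quotient.mk_eq_zero]
      exact le_sat 𝔞 Q hz
    simp only [Set.mem_iUnion] at this
    obtain ⟨p, hp', hy'⟩ := this
    exact hp p (by simpa using hp') hy'

end Generic

section Tower

variable {S : Type} [CommRing S] {L : Type} [AddCommGroup L] [Module S L] {𝔞 : Ideal S}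

open Classical in
/-- A tower of conditions on the successive quotients of `L ⧸ Q` by members of the family `x`
(and by their squares), to depth `d`. -/
def HT (𝔞 : Ideal S) {ι : Type} (x : ι → S) (H : ℕ → Submodule S L → Prop) :
    ℕ → Finset ι → Submodule S L → Prop
  | 0, _, Q => H 0 Q
  | d + 1, I, Q => H (d + 1) Q ∧ ∀ i ∈ I, x i ∈ 𝔞 ∧ FR 𝔞 (x i) Q ∧
      HT 𝔞 x H d (I.erase i) (adj Q (x i)) ∧ HT 𝔞 x H d (I.erase i) (adj Q (x i ^ 2))

/-- The family `x` on `I` generates `𝔞` even after removing fewer than `d` members. -/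
def Rich (𝔞 : Ideal S) {ι : Type} (x : ι → S) (d : ℕ) (I : Finset ι) : Prop :=
  ∀ F : Finset ι, F.card < d → 𝔞 ≤ Ideal.span (x '' ((I : Set ι) \ F))

/-- The condition `Good`, imposed in positive dimension only. -/
def GoodPos (𝔞 : Ideal S) (d : ℕ) (Q : Submodule S L) : Prop := 1 ≤ d → Good 𝔞 Q

/-- There is a generating family of `𝔞` realising a tower of depth `d` of good quotients. -/
def Real (𝔞 : Ideal S) (d : ℕ) (Q : Submodule S L) : Prop :=
  ∃ (ι : Type) (x : ι → S) (I : Finset ι), Rich 𝔞 x d I ∧ HT 𝔞 x (GoodPos 𝔞) d I Q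

variable {ι : Type} {x : ι → S} {H H' : ℕ → Submodule S L → Prop}

open Classical in
theorem Rich.erase {d : ℕ} {I : Finset ι} (h : Rich 𝔞 x (d + 1) I) (i : ι) :
    Rich 𝔞 x d (I.erase i) := by
  intro F hF
  have h1 : (insert i F).card < d + 1 := (Finset.card_insert_le i F).trans_lt (by omega)
  refine (h _ h1).trans (Ideal.span_mono (Set.image_mono ?_))
  rintro j ⟨hj, hj'⟩
  simp only [Finset.coe_insert, Set.mem_insert_iff, not_or] at hj'
  exact ⟨by simp [hj'.1, Finset.mem_coe.1 hj], hj'.2⟩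

theorem Rich.le_span {d : ℕ} {I : Finset ι} (h : Rich 𝔞 x (d + 1) I) :
    𝔞 ≤ Ideal.span (x '' I) := by
  simpa using h ∅ (by simp)

theorem HT.head {d : ℕ} {I : Finset ι} {Q : Submodule S L} (h : HT 𝔞 x H d I Q) : H d Q := by
  cases d with
  | zero => exact h
  | succ d => exact h.1

theorem HT.mono (hH : ∀ d Q, H d Q → H' d Q) {d : ℕ} :
    ∀ {I : Finset ι} {Q : Submodule S L}, HT 𝔞 x H d I Q → HT 𝔞 x H' d I Q := by
  induction d with
  | zero => exact fun h => hH _ _ h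
  | succ d ih =>
    exact fun h => ⟨hH _ _ h.1, fun i hi =>
      ⟨(h.2 i hi).1, (h.2 i hi).2.1, ih (h.2 i hi).2.2.1, ih (h.2 i hi).2.2.2⟩⟩

theorem HT.le [IsNoetherianRing S] {d : ℕ} : ∀ {I : Finset ι} {Q : Submodule S L},
    HT 𝔞 x (GoodPos 𝔞) (d + 1) I Q → HT 𝔞 x (GoodPos 𝔞) d I Q := by
  induction d with
  | zero => exact fun _ h => absurd h (by norm_num)
  | succ d ih =>
    exact fun h => ⟨fun _ => h.1 (by omega), fun i hi =>
      ⟨(h.2 i hi).1, (h.2 i hi).2.1, ih (h.2 i hi).2.2.1, ih (h.2 i hi).2.2.2⟩⟩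

/-- Quotients by a filter regular element preserve towers. -/
theorem HT.adj [IsNoetherianRing S] {y : S} (hy : y ∈ 𝔞) {d : ℕ} :
    ∀ {I : Finset ι} {Q : Submodule S L}, Rich 𝔞 x (d + 1) I →
      HT 𝔞 x (fun d Q => GoodPos 𝔞 d Q ∧ FR 𝔞 y Q) (d + 1) I Q →
      HT 𝔞 x (GoodPos 𝔞) d I (adj Q y) := by
  classical
  induction d with
  | zero => exact fun _ _ h => absurd h (by norm_num)
  | succ d ih =>
    intro I Q hI h
    refine ⟨fun _ => ?_, fun i hi => ⟨(h.2 i hi).1, (h.2 i hi).2.1.swap (h.2 i hi).2.2.1.head.2, ?_, ?_⟩⟩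
    · refine Good.adj (x := x) (I := I) hI.le_span (fun i hi => (h.2 i hi).1) (h.1.1 (by omega))
        (fun i hi => (h.2 i hi).2.1) (fun i hi => (h.2 i hi).2.2.1.head.1 (by omega))
        (fun i hi => (h.2 i hi).2.2.2.head.1 (by omega)) (fun i hi l hl hli => ?_) hy h.1.2
      exact ((h.2 i hi).2.2.1.2 l (Finset.mem_erase.2 ⟨hli, hl⟩)).2.1
    · rw [adj_comm]
      convert ih (hI.erase i) (h.2 i hi).2.2.1
    · rw [adj_comm]
      convert ih (hI.erase i) (h.2 i hi).2.2.2

theorem HT.gen_FR [IsNoetherianRing S] [IsNoetherian S L] {d : ℕ} :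
    ∀ {I : Finset ι} {Q : Submodule S L}, HT 𝔞 x H d I Q →
      Gen 𝔞 fun y => HT 𝔞 x (fun d Q => H d Q ∧ FR 𝔞 y Q) d I Q := by
  induction d with
  | zero => exact fun h => (Spl.gen_FR _).mono fun y _ hy => ⟨h, hy⟩
  | succ d ih =>
    intro I Q h
    have := Gen.ball I fun i hi => (ih (h.2 i hi).2.2.1).and (ih (h.2 i hi).2.2.2)
    refine ((Spl.gen_FR Q).and this).mono fun y _ hy => ⟨⟨h.1, hy.1⟩, fun i hi => ?_⟩
    exact ⟨(h.2 i hi).1, (h.2 i hi).2.1, hy.2 i hi⟩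

theorem Real.gen_adj [IsNoetherianRing S] [IsNoetherian S L] {d : ℕ} {Q : Submodule S L}
    (h : Real 𝔞 (d + 1) Q) : Gen 𝔞 fun y => Real 𝔞 d (Spl.adj Q y) := by
  obtain ⟨ι, x, I, hI, h⟩ := h
  exact h.gen_FR.mono fun y hy h' =>
    ⟨ι, x, I, fun F hF => hI F (by omega), HT.adj hy hI h'⟩

/-- A family of conditions inherited by generic quotients. -/
structure GenStable (𝔞 : Ideal S) (G : ℕ → Submodule S L → Prop) : Prop where
  step : ∀ {d Q}, G (d + 1) Q → Gen 𝔞 fun y => G d (Spl.adj Q y)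

variable {G : ℕ → Submodule S L → Prop}

theorem GenStable.gen_adj [IsNoetherianRing S] [IsNoetherian S L] (hG : GenStable 𝔞 G) {d : ℕ} :
    ∀ {I : Finset ι} {Q : Submodule S L}, HT 𝔞 x G (d + 1) I Q →
      Gen 𝔞 fun y => HT 𝔞 x G d I (Spl.adj Q y) := by
  induction d with
  | zero => exact fun h => hG.step h.1
  | succ d ih =>
    intro I Q h
    have h1 := Gen.ball I fun i hi => ((ih (h.2 i hi).2.2.1).and (ih (h.2 i hi).2.2.2)).and
      (gen_FR (𝔞 := 𝔞) (Spl.adj Q (x i)))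
    refine ((hG.step h.1).and h1).mono fun y _ hy => ⟨hy.1, fun i hi => ?_⟩
    refine ⟨(h.2 i hi).1, (h.2 i hi).2.1.swap (hy.2 i hi).2, ?_, ?_⟩
    · rw [adj_comm]; exact (hy.2 i hi).1.1
    · rw [adj_comm]; exact (hy.2 i hi).1.2

open Classical in
theorem GenStable.gen_insert [IsNoetherianRing S] [IsNoetherian S L] (hG : GenStable 𝔞 G)
    {d : ℕ} : ∀ {I : Finset ι} {Q : Submodule S L}, HT 𝔞 x G d I Q →
      Gen 𝔞 fun y => ∀ j ∉ I, x j = y → HT 𝔞 x G d (insert j I) Q := by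
  induction d with
  | zero => exact fun h => Gen.of_forall fun y _ j _ _ => h
  | succ d ih =>
    intro I Q h
    have h1 := Gen.ball I fun i hi => (ih (h.2 i hi).2.2.1).and (ih (h.2 i hi).2.2.2)
    have h2 := hG.gen_adj h
    refine ((((Spl.gen_FR Q).and h1).and h2).and h2.sq).mono fun y hy hyp j hj hjy =>
      ⟨h.1, fun i hi => ?_⟩
    obtain ⟨⟨⟨hFR, h1⟩, h2⟩, h3⟩ := hyp
    rcases Finset.mem_insert.1 hi with rfl | hiI
    · rw [Finset.erase_insert hj, hjy]
      exact ⟨hy, hFR, h2, h3⟩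
    · have hne : j ≠ i := fun hc => hj (hc ▸ hiI)
      rw [Finset.erase_insert_of_ne hne]
      exact ⟨(h.2 i hiI).1, (h.2 i hiI).2.1,
        (h1 i hiI).1 j (fun hc => hj (Finset.mem_of_mem_erase hc)) hjy,
        (h1 i hiI).2 j (fun hc => hj (Finset.mem_of_mem_erase hc)) hjy⟩

open Classical in
theorem GenStable.exists_block [IsNoetherianRing S] [IsNoetherian S L] (hG : GenStable 𝔞 G)
    {d : ℕ} {Q : Submodule S L} {I : Finset (ℕ × S)} (hI : HT 𝔞 Prod.snd G d I Q) (n : ℕ) :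
    ∃ J, I ⊆ J ∧ HT 𝔞 Prod.snd G d J Q ∧
      𝔞 ≤ Ideal.span (Prod.snd '' {i : ℕ × S | i ∈ J ∧ i.1 = n}) := by
  let sp : Finset (ℕ × S) → Ideal S := fun J =>
    Ideal.span (Prod.snd '' {i : ℕ × S | i ∈ J ∧ i.1 = n})
  obtain ⟨_, ⟨J, ⟨hIJ, hJ⟩, rfl⟩, hmax⟩ := set_has_maximal_iff_noetherian.2
    (inferInstance : IsNoetherian S S)
    (sp '' {J | I ⊆ J ∧ HT 𝔞 Prod.snd G d J Q}) ⟨_, I, ⟨subset_rfl, hI⟩, rfl⟩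
  refine ⟨J, hIJ, hJ, ?_⟩
  by_contra hc
  obtain ⟨y, hy, hyJ, hyG⟩ := (hG.gen_insert hJ).exists_notMem hc
  have hn : (n, y) ∉ J := fun hm => hyJ (Ideal.subset_span ⟨(n, y), ⟨hm, rfl⟩, rfl⟩)
  refine hmax (sp (insert (n, y) J))
    ⟨_, ⟨hIJ.trans (Finset.subset_insert _ _), by convert hyG (n, y) hn rfl⟩, rfl⟩ ?_
  refine lt_of_le_of_ne (Ideal.span_mono (Set.image_mono fun i hi => ⟨by simp [hi.1], hi.2⟩)) ?_
  intro he
  apply hyJ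
  change y ∈ sp J
  rw [he]
  exact Ideal.subset_span ⟨(n, y), ⟨by simp, rfl⟩, rfl⟩

theorem GenStable.exists_rich [IsNoetherianRing S] [IsNoetherian S L] (hG : GenStable 𝔞 G)
    {d : ℕ} {Q : Submodule S L} (hQ : G d Q) :
    ∃ I : Finset (ℕ × S), Rich 𝔞 Prod.snd d I ∧ HT 𝔞 Prod.snd G d I Q := by
  classical
  have h0 : HT 𝔞 Prod.snd G d (∅ : Finset (ℕ × S)) Q := by
    cases d with
    | zero => exact hQ
    | succ d => exact ⟨hQ, by simp⟩
  have : ∀ n : ℕ, ∃ I : Finset (ℕ × S), HT 𝔞 Prod.snd G d I Q ∧ ∀ n' < n,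
      𝔞 ≤ Ideal.span (Prod.snd '' {i : ℕ × S | i ∈ I ∧ i.1 = n'}) := by
    intro n
    induction n with
    | zero => exact ⟨∅, h0, by simp⟩
    | succ n ih =>
      obtain ⟨I, hI, hI'⟩ := ih
      obtain ⟨J, hIJ, hJ, hJ'⟩ := hG.exists_block hI n
      refine ⟨J, hJ, fun n' hn' => ?_⟩
      rcases Nat.lt_succ_iff_lt_or_eq.1 hn' with h | rfl
      · exact (hI' n' h).trans (Ideal.span_mono (Set.image_mono fun i hi => ⟨hIJ hi.1, hi.2⟩))
      · exact hJ'
  obtain ⟨I, hI, hI'⟩ := this d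
  refine ⟨I, fun F hF => ?_, hI⟩
  obtain ⟨n', hn', hn''⟩ : ∃ n' ∈ Finset.range d, n' ∉ F.image Prod.fst := by
    by_contra! hc
    have := Finset.card_le_card hc
    rw [Finset.card_range] at this
    exact absurd (this.trans Finset.card_image_le) (by omega)
  refine (hI' n' (Finset.mem_range.1 hn')).trans (Ideal.span_mono (Set.image_mono ?_))
  rintro i ⟨hi, rfl⟩
  exact ⟨hi, fun hc => hn'' (Finset.mem_image_of_mem _ hc)⟩

theorem Real.goodPos {d : ℕ} {Q : Submodule S L} (h : Real 𝔞 d Q) : GoodPos 𝔞 d Q := by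
  obtain ⟨_, _, _, _, h⟩ := h
  exact h.head

theorem Real.le [IsNoetherianRing S] {d : ℕ} {Q : Submodule S L} (h : Real 𝔞 (d + 1) Q) :
    Real 𝔞 d Q := by
  obtain ⟨ι, x, I, hI, h⟩ := h
  exact ⟨ι, x, I, fun F hF => hI F (by omega), h.le⟩

theorem Real.of_le [IsNoetherianRing S] {d e : ℕ} {Q : Submodule S L} (h : Real 𝔞 e Q)
    (hde : d ≤ e) : Real 𝔞 d Q := by
  induction e, hde using Nat.le_induction with
  | base => exact h
  | succ e _ ih => exact ih h.le

theorem Real.adj [IsNoetherianRing S] [IsNoetherian S L] {d : ℕ} {Q : Submodule S L}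
    (h : Real 𝔞 (d + 1) Q) {b : S} (hb : b ∈ 𝔞) (hbQ : FR 𝔞 b Q) :
    Real 𝔞 d (Spl.adj Q b) := by
  have hG : GenStable 𝔞 fun d (Q : Submodule S L) => Real 𝔞 d Q ∧ FR 𝔞 b Q :=
    ⟨fun {d Q} h => (h.1.gen_adj.and (gen_FR (Spl.adj Q b))).mono fun y _ hy =>
      ⟨hy.1, h.2.swap hy.2⟩⟩
  obtain ⟨I, hI, h⟩ := hG.exists_rich (d := d + 1) (Q := Q) ⟨h, hbQ⟩
  exact ⟨_, _, I, fun F hF => hI F (by omega),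
    HT.adj hb hI (h.mono fun d Q h => ⟨h.1.goodPos, h.2⟩)⟩

end Tower

set_option linter.unusedSectionVars false

section Dimension

variable {S : Type} [CommRing S] [IsLocalRing S] [IsNoetherianRing S]

open IsLocalRing

theorem ringKrullDim_quotient_le_card {ι : Type*} (F : Finset ι) (b : ι → S)
    (hb : ∀ i ∈ F, b i ∈ maximalIdeal S) (J : Ideal S)
    (h : ∀ q : Ideal S, q.IsPrime → J ≤ q → (∀ i ∈ F, b i ∈ q) → q = maximalIdeal S) :
    ringKrullDim (S ⧸ J) ≤ (F.card : ℕ∞) := by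
  classical
  rcases eq_or_ne J ⊤ with rfl | hJ
  · rw [ringKrullDim_eq_bot_of_subsingleton]; exact bot_le
  have : Nontrivial (S ⧸ J) := Ideal.Quotient.nontrivial_iff.2 hJ
  have : IsLocalRing (S ⧸ J) :=
    IsLocalRing.of_surjective' (Ideal.Quotient.mk J) Ideal.Quotient.mk_surjective
  have : IsLocalHom (Ideal.Quotient.mk J) :=
    IsLocalHom.of_surjective _ Ideal.Quotient.mk_surjective
  let s : Finset (S ⧸ J) := F.image fun i => Ideal.Quotient.mk J (b i)
  have hs : (s : Set (S ⧸ J)) ⊆ Ring.jacobson (S ⧸ J) := by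
    rw [IsLocalRing.ringJacobson_eq_maximalIdeal]
    intro y hy
    obtain ⟨i, hi, rfl⟩ := Finset.mem_image.1 (Finset.mem_coe.1 hy)
    have := hb i hi
    rw [SetLike.mem_coe, mem_maximalIdeal, mem_nonunits_iff]
    exact fun hu => (mem_maximalIdeal _).1 this
      ((isUnit_map_iff (Ideal.Quotient.mk J) (b i)).1 hu)
  refine (ringKrullDim_le_ringKrullDim_quotient_add_card s hs).trans ?_
  have h0 : ringKrullDim ((S ⧸ J) ⧸ Ideal.span (s : Set (S ⧸ J))) ≤ 0 := by
    have : Ring.KrullDimLE 0 ((S ⧸ J) ⧸ Ideal.span (s : Set (S ⧸ J))) := by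
      refine Ring.KrullDimLE.mk₀ fun I hI => ?_
      let f : S →+* ((S ⧸ J) ⧸ Ideal.span (s : Set (S ⧸ J))) :=
        (Ideal.Quotient.mk _).comp (Ideal.Quotient.mk J)
      have hf : Function.Surjective f :=
        Ideal.Quotient.mk_surjective.comp Ideal.Quotient.mk_surjective
      have hc : I.comap f = maximalIdeal S := by
        refine h _ (hI.comap f) (fun c hc => ?_) fun i hi => ?_
        · have : f c = 0 := by
            simp [f, Ideal.Quotient.eq_zero_iff_mem.2 hc]
          simp [this]
        · have : f (b i) = 0 := by
            simp only [f, RingHom.comp_apply]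
            exact Ideal.Quotient.eq_zero_iff_mem.2
              (Ideal.subset_span (Finset.mem_coe.2 (Finset.mem_image_of_mem _ hi)))
          simp [this]
      rw [← Ideal.map_comap_of_surjective f hf I, hc]
      refine (Ideal.map_eq_top_or_isMaximal_of_surjective f hf
        (inferInstance : (maximalIdeal S).IsMaximal)).resolve_left ?_
      rw [← hc, Ideal.map_comap_of_surjective f hf I]
      exact hI.ne_top
    simpa using (Ring.krullDimLE_iff.1 this)
  calc _ ≤ (0 : WithBot ℕ∞) + s.card := add_le_add_left h0 _
    _ ≤ _ := by
      rw [zero_add]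
      exact_mod_cast (Finset.card_image_le)

variable {L : Type} [AddCommGroup L] [Module S L] {𝔞 : Ideal S}

theorem ringKrullDim_quotient_succ_le {p q : Ideal S} [p.IsPrime] (hpq : p ≤ q) {x : S}
    (hx : x ∉ p) (hxq : x ∈ q) : ringKrullDim (S ⧸ q) + 1 ≤ ringKrullDim (S ⧸ p) := by
  refine ringKrullDim_succ_le_of_surjective (Ideal.Quotient.factor hpq)
    (Ideal.Quotient.factor_surjective hpq) (r := Ideal.Quotient.mk p x) ?_ ?_
  · rw [mem_nonZeroDivisors_iff_ne_zero, Ne, Ideal.Quotient.eq_zero_iff_mem]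
    exact hx
  · rw [Ideal.Quotient.factor_mk, Ideal.Quotient.eq_zero_iff_mem]
    exact hxq

theorem ringKrullDim_quotient_nonneg {p : Ideal S} [hp : p.IsPrime] :
    0 ≤ ringKrullDim (S ⧸ p) := by
  have : Nontrivial (S ⧸ p) := Ideal.Quotient.nontrivial_iff.2 hp.ne_top
  exact ringKrullDim_nonneg_of_nontrivial

theorem exists_smul_mem_sat_of_mem_associatedPrimes {Q : Submodule S L} {p : Ideal S}
    (hp : p ∈ associatedPrimes S (L ⧸ sat 𝔞 Q)) :
    ∃ z ∉ sat 𝔞 Q, ∀ c, c ∈ p ↔ c • z ∈ sat 𝔞 Q := by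
  obtain ⟨hpr, z, hz⟩ := isAssociatedPrime_iff.1 hp
  obtain ⟨z, rfl⟩ := Submodule.Quotient.mk_surjective _ z
  have hz' : ∀ c, c ∈ p ↔ c • z ∈ sat 𝔞 Q := fun c => by
    rw [hz, Submodule.mem_colon_singleton, Submodule.mem_bot, ← Submodule.Quotient.mk_smul,
      Submodule.Quotient.mk_eq_zero]
  refine ⟨z, fun h => hpr.ne_top ((Ideal.eq_top_iff_one p).2 ((hz' 1).2 (by simpa using h))), hz'⟩

theorem exists_associatedPrime_of_notMem_sat {Q : Submodule S L} {z : L} (hz : z ∉ sat 𝔞 Q) :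
    ∃ q ∈ associatedPrimes S (L ⧸ sat 𝔞 Q), ∀ c, c • z ∈ sat 𝔞 Q → c ∈ q := by
  obtain ⟨q, hq, hle⟩ := exists_le_isAssociatedPrime_of_isNoetherianRing S
    (Submodule.Quotient.mk z : L ⧸ sat 𝔞 Q) (by rwa [Ne, Submodule.Quotient.mk_eq_zero])
  refine ⟨q, hq, fun c hc => hle ?_⟩
  rw [Submodule.mem_colon_singleton, Submodule.mem_bot, ← Submodule.Quotient.mk_smul,
      Submodule.Quotient.mk_eq_zero]
  exact hc

theorem HT.le_ringKrullDim [IsNoetherian S L] (h𝔞 : 𝔞 ≤ maximalIdeal S) {ι : Type} {x : ι → S}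
    {d : ℕ} : ∀ {I : Finset ι} {Q : Submodule S L}, Rich 𝔞 x d I → HT 𝔞 x (GoodPos 𝔞) d I Q →
      ∀ p ∈ associatedPrimes S (L ⧸ sat 𝔞 Q), (d : WithBot ℕ∞) ≤ ringKrullDim (S ⧸ p) := by
  classical
  induction d with
  | zero =>
    intro _ _ _ _ p hp
    have := hp.isPrime
    exact_mod_cast ringKrullDim_quotient_nonneg
  | succ d ih =>
    intro I Q hI h p hp
    have hpr := hp.isPrime
    have hple : ¬ 𝔞 ≤ p := not_le_of_mem_associatedPrimes_sat hp
    obtain ⟨i, hi, hip⟩ : ∃ i ∈ I, x i ∉ p := by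
      by_contra! hc
      refine hple (hI.le_span.trans (Ideal.span_le.2 ?_))
      rintro _ ⟨i, hi, rfl⟩
      exact hc i hi
    obtain ⟨hxi, hFR, -, h2⟩ := h.2 i hi
    suffices ∃ q : Ideal S, p ≤ q ∧ x i ∈ q ∧ (d : WithBot ℕ∞) ≤ ringKrullDim (S ⧸ q) by
      obtain ⟨q, hpq, hxq, hd⟩ := this
      push_cast
      exact (add_le_add_left hd 1).trans (ringKrullDim_quotient_succ_le hpq hip hxq)
    rcases Nat.eq_zero_or_pos d with rfl | hd
    · exact ⟨maximalIdeal S, le_maximalIdeal hpr.ne_top, h𝔞 hxi,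
        by exact_mod_cast ringKrullDim_quotient_nonneg⟩
    let N : Submodule S L :=
      { carrier := {z | ∀ c ∈ p, c • z ∈ sat 𝔞 Q}
        add_mem' := fun hz hw c hc => by rw [smul_add]; exact add_mem (hz c hc) (hw c hc)
        zero_mem' := fun c _ => by simp
        smul_mem' := fun s z hz c hc => by
          rw [smul_comm]; exact Submodule.smul_mem _ s (hz c hc) }
    obtain ⟨z₀, hz₀, hz₀p⟩ := exists_smul_mem_sat_of_mem_associatedPrimes hp
    obtain ⟨z, hzN, hz⟩ : ∃ z ∈ N, z ∉ sat 𝔞 (Spl.adj Q (x i ^ 2)) := by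
      by_contra! hc
      refine hz₀ ((Submodule.le_of_le_smul_of_le_jacobson_bot (I := Ideal.span {x i}) (N := sat 𝔞 Q)
        (N' := N) (IsNoetherian.noetherian N) ?_ ?_) fun c hc => (hz₀p c).1 hc)
      · rw [IsLocalRing.jacobson_eq_maximalIdeal _ bot_ne_top, Ideal.span_singleton_le_iff_mem]
        exact h𝔞 hxi
      · intro z hz
        obtain ⟨l, hl⟩ := mem_sat_of_smul_sub_sq hFR hxi (h2.head hd) (hc z hz)
        have hlN : l ∈ N := by
          intro c hcp
          refine hFR.sat ?_
          have := sub_mem (hz c hcp) (Submodule.smul_mem _ c hl)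
          convert this using 1
          module
        rw [show z = (z - x i • l) + x i • l by abel]
        exact Submodule.add_mem_sup hl
          (Submodule.smul_mem_smul (Ideal.mem_span_singleton_self _) hlN)
    obtain ⟨q, hq, hqz⟩ := exists_associatedPrime_of_notMem_sat hz
    refine ⟨q, fun c hc => hqz c (sat_mono 𝔞 (le_adj _ _) (hzN c hc)), ?_,
      ih (hI.erase i) h2 q hq⟩
    exact hq.isPrime.mem_of_pow_mem 2 (hqz _ (le_sat 𝔞 _ (smul_mem_adj _ _ _)))

theorem Real.le_ringKrullDim [IsNoetherian S L] (h𝔞 : 𝔞 ≤ maximalIdeal S) {d : ℕ}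
    {Q : Submodule S L} (h : Real 𝔞 d Q) :
    ∀ p ∈ associatedPrimes S (L ⧸ sat 𝔞 Q), (d : WithBot ℕ∞) ≤ ringKrullDim (S ⧸ p) := by
  obtain ⟨ι, x, I, hI, h⟩ := h
  exact h.le_ringKrullDim h𝔞 hI

theorem moduleDim_le_zero_iff {M : Type} [AddCommGroup M] [Module S M] :
    moduleDim S M ≤ 0 ↔
      ∀ q : Ideal S, q.IsPrime → Module.annihilator S M ≤ q → q = maximalIdeal S := by
  constructor
  · intro h q hq hle
    have h0 : Ring.KrullDimLE 0 (S ⧸ Module.annihilator S M) := Ring.krullDimLE_iff.2 (by simpa [moduleDim] using h)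
    have hker : RingHom.ker (Ideal.Quotient.mk (Module.annihilator S M)) ≤ q := by
      rwa [Ideal.mk_ker]
    have hp := Ideal.map_isPrime_of_surjective (Ideal.Quotient.mk_surjective) hker
    have hm := Ideal.isMaximal_of_isPrime (q.map (Ideal.Quotient.mk (Module.annihilator S M)))
    have hc := Ideal.comap_isMaximal_of_surjective (K := q.map (Ideal.Quotient.mk (Module.annihilator S M)))
      _ Ideal.Quotient.mk_surjective
    rw [Ideal.comap_map_of_surjective _ Ideal.Quotient.mk_surjective, ← RingHom.ker_eq_comap_bot,
      Ideal.mk_ker, sup_eq_left.2 hle] at hc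
    exact IsLocalRing.eq_maximalIdeal hc
  · intro h
    simpa [moduleDim] using ringKrullDim_quotient_le_card (∅ : Finset (Fin 0)) (fun _ => (0 : S)) (by simp) _
      fun q hq hle _ => h q hq hle

theorem annihilator_quotient_smul_le_iff [Module.Finite S L] {J q : Ideal S} [hq : q.IsPrime] :
    Module.annihilator S (L ⧸ (J • (⊤ : Submodule S L))) ≤ q ↔
      Module.annihilator S L ≤ q ∧ J ≤ q := by
  have h := Module.support_quotient (R := S) (M := L) J
  rw [Module.support_eq_zeroLocus, Module.support_eq_zeroLocus] at h
  simpa [PrimeSpectrum.mem_zeroLocus] using Set.ext_iff.1 h ⟨q, hq⟩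

theorem adj_span_lt_smul_top {d : ℕ} (b : Fin d → S) (j : ℕ) (hj : j < d) :
    adj (Ideal.span (b '' {x : Fin d | (x : ℕ) < j}) • (⊤ : Submodule S L)) (b ⟨j, hj⟩) =
      Ideal.span (b '' {x : Fin d | (x : ℕ) < j + 1}) • ⊤ := by
  rw [adj_smul_top, ← Ideal.span_union, ← Set.image_singleton, ← Set.image_union]
  congr 3
  ext x
  simp [Fin.ext_iff, le_iff_lt_or_eq, or_comm]

/-- Quotients by the members of a system of parameters lying in `𝔞` preserve towers. -/
theorem Real.sop [Module.Finite S L] (h𝔞 : 𝔞 ≤ maximalIdeal S) {d : ℕ} (b : Fin d → S)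
    (hb : ∀ i, b i ∈ 𝔞)
    (hdim : moduleDim S (L ⧸ (Ideal.span (Set.range b) • (⊤ : Submodule S L))) ≤ 0)
    (h : Real 𝔞 d (⊥ : Submodule S L)) (j : ℕ) (hj : j ≤ d) :
    Real 𝔞 (d - j) (Ideal.span (b '' {x : Fin d | (x : ℕ) < j}) • (⊤ : Submodule S L)) := by
  induction j with
  | zero => simpa using h
  | succ j ih =>
    have hj' : j < d := hj
    have ih := ih hj'.le
    rw [← adj_span_lt_smul_top b j hj']
    rw [show d - j = d - (j + 1) + 1 by omega] at ih
    refine ih.adj (hb _) fun z hz => ?_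
    by_contra hzn
    obtain ⟨p, hp, hpz⟩ := exists_associatedPrime_of_notMem_sat hzn
    have h1 := ih.le_ringKrullDim h𝔞 p hp
    have h2 := ringKrullDim_quotient_le_card (Finset.univ.filter fun x : Fin d => j < (x : ℕ)) b
      (fun i _ => h𝔞 (hb i)) p fun q hq hpq hbq => by
        refine moduleDim_le_zero_iff.1 hdim q hq (annihilator_quotient_smul_le_iff.2
          ⟨fun c hc => hpq (hpz c ?_), Ideal.span_le.2 ?_⟩)
        · rw [Module.mem_annihilator.1 hc z]; exact zero_mem _
        · rintro _ ⟨i, rfl⟩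
          rcases lt_trichotomy (i : ℕ) j with hij | hij | hij
          · exact hpq (hpz _ (le_sat _ _ (Submodule.smul_mem_smul
              (Ideal.subset_span ⟨i, hij, rfl⟩) trivial)))
          · have : i = ⟨j, hj'⟩ := Fin.ext hij
            exact this ▸ hpq (hpz _ (le_sat _ _ hz))
          · exact hbq i (by simpa using hij)
    have h3 : (Finset.univ.filter fun x : Fin d => j < (x : ℕ)).card = d - (j + 1) := by
      rw [show (Finset.univ.filter fun x : Fin d => j < (x : ℕ)) = Finset.Ioi ⟨j, hj'⟩ by
        ext; simp [Fin.lt_def]]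
      simp; omega
    rw [h3] at h2
    have h4 := h1.trans h2
    generalize d - (j + 1) = e at h4
    have h5 : ((e + 1 : ℕ) : ℕ∞) ≤ ((e : ℕ) : ℕ∞) := WithBot.coe_le_coe.1 (by simpa using h4)
    exact absurd (by exact_mod_cast h5 : e + 1 ≤ e) (by omega)

end Dimension

section GenericParameters

variable {S : Type} [CommRing S] [IsLocalRing S] [IsNoetherianRing S]
  {L : Type} [AddCommGroup L] [Module S L] {𝔞 : Ideal S}

open IsLocalRing

/-- The primes in the support of `L` containing `y 0, …, y (r - 1)` have dimension at most `e`. -/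
def DimLE (L : Type) [AddCommGroup L] [Module S L] (y : ℕ → S) (r e : ℕ) : Prop :=
  ∀ p : Ideal S, p.IsPrime → Module.annihilator S L ≤ p → (∀ i < r, y i ∈ p) →
    ringKrullDim (S ⧸ p) ≤ (e : ℕ∞)

theorem Gen.exists {Φ : S → Prop} (h : Gen 𝔞 Φ) : ∃ y ∈ 𝔞, Φ y := by
  by_contra! hc
  have h1 := h.le_span
  have h2 : {y | y ∈ 𝔞 ∧ Φ y} = ∅ := by
    ext y; simpa using hc y
  rw [h2, Ideal.span_empty, le_bot_iff] at h1
  obtain ⟨ps, h3, h4⟩ := h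
  refine hc 0 (zero_mem _) (h4 0 (zero_mem _) fun p hp => ?_)
  exact absurd (h1 ▸ bot_le) (h3 p hp).2

theorem DimLE.gen_update (hrad : 𝔞.radical = maximalIdeal S) {y : ℕ → S} {r e : ℕ}
    (h : DimLE L y r (e + 1)) :
    Gen 𝔞 fun u => DimLE L (Function.update y r u) (r + 1) e := by
  classical
  let J := Module.annihilator S L ⊔ Ideal.span (y '' {i | i < r})
  have hfin : J.minimalPrimes.Finite := J.finite_minimalPrimes_of_isNoetherianRing
  refine ⟨hfin.toFinset.filter fun p => p ≠ maximalIdeal S, fun p hp => ?_, fun u hu hup => ?_⟩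
  · have hp' : p ∈ J.minimalPrimes ∧ p ≠ maximalIdeal S := by simpa using hp
    have hpr := Ideal.IsMinimalPrime.isPrime hp'.1
    refine ⟨hpr, fun hle => hp'.2 (le_antisymm (le_maximalIdeal hpr.ne_top) ?_)⟩
    rw [← hrad]
    exact hpr.radical_le_iff.2 hle
  · intro q hq hann hyq
    have hJ : J ≤ q := by
      refine sup_le hann (Ideal.span_le.2 ?_)
      rintro _ ⟨i, hi, rfl⟩
      have := hyq i (Nat.lt_succ_of_lt hi)
      rwa [Function.update_of_ne (ne_of_lt hi)] at this
    obtain ⟨p, hp, hpq⟩ := Ideal.exists_minimalPrimes_le hJ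
    have hpr := Ideal.IsMinimalPrime.isPrime hp
    have huq : u ∈ q := by simpa using hyq r (Nat.lt_succ_self r)
    by_cases hpm : p = maximalIdeal S
    · have hqm : q = maximalIdeal S :=
        le_antisymm (le_maximalIdeal hq.ne_top) (hpm ▸ hpq)
      have h0 := ringKrullDim_quotient_le_card (∅ : Finset (Fin 0)) (fun _ => (0 : S)) (by simp) q
        fun q' hq' hle _ => le_antisymm (le_maximalIdeal hq'.ne_top) (hqm ▸ hle)
      refine h0.trans ?_
      simp
    · have hup' : u ∉ p := hup p (by simp [hp, hpm])
      have h1 := ringKrullDim_quotient_succ_le hpq hup' huq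
      have h2 := h p hpr (le_sup_left.trans hp.1.2)
        fun i hi => hp.1.2 (Ideal.mem_sup_right (Ideal.subset_span ⟨i, hi, rfl⟩))
      have h3 := h1.trans h2
      push_cast at h3
      exact (ENat.WithBot.add_le_add_one_right_iff).1 h3

theorem DimLE.exists_extend (hrad : 𝔞.radical = maximalIdeal S) {e : ℕ} : ∀ {y : ℕ → S} {r : ℕ},
    (∀ i, y i ∈ 𝔞) → DimLE L y r e →
    ∃ y' : ℕ → S, (∀ i, y' i ∈ 𝔞) ∧ (∀ i < r, y' i = y i) ∧ DimLE L y' (r + e) 0 := by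
  induction e with
  | zero => exact fun {y r} hy h => ⟨y, hy, fun _ _ => rfl, h⟩
  | succ e ih =>
    intro y r hy h
    obtain ⟨u, hu, hG⟩ := (h.gen_update hrad).exists
    obtain ⟨y', h1, h2, h3⟩ := ih (y := Function.update y r u) (fun i => by
      by_cases hi : i = r
      · subst hi; simpa using hu
      · simpa [Function.update_of_ne hi] using hy i) hG
    refine ⟨y', h1, fun i hi => ?_, by rwa [add_right_comm, add_assoc] at h3⟩
    rw [h2 i (Nat.lt_succ_of_lt hi), Function.update_of_ne (ne_of_lt hi)]

theorem DimLE.eq_maximalIdeal {y : ℕ → S} {r : ℕ} (h : DimLE L y r 0) {q : Ideal S}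
    (hq : q.IsPrime) (hann : Module.annihilator S L ≤ q) (hy : ∀ i < r, y i ∈ q) :
    q = maximalIdeal S := by
  by_contra hne
  obtain ⟨x, hx, hxq⟩ := SetLike.exists_of_lt
    (lt_of_le_of_ne (le_maximalIdeal hq.ne_top) hne)
  have h1 := ringKrullDim_quotient_succ_le (le_maximalIdeal hq.ne_top) hxq hx
  have h2 := h1.trans (h q hq hann hy)
  have h3 : (0 : WithBot ℕ∞) + 1 ≤ _ := (add_le_add_left ringKrullDim_quotient_nonneg 1).trans h2
  have : ((1 : ℕ) : WithBot ℕ∞) ≤ ((0 : ℕ) : WithBot ℕ∞) := by simpa using h3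
  exact absurd (by exact_mod_cast this : 1 ≤ 0) (by norm_num)

theorem image_val_lt {S : Type} (y : ℕ → S) {d r : ℕ} (hr : r ≤ d) :
    (fun i : Fin d => y i) '' {x : Fin d | (x : ℕ) < r} = y '' {i | i < r} := by
  ext z
  constructor
  · rintro ⟨i, hi, rfl⟩
    exact ⟨i, hi, rfl⟩
  · rintro ⟨i, hi, rfl⟩
    exact ⟨⟨i, lt_of_lt_of_le hi hr⟩, hi, rfl⟩

theorem DimLE.moduleDim_le [Module.Finite S L] {y : ℕ → S} {d : ℕ} (h : DimLE L y d 0) :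
    moduleDim S (L ⧸ (Ideal.span (Set.range fun i : Fin d => y i) • (⊤ : Submodule S L))) ≤ 0 := by
  refine moduleDim_le_zero_iff.2 fun q hq hle => ?_
  obtain ⟨h1, h2⟩ := annihilator_quotient_smul_le_iff.1 hle
  exact h.eq_maximalIdeal hq h1 fun i hi => h2 (Ideal.subset_span ⟨⟨i, hi⟩, rfl⟩)

/-- If every system of parameters in `𝔞` kills the torsion of the quotients by its initial
segments, then `𝔞` has a tower of depth `dim L`. -/
theorem exists_rich_of_parameters [Module.Finite S L] (hrad : 𝔞.radical = maximalIdeal S) {d : ℕ}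
    (hd : moduleDim S L ≤ (d : ℕ∞))
    (hpar : ∀ a : Fin d → S, (∀ i, a i ∈ 𝔞) →
      moduleDim S (L ⧸ (Ideal.span (Set.range a) • (⊤ : Submodule S L))) ≤ 0 → ∀ j < d,
      ∀ z ∈ sat 𝔞 (Ideal.span (a '' {x : Fin d | (x : ℕ) < j}) • (⊤ : Submodule S L)), ∀ i,
        a i • z ∈ (Ideal.span (a '' {x : Fin d | (x : ℕ) < j}) • (⊤ : Submodule S L))) :
    ∃ I : Finset (ℕ × S), Rich 𝔞 Prod.snd d I ∧
      HT 𝔞 Prod.snd (GoodPos 𝔞) d I (⊥ : Submodule S L) := by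
  let G : ℕ → Submodule S L → Prop := fun e Q => ∃ (y : ℕ → S) (r : ℕ), (∀ i, y i ∈ 𝔞) ∧
    r + e = d ∧ Q = Ideal.span (y '' {i | i < r}) • ⊤ ∧ DimLE L y r e
  have hupd : ∀ (y : ℕ → S) (r : ℕ) (u : S), adj (Ideal.span (y '' {i | i < r}) • ⊤) u =
      Ideal.span (Function.update y r u '' {i | i < r + 1}) • (⊤ : Submodule S L) := by
    intro y r u
    rw [adj_smul_top, ← Ideal.span_union]
    congr 2
    ext z
    constructor
    · rintro (⟨i, hi, rfl⟩ | rfl)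
      · exact ⟨i, Nat.lt_succ_of_lt hi, by rw [Function.update_of_ne (ne_of_lt hi)]⟩
      · exact ⟨r, Nat.lt_succ_self r, by simp⟩
    · rintro ⟨i, hi, rfl⟩
      rcases Nat.lt_succ_iff_lt_or_eq.1 hi with hi | rfl
      · exact Or.inl ⟨i, hi, by rw [Function.update_of_ne (ne_of_lt hi)]⟩
      · right; simp
  have hmem : ∀ {y : ℕ → S} {r : ℕ} {u : S}, (∀ i, y i ∈ 𝔞) → u ∈ 𝔞 →
      ∀ i, Function.update y r u i ∈ 𝔞 := by
    intro y r u hy hu i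
    by_cases hi : i = r
    · subst hi; simpa using hu
    · simpa [Function.update_of_ne hi] using hy i
  have hG : GenStable 𝔞 G := ⟨by
    rintro e _ ⟨y, r, hy, hre, rfl, hdim⟩
    exact (hdim.gen_update hrad).mono fun u hu hu' =>
      ⟨Function.update y r u, r + 1, hmem hy hu, by omega, hupd y r u, hu'⟩⟩
  have hgood : ∀ e Q, G e Q → GoodPos 𝔞 e Q := by
    rintro e _ ⟨y, r, hy, hre, rfl, hdim⟩ he z hz c hc
    obtain ⟨e, rfl⟩ : ∃ e', e = e' + 1 := ⟨e - 1, by omega⟩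
    have hgen := hdim.gen_update hrad
    refine Submodule.span_induction (p := fun c _ => c • z ∈ _)
      ?_ (by simp) (fun _ _ _ _ h h' => ?_) (fun s _ _ h => ?_) (hgen.le_span hc)
    · rintro u ⟨hu, hdu⟩
      obtain ⟨y', h1, h2, h3⟩ := hdu.exists_extend hrad (hmem hy hu)
      rw [show r + 1 + e = d by omega] at h3
      have himg : (fun i : Fin d => y' i) '' {x : Fin d | (x : ℕ) < r} = y '' {i | i < r} := by
        rw [image_val_lt y' (by omega)]
        refine Set.image_congr fun i hi => ?_
        rw [h2 i (Nat.lt_succ_of_lt hi), Function.update_of_ne (ne_of_lt hi)]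
      have := hpar (fun i => y' i) (fun i => h1 i) h3.moduleDim_le r (by omega)
      rw [himg] at this
      have := this z hz ⟨r, by omega⟩
      simpa [h2 r (Nat.lt_succ_self r)] using this
    · rw [add_smul]; exact Submodule.add_mem _ h h'
    · rw [smul_assoc]; exact Submodule.smul_mem _ s h
  have h0 : G d (⊥ : Submodule S L) := by
    refine ⟨fun _ => 0, 0, fun _ => zero_mem _, by omega, by simp, fun p hp hann _ => ?_⟩
    exact (ringKrullDim_le_of_surjective (Ideal.Quotient.factor hann)
      (Ideal.Quotient.factor_surjective hann)).trans hd
  obtain ⟨I, hI, h⟩ := hG.exists_rich h0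
  exact ⟨I, hI, h.mono hgood⟩

end GenericParameters

section GenericFlatness

variable {A : Type} [CommRing A] {N : Type} [AddCommGroup N] [Module A N]

/-- After inverting `c`, the quotient `U / V` satisfies the equational criterion for flatness. -/
def FlatAway (c : A) (V U : Submodule A N) : Prop :=
  ∀ (ι : Type) (_ : Fintype ι) (f : ι → A) (n : ι → N), (∀ i, n i ∈ U) → ∑ i, f i • n i ∈ V →
    ∃ (j : ℕ) (κ : Type) (_ : Fintype κ) (a : ι → κ → A) (y : κ → N), (∀ l, y l ∈ U) ∧
      (∀ i, c ^ j • n i - ∑ l, a i l • y l ∈ V) ∧ ∀ l, ∑ i, f i * a i l = 0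

theorem sum_smul_sub_eq {ι κ : Type} [Fintype ι] [Fintype κ] (r : A) (f : ι → A) (n : ι → N)
    (a : ι → κ → A) (y : κ → N) (h : ∀ l, ∑ i, f i * a i l = 0) :
    ∑ i, f i • (r • n i - ∑ l, a i l • y l) = r • ∑ i, f i • n i := by
  have h1 : ∑ i, f i • ∑ l, a i l • y l = 0 := by
    simp only [Finset.smul_sum, smul_smul]
    rw [Finset.sum_comm]
    exact Finset.sum_eq_zero fun l _ => by rw [← Finset.sum_smul, h l, zero_smul]
  simp only [smul_sub, Finset.sum_sub_distrib]
  rw [h1, sub_zero, Finset.smul_sum]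
  exact Finset.sum_congr rfl fun i _ => smul_comm (f i) r (n i)

theorem FlatAway.refl (c : A) (V : Submodule A N) : FlatAway c V V := fun ι _ f n hn _ =>
  ⟨0, Empty, inferInstance, fun _ l => l.elim, fun l => l.elim, fun l => l.elim,
    fun i => by simpa using hn i, fun l => l.elim⟩

theorem FlatAway.trans {c : A} {V U T : Submodule A N} (hUT : U ≤ T) (hVU : V ≤ U)
    (h : FlatAway c V U) (h' : FlatAway c U T) : FlatAway c V T := by
  intro ι _ f n hn hs
  obtain ⟨j, κ, _, a, y, hy, h1, h2⟩ := h' ι _ f n hn (hVU hs)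
  obtain ⟨j', κ', _, a', y', hy', h1', h2'⟩ := h ι _ f _ h1 (by
    rw [sum_smul_sub_eq _ _ _ _ _ h2]; exact V.smul_mem _ hs)
  refine ⟨j' + j, κ ⊕ κ', inferInstance, fun i => Sum.elim (fun l => c ^ j' * a i l) (a' i),
    Sum.elim y y', ?_, fun i => ?_, ?_⟩
  · rintro (l | l)
    exacts [hy l, hUT (hy' l)]
  · convert h1' i using 1
    simp only [Fintype.sum_sum_type, Sum.elim_inl, Sum.elim_inr, smul_sub, Finset.smul_sum,
      smul_smul, pow_add]
    abel
  · rintro (l | l)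
    · simp only [Sum.elim_inl]
      rw [← mul_zero (c ^ j'), ← h2 l, Finset.mul_sum]
      exact Finset.sum_congr rfl fun i _ => by ring
    · exact h2' l

theorem FlatAway.mul {c : A} {V U : Submodule A N} (h : FlatAway c V U) (d : A) :
    FlatAway (c * d) V U := by
  intro ι _ f n hn hs
  obtain ⟨j, κ, _, a, y, hy, h1, h2⟩ := h ι _ f n hn hs
  refine ⟨j, κ, inferInstance, fun i l => d ^ j * a i l, y, hy, fun i => ?_, fun l => ?_⟩
  · convert V.smul_mem (d ^ j) (h1 i) using 1
    simp only [smul_sub, Finset.smul_sum, smul_smul, mul_pow]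
    rw [mul_comm (d ^ j)]
  · rw [← mul_zero (d ^ j), ← h2 l, Finset.mul_sum]
    exact Finset.sum_congr rfl fun i _ => by ring

theorem FlatAway.of_dvd {c d : A} {V U : Submodule A N} (h : FlatAway c V U) (hd : c ∣ d) :
    FlatAway d V U := by
  obtain ⟨e, rfl⟩ := hd
  exact h.mul e

theorem FlatAway.map {N' : Type} [AddCommGroup N'] [Module A N'] {c : A} {V U : Submodule A N}
    (h : FlatAway c V U) (g : N →ₗ[A] N') {V' : Submodule A N'} (hV : V'.comap g ⊓ U ≤ V)
    (hV' : V ≤ V'.comap g) : FlatAway c V' (V' ⊔ U.map g) := by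
  intro ι _ f n hn hs
  have : ∀ i, ∃ u ∈ U, n i - g u ∈ V' := fun i => by
    obtain ⟨v, hv, u', hu', he⟩ := Submodule.mem_sup.1 (hn i)
    obtain ⟨u, hu, rfl⟩ := hu'
    exact ⟨u, hu, by rw [← he]; simpa using hv⟩
  choose u hu hnu using this
  have hs' : ∑ i, f i • u i ∈ V := by
    refine hV ⟨?_, U.sum_mem fun i _ => U.smul_mem _ (hu i)⟩
    change g _ ∈ V'
    have := V'.sub_mem hs (V'.sum_mem fun i (_ : i ∈ Finset.univ) => V'.smul_mem (f i) (hnu i))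
    rw [← Finset.sum_sub_distrib] at this
    convert this using 1
    simp [map_sum, smul_sub]
  obtain ⟨j, κ, _, a, y, hy, h1, h2⟩ := h ι _ f u hu hs'
  refine ⟨j, κ, inferInstance, a, g ∘ y, fun l => Submodule.mem_sup_right ⟨_, hy l, rfl⟩,
    fun i => ?_, h2⟩
  have := V'.add_mem (V'.smul_mem (c ^ j) (hnu i)) (hV' (h1 i))
  convert this using 1
  simp [map_sum, smul_sub]

theorem FlatAway.iSup {c : A} {V : Submodule A N} {U : ℕ → Submodule A N} (hU : Monotone U)
    (h : ∀ i, FlatAway c V (U i)) (htop : ∀ n, ∃ i, n ∈ U i) : FlatAway c V ⊤ := by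
  intro ι _ f n _ hs
  choose i hi using fun s => htop (n s)
  obtain ⟨M, hM⟩ := (Finset.univ.image i).bddAbove
  obtain ⟨j, κ, _, a, y, _, h1, h2⟩ := h M ι _ f n
    (fun s => hU (hM (by simp)) (hi s)) hs
  exact ⟨j, κ, inferInstance, a, y, fun _ => trivial, h1, h2⟩

theorem exists_sum_of_mem_ideal_smul {q : Ideal A} {w : N} (hq : w ∈ q • (⊤ : Submodule A N)) :
    ∃ (ι : Type) (_ : Fintype ι) (f : ι → A) (n : ι → N), (∀ i, f i ∈ q) ∧
      ∑ i, f i • n i = w := by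
  refine Submodule.smul_induction_on hq (fun r hr n _ => ?_) ?_
  · exact ⟨Unit, inferInstance, fun _ => r, fun _ => n, fun _ => hr, by simp⟩
  · rintro _ _ ⟨ι, _, f, n, hf, rfl⟩ ⟨ι', _, f', n', hf', rfl⟩
    refine ⟨ι ⊕ ι', inferInstance, Sum.elim f f', Sum.elim n n', ?_, by simp⟩
    rintro (i | i)
    exacts [hf i, hf' i]

theorem FlatAway.exists_mem_ideal_smul {c : A} {V : Submodule A N} (h : FlatAway c V ⊤)
    {q : Ideal A} {w : N} (hw : w ∈ V) (hq : w ∈ q • (⊤ : Submodule A N)) :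
    ∃ j : ℕ, c ^ j • w ∈ q • V := by
  obtain ⟨ι, _, f, n, hf, rfl⟩ := exists_sum_of_mem_ideal_smul hq
  obtain ⟨j, κ, _, a, y, _, h1, h2⟩ := h ι _ f n (fun _ => trivial) hw
  refine ⟨j, ?_⟩
  rw [← sum_smul_sub_eq _ _ _ _ _ h2]
  exact Submodule.sum_mem _ fun i _ => Submodule.smul_mem_smul (hf i) (h1 i)

/-- Finitely generated modules over the `A`-algebra `R` are generically flat over `A`. -/
def GenericallyFlat (A R : Type) [CommRing A] [CommRing R] [Algebra A R] : Prop :=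
  ∀ (N : Type) [AddCommGroup N] [Module A N] [Module R N] [IsScalarTower A R N]
    [Module.Finite R N] (V : Submodule R N),
    ∃ c : A, c ≠ 0 ∧ FlatAway c (V.restrictScalars A) ⊤

theorem genericallyFlat_self (A : Type) [CommRing A] [IsDomain A] : GenericallyFlat A A := by
  classical
  intro N _ i1 i2 i3 _ V
  obtain rfl : i1 = i2 := by
    refine Module.ext' _ _ fun a n => ?_
    have := i3.smul_assoc a 1 n
    simpa using this.symm
  have key : ∀ s : Finset N, ∃ c : A, c ≠ 0 ∧ FlatAway c V (V ⊔ Submodule.span A s) := by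
    intro s
    induction s using Finset.induction_on with
    | empty => exact ⟨1, one_ne_zero, by simpa using FlatAway.refl 1 V⟩
    | insert g s _ ih =>
      obtain ⟨c, hc, h⟩ := ih
      set U := V ⊔ Submodule.span A (s : Set N) with hU
      have hU' : V ⊔ Submodule.span A (↑(insert g s) : Set N) = U ⊔ Submodule.span A {g} := by
        rw [Finset.coe_insert, Submodule.span_insert, hU]
        ac_rfl
      obtain ⟨d, hd, h'⟩ : ∃ d : A, d ≠ 0 ∧ FlatAway d U (U ⊔ Submodule.span A {g}) := by
        by_cases hI : ∃ d : A, d ≠ 0 ∧ d • g ∈ U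
        · obtain ⟨d, hd, hdg⟩ := hI
          refine ⟨d, hd, fun ι _ f n hn _ => ⟨1, Empty, inferInstance, fun _ l => l.elim,
            fun l => l.elim, fun l => l.elim, fun i => ?_, fun l => l.elim⟩⟩
          obtain ⟨u, hu, t, ht, he⟩ := Submodule.mem_sup.1 (hn i)
          obtain ⟨t, rfl⟩ := Submodule.mem_span_singleton.1 ht
          rw [← he]
          have := U.add_mem (U.smul_mem d hu) (U.smul_mem t hdg)
          simpa [smul_add, smul_comm d t] using this
        · push Not at hI
          refine ⟨1, one_ne_zero, fun ι _ f n hn hs => ?_⟩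
          have : ∀ i, ∃ t : A, n i - t • g ∈ U := fun i => by
            obtain ⟨u, hu, t, ht, he⟩ := Submodule.mem_sup.1 (hn i)
            obtain ⟨t, rfl⟩ := Submodule.mem_span_singleton.1 ht
            exact ⟨t, by rw [← he]; simpa using hu⟩
          choose t ht using this
          refine ⟨0, Unit, inferInstance, fun i _ => t i, fun _ => g, fun _ =>
            Submodule.mem_sup_right (Submodule.mem_span_singleton_self g),
            fun i => by simpa using ht i, fun _ => ?_⟩
          by_contra hne
          refine hI _ hne ?_
          have := U.sub_mem hs (U.sum_mem fun i (_ : i ∈ Finset.univ) => U.smul_mem (f i) (ht i))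
          rw [← Finset.sum_sub_distrib] at this
          convert this using 1
          simp [Finset.sum_smul, smul_smul, smul_sub]
      refine ⟨c * d, mul_ne_zero hc hd, ?_⟩
      rw [hU']
      exact (h.mul d).trans le_sup_left le_sup_left (h'.of_dvd (dvd_mul_left d c))
  obtain ⟨s, hs⟩ := Module.Finite.fg_top (R := A) (M := N)
  obtain ⟨c, hc, h⟩ := key s
  refine ⟨c, hc, ?_⟩
  rw [hs, sup_top_eq] at h
  exact h

theorem GenericallyFlat.of_surjective {A R R' : Type} [CommRing A] [CommRing R] [Algebra A R]
    [CommRing R'] [Algebra A R'] (h : GenericallyFlat A R) (g : R →ₐ[A] R')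
    (hg : Function.Surjective g) : GenericallyFlat A R' := by
  intro N _ _ _ _ _ V
  let : Module R N := Module.compHom N (g : R →+* R')
  have hsm : ∀ (r : R) (n : N), r • n = g r • n := fun _ _ => rfl
  have : IsScalarTower A R N := ⟨fun a r n => by
    rw [hsm, hsm, map_smul, smul_assoc]⟩
  have : Module.Finite R N := by
    obtain ⟨s, hs⟩ := Module.Finite.fg_top (R := R') (M := N)
    refine ⟨⟨s, eq_top_iff.2 fun n _ => ?_⟩⟩
    have hn : n ∈ Submodule.span R' (s : Set N) := hs ▸ trivial
    refine Submodule.span_induction (fun x hx => Submodule.subset_span hx) (zero_mem _)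
      (fun _ _ _ _ h h' => add_mem h h') (fun r x _ hx => ?_) hn
    obtain ⟨r, rfl⟩ := hg r
    exact Submodule.smul_mem _ r hx
  obtain ⟨c, hc, h⟩ := h N { V with smul_mem' := fun r n hn => V.smul_mem (g r) hn }
  exact ⟨c, hc, h⟩

open Polynomial in
theorem GenericallyFlat.polynomial {A R : Type} [CommRing A] [IsDomain A] [CommRing R] [Algebra A R]
    [IsNoetherianRing R] (h : GenericallyFlat A R) : GenericallyFlat A R[X] := by
  classical
  intro N _ _ _ _ _ V
  let : Module R N := Module.compHom N (Polynomial.C : R →+* R[X])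
  have hsm : ∀ (r : R) (n : N), r • n = (Polynomial.C r : R[X]) • n := fun _ _ => rfl
  have : IsScalarTower A R N := ⟨fun a r n => by
    rw [hsm, hsm, ← Polynomial.smul_C, smul_assoc]⟩
  let T : N →ₗ[R] N :=
    { toFun := fun n => (Polynomial.X : R[X]) • n
      map_add' := fun _ _ => smul_add _ _ _
      map_smul' := fun r n => by
        simp only [hsm, RingHom.id_apply, smul_smul]
        rw [Polynomial.X_mul] }
  have hT : ∀ n, T n = (Polynomial.X : R[X]) • n := fun _ => rfl
  let V' : Submodule R N := { V with smul_mem' := fun r n hn => V.smul_mem (Polynomial.C r) hn }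
  obtain ⟨s, hs⟩ := Module.Finite.fg_top (R := R[X]) (M := N)
  let M := Submodule.span R (s : Set N)
  let U : ℕ → Submodule R N := fun i => Nat.rec V' (fun i Ui => Ui ⊔ M.map (T ^ i)) i
  have hU0 : U 0 = V' := rfl
  have hUs : ∀ i, U (i + 1) = U i ⊔ M.map (T ^ i) := fun _ => rfl
  have hUmono : Monotone U := monotone_nat_of_le_succ fun i => le_sup_left
  have hTU : ∀ i, U i ≤ (U (i + 1)).comap T := by
    intro i
    induction i with
    | zero =>
      intro v hv
      exact hUmono (Nat.zero_le 1) (V.smul_mem Polynomial.X hv)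
    | succ i ih =>
      rw [hUs i]
      refine sup_le (ih.trans (Submodule.comap_mono (hUmono (Nat.le_succ (i + 1))))) ?_
      rintro _ ⟨m, hm, rfl⟩
      rw [Submodule.mem_comap, hUs (i + 1)]
      exact Submodule.mem_sup_right ⟨m, hm, by rw [pow_succ']; rfl⟩
  have : Module.Finite R M := Module.Finite.span_finset R s
  let κ : ℕ →o Submodule R M := ⟨fun i => ((U i).comap (T ^ i)).comap M.subtype,
    monotone_nat_of_le_succ fun i m hm => by
      have := hTU i hm
      simp only [Submodule.mem_comap] at this ⊢
      rwa [pow_succ']⟩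
  obtain ⟨i0, hi0⟩ := monotone_stabilizes_iff_noetherian.2 (inferInstance : IsNoetherian R M) κ
  choose c hc hflat using fun i => h M (κ i)
  have htop : ∀ n, ∃ i, n ∈ U i := by
    intro n
    have hn : n ∈ Submodule.span R[X] (s : Set N) := hs ▸ trivial
    refine Submodule.span_induction (fun x hx => ⟨1, ?_⟩) ⟨0, zero_mem _⟩ ?_ ?_ hn
    · exact Submodule.mem_sup_right ⟨x, Submodule.subset_span hx, rfl⟩
    · rintro x y _ _ ⟨i, hi⟩ ⟨j, hj⟩
      exact ⟨max i j, add_mem (hUmono (le_max_left _ _) hi) (hUmono (le_max_right _ _) hj)⟩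
    · rintro p x _ hx
      induction p using Polynomial.induction_on generalizing x with
      | C a =>
        obtain ⟨i, hi⟩ := hx
        exact ⟨i, (U i).smul_mem a hi⟩
      | add p q hp hq =>
        obtain ⟨i, hi⟩ := hp x ‹_› hx
        obtain ⟨j, hj⟩ := hq x ‹_› hx
        exact ⟨max i j, by
          rw [add_smul]
          exact add_mem (hUmono (le_max_left _ _) hi) (hUmono (le_max_right _ _) hj)⟩
      | monomial n a ih =>
        obtain ⟨i, hi⟩ := ih x ‹_› hx
        refine ⟨i + 1, ?_⟩
        have := hTU i hi
        rwa [Submodule.mem_comap, hT, smul_smul, mul_left_comm, ← pow_succ'] at this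
  refine ⟨∏ i ∈ Finset.range (i0 + 1), c i, Finset.prod_ne_zero_iff.2 fun i _ => hc i, ?_⟩
  have hstep : ∀ i, FlatAway (∏ i ∈ Finset.range (i0 + 1), c i) ((U i).restrictScalars A)
      ((U (i + 1)).restrictScalars A) := by
    intro i
    obtain ⟨i', hi', he⟩ : ∃ i' ∈ Finset.range (i0 + 1), κ i' = κ i := by
      rcases le_total i i0 with hi | hi
      · exact ⟨i, by simpa [Nat.lt_succ_iff] using hi, rfl⟩
      · exact ⟨i0, by simp, hi0 i hi⟩
    have h1 := (hflat i').of_dvd (Finset.dvd_prod_of_mem c hi')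
    rw [he] at h1
    have h2 := h1.map (((T ^ i) ∘ₗ M.subtype).restrictScalars A)
      (V' := (U i).restrictScalars A) (fun x hx => hx.1) (fun x hx => hx)
    convert h2 using 1
    rw [hUs]
    ext x
    simp [Submodule.mem_sup, M]
  refine FlatAway.iSup (U := fun i => (U i).restrictScalars A) (fun i j hij => hUmono hij) (fun i => ?_) htop
  induction i with
  | zero => exact FlatAway.refl _ _
  | succ i ih =>
    exact FlatAway.trans (hUmono (Nat.le_succ i)) (hUmono (Nat.zero_le i)) ih (hstep i)

theorem genericallyFlat_mvPolynomial (A : Type) [CommRing A] [IsDomain A] [IsNoetherianRing A]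
    (n : ℕ) : GenericallyFlat A (MvPolynomial (Fin n) A) := by
  induction n with
  | zero =>
    exact (genericallyFlat_self A).of_surjective (MvPolynomial.isEmptyAlgEquiv A (Fin 0)).symm.toAlgHom
      (MvPolynomial.isEmptyAlgEquiv A (Fin 0)).symm.surjective
  | succ n ih =>
    exact ih.polynomial.of_surjective (MvPolynomial.finSuccEquiv A n).symm.toAlgHom
      (MvPolynomial.finSuccEquiv A n).symm.surjective

end GenericFlatness

section Exactness

variable {A B : Type} [CommRing A] [CommRing B] [Algebra A B]

/-- `T` is, through `ρ`, a localization of the fibre `B ⧸ qB` in which the elements of `A`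
outside `q` are invertible. -/
structure IsFibreLoc (q : Ideal A) {T : Type} [CommRing T] (ρ : B →+* T) : Prop where
  exists_num : ∀ x : T, ∃ b g : B, IsUnit (ρ g) ∧ ρ g * x = ρ b
  exists_smul : ∀ b : B, ρ b = 0 → ∃ g : B, IsUnit (ρ g) ∧ g * b ∈ q • (⊤ : Submodule A B)
  map_eq_zero : ∀ a ∈ q, ρ (algebraMap A B a) = 0
  isUnit_map : ∀ a, a ∉ q → IsUnit (ρ (algebraMap A B a))

variable {q : Ideal A} {T : Type} [CommRing T] {ρ : B →+* T}

theorem exists_common_num {ι : Type} [Fintype ι]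
    (h : ∀ x : T, ∃ b g : B, IsUnit (ρ g) ∧ ρ g * x = ρ b) (v : ι → T) :
    ∃ (b : ι → B) (g : B), IsUnit (ρ g) ∧ ∀ i, ρ g * v i = ρ (b i) := by
  classical
  choose b g hg hb using fun i => h (v i)
  refine ⟨fun i => (∏ j ∈ Finset.univ.erase i, g j) * b i, ∏ j, g j, ?_, fun i => ?_⟩
  · rw [map_prod, IsUnit.prod_univ_iff]
    exact hg
  · rw [← Finset.prod_erase_mul _ _ (Finset.mem_univ i), map_mul, map_mul, mul_assoc, hb]

theorem IsFibreLoc.map_eq_zero_of_mem (h : IsFibreLoc q ρ) {b : B}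
    (hb : b ∈ q • (⊤ : Submodule A B)) : ρ b = 0 := by
  refine Submodule.smul_induction_on hb (fun a ha n _ => ?_) fun x y hx hy => ?_
  · rw [Algebra.smul_def, map_mul, h.map_eq_zero a ha, zero_mul]
  · rw [map_add, hx, hy, add_zero]

theorem mem_smul_top_pi {ι : Type} [Fintype ι] {q : Ideal A} {b : ι → B} :
    b ∈ q • (⊤ : Submodule A (ι → B)) ↔ ∀ i, b i ∈ q • (⊤ : Submodule A B) := by
  classical
  constructor
  · intro h i
    have := Submodule.mem_map_of_mem (f := LinearMap.proj (R := A) (φ := fun _ : ι => B) i) h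
    rw [Submodule.map_smul''] at this
    exact Submodule.smul_mono le_rfl le_top this
  · intro h
    have : b = ∑ i, LinearMap.single A (fun _ : ι => B) i (b i) := by
      ext j; simp [Finset.sum_apply, Pi.single_apply]
    rw [this]
    refine Submodule.sum_mem _ fun i _ => ?_
    have := Submodule.mem_map_of_mem (f := LinearMap.single A (fun _ : ι => B) i) (h i)
    rw [Submodule.map_smul''] at this
    exact Submodule.smul_mono le_rfl le_top this

theorem IsFibreLoc.exists_smul_pi (h : IsFibreLoc q ρ) {ι : Type} [Fintype ι] (b : ι → B)
    (hb : ∀ i, ρ (b i) = 0) :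
    ∃ g : B, IsUnit (ρ g) ∧ g • b ∈ q • (⊤ : Submodule A (ι → B)) := by
  classical
  choose g hg hgb using fun i => h.exists_smul (b i) (hb i)
  refine ⟨∏ i, g i, by rw [map_prod, IsUnit.prod_univ_iff]; exact hg, ?_⟩
  rw [mem_smul_top_pi]
  intro i
  rw [Pi.smul_apply, ← Finset.prod_erase_mul _ _ (Finset.mem_univ i), smul_eq_mul, mul_assoc]
  have := Submodule.mem_map_of_mem
    (f := LinearMap.mulLeft A (∏ j ∈ Finset.univ.erase i, g j)) (hgb i)
  rw [Submodule.map_smul''] at this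
  exact Submodule.smul_mono le_rfl le_top this

/-- The kernel of a matrix commutes with specialization, generically. -/
theorem exists_ker_matrix [IsDomain A] [IsNoetherianRing B] (hflat : GenericallyFlat A B)
    {ι κ : Type} [Fintype ι] [Fintype κ] (D : Matrix ι κ B) :
    ∃ (l : ℕ) (C : Matrix κ (Fin l) B) (c : A), c ≠ 0 ∧ D * C = 0 ∧
      ∀ (q : Ideal A) (T : Type) [CommRing T] (ρ : B →+* T), IsFibreLoc q ρ → c ∉ q →
        ∀ v : κ → T, (D.map ρ).mulVec v = 0 → ∃ z : Fin l → T, v = (C.map ρ).mulVec z := by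
  classical
  obtain ⟨l, w, hw⟩ := Submodule.fg_iff_exists_fin_generating_family.1
    (IsNoetherian.noetherian (LinearMap.ker D.mulVecLin))
  let C : Matrix κ (Fin l) B := Matrix.of fun i j => w j i
  have hCv : ∀ z, C.mulVec z = ∑ j, z j • w j := by
    intro z; ext i
    simp [Matrix.mulVec, dotProduct, C, mul_comm]
  have hker : ∀ v, D.mulVec v = 0 → ∃ z, v = C.mulVec z := by
    intro v hv
    have : v ∈ Submodule.span B (Set.range w) := by
      rw [hw]; exact hv
    obtain ⟨z, hz⟩ := (Submodule.mem_span_range_iff_exists_fun B).1 this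
    exact ⟨z, by rw [hCv, hz]⟩
  obtain ⟨c, hc, hcf⟩ := hflat (ι → B) (LinearMap.range D.mulVecLin)
  refine ⟨l, C, c, hc, ?_, fun q T _ ρ hρ hcq v hv => ?_⟩
  · ext i j
    have : w j ∈ LinearMap.ker D.mulVecLin := hw ▸ Submodule.subset_span ⟨j, rfl⟩
    exact congrFun (LinearMap.mem_ker.1 this) i
  · obtain ⟨b, g, hg, hb⟩ := exists_common_num hρ.exists_num v
    have hmap : ∀ b : κ → B, ∀ i, ρ (D.mulVec b i) = (D.map ρ).mulVec (ρ ∘ b) i := fun b i => by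
      simp [Matrix.mulVec, dotProduct]
    have hb' : ρ ∘ b = ρ g • v := by ext i; simp [hb]
    obtain ⟨g', hg', hgb⟩ := hρ.exists_smul_pi (D.mulVec b) fun i => by
      rw [hmap, hb', Matrix.mulVec_smul, hv, smul_zero, Pi.zero_apply]
    obtain ⟨j, hj⟩ := hcf.exists_mem_ideal_smul (w := g' • D.mulVec b)
      ⟨g' • b, by simp⟩ hgb
    have hrange : q • (LinearMap.range D.mulVecLin).restrictScalars A =
        (q • (⊤ : Submodule A (κ → B))).map (D.mulVecLin.restrictScalars A) := by
      rw [Submodule.map_smul'']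
      congr 1
      ext x; simp
    rw [hrange] at hj
    obtain ⟨v', hv', he⟩ := hj
    obtain ⟨z, hz⟩ := hker (algebraMap A B (c ^ j) • g' • b - v') (by
      rw [Matrix.mulVec_sub, Matrix.mulVec_smul, Matrix.mulVec_smul, sub_eq_zero]
      rw [algebraMap_smul]
      exact he.symm)
    have hu : IsUnit (ρ (algebraMap A B (c ^ j)) * (ρ g' * ρ g)) := by
      rw [map_pow, map_pow]
      exact ((hρ.isUnit_map c hcq).pow j).mul (hg'.mul hg)
    obtain ⟨u, hu⟩ := hu
    refine ⟨((u⁻¹ : Tˣ) : T) • (ρ ∘ z), ?_⟩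
    rw [Matrix.mulVec_smul]
    have h1 : (C.map ρ).mulVec (ρ ∘ z) = (u : T) • v := by
      ext i
      have h2 := congrArg ρ (congrFun hz i)
      have h3 : ρ (v' i) = 0 := hρ.map_eq_zero_of_mem (mem_smul_top_pi.1 hv' i)
      have h4 : ρ (C.mulVec z i) = (C.map ρ).mulVec (ρ ∘ z) i := by
        simp [Matrix.mulVec, dotProduct]
      rw [h4] at h2
      rw [← h2, hu]
      simp [h3, ← hb, mul_assoc]
    rw [h1, smul_smul, Units.inv_mul, one_smul]

/-- A nonzerodivisor modulo an ideal generically stays so modulo the specialized ideal. -/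
theorem exists_nzd [IsDomain A] [IsNoetherianRing B] (hflat : GenericallyFlat A B)
    (J : Ideal B) [hJ : J.IsPrime] {p : B} (hp : p ∉ J) :
    ∃ c : A, c ≠ 0 ∧ ∀ (q : Ideal A) (T : Type) [CommRing T] (ρ : B →+* T), IsFibreLoc q ρ →
      c ∉ q → ∀ x, ρ p * x ∈ J.map ρ → x ∈ J.map ρ := by
  classical
  obtain ⟨r, h, hh⟩ := Submodule.fg_iff_exists_fin_generating_family.1
    (IsNoetherian.noetherian J)
  obtain ⟨l, C, c, hc, hDC, hC⟩ := exists_ker_matrix hflat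
    (Matrix.of fun (_ : Unit) (i : Option (Fin r)) => i.elim p h)
  refine ⟨c, hc, fun q T _ ρ hρ hcq x hx => ?_⟩
  have hgen : J.map ρ = Ideal.span (Set.range (ρ ∘ h)) := by
    rw [← hh, Set.range_comp]
    exact Ideal.map_span ρ _
  rw [hgen] at hx
  obtain ⟨y, hy⟩ := (Submodule.mem_span_range_iff_exists_fun T).1 hx
  obtain ⟨z, hz⟩ := hC q T ρ hρ hcq (fun i => i.elim x fun j => - y j) (by
    ext i
    simp only [Matrix.mulVec, dotProduct, Fintype.sum_option, Matrix.map_apply, Matrix.of_apply,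
      Option.elim, Pi.zero_apply]
    rw [← hy]
    simp [mul_comm])
  have h0 := congrFun hz none
  simp only [Option.elim] at h0
  rw [h0]
  simp only [Matrix.mulVec, dotProduct, Matrix.map_apply]
  refine Ideal.sum_mem _ fun j _ => Ideal.mul_mem_right _ _ (Ideal.mem_map_of_mem ρ ?_)
  have h1 := congrFun (congrFun hDC ()) j
  simp only [Matrix.mul_apply, Fintype.sum_option, Matrix.of_apply, Option.elim,
    Matrix.zero_apply] at h1
  have h2 : p * C none j ∈ J := by
    rw [eq_neg_of_add_eq_zero_left h1]
    exact J.neg_mem (Ideal.sum_mem _ fun i _ => Ideal.mul_mem_right _ _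
      (hh ▸ Submodule.subset_span ⟨i, rfl⟩))
  exact (hJ.mem_or_mem h2).resolve_left hp

end Exactness

section FibreLoc

variable {A B : Type} [CommRing A] [CommRing B] [Algebra A B]
variable {q : Ideal A} {T : Type} [CommRing T] {ρ : B →+* T}

theorem IsFibreLoc.localization (h : IsFibreLoc q ρ) (M : Submonoid T) {T' : Type} [CommRing T']
    [Algebra T T'] [IsLocalization M T'] : IsFibreLoc q ((algebraMap T T').comp ρ) where
  exists_num x := by
    obtain ⟨⟨y, s⟩, hs⟩ := IsLocalization.surj M x
    obtain ⟨b, g, hg, hb⟩ := h.exists_num y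
    obtain ⟨b', g', hg', hb'⟩ := h.exists_num s
    have hu : IsUnit (algebraMap T T' (ρ b')) := by
      rw [← hb', map_mul]
      exact (hg'.map (algebraMap T T')).mul (IsLocalization.map_units T' s)
    refine ⟨g' * b, g * b', ?_, ?_⟩
    · rw [map_mul]; exact IsUnit.mul (hg.map (algebraMap T T')) hu
    · simp only [RingHom.comp_apply, map_mul] at *
      rw [← hb, ← hb', map_mul, map_mul, ← hs]
      ring
  exists_smul b hb := by
    obtain ⟨t, ht⟩ := (IsLocalization.map_eq_zero_iff M T' (ρ b)).1 hb
    obtain ⟨b', g, hg, hb'⟩ := h.exists_num t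
    obtain ⟨g', hg', hm⟩ := h.exists_smul (b' * b) (by rw [map_mul, ← hb', mul_assoc, ht, mul_zero])
    refine ⟨g' * b', ?_, by rwa [mul_assoc]⟩
    rw [RingHom.comp_apply, map_mul, map_mul, ← hb', map_mul]
    exact (hg'.map (algebraMap T T')).mul ((hg.map (algebraMap T T')).mul (IsLocalization.map_units T' t))
  map_eq_zero a ha := by rw [RingHom.comp_apply, h.map_eq_zero a ha, map_zero]
  isUnit_map a ha := (h.isUnit_map a ha).map (algebraMap T T')

theorem IsFibreLoc.exists_num_mem_map (h : IsFibreLoc q ρ) {J : Ideal B} {x : T}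
    (hx : x ∈ J.map ρ) : ∃ p ∈ J, ∃ g, IsUnit (ρ g) ∧ ρ g * x = ρ p := by
  refine Submodule.span_induction ?_ ?_ ?_ ?_ hx
  · rintro _ ⟨p, hp, rfl⟩
    exact ⟨p, hp, 1, by simp, by simp⟩
  · exact ⟨0, J.zero_mem, 1, by simp, by simp⟩
  · rintro x y _ _ ⟨p, hp, g, hg, he⟩ ⟨p', hp', g', hg', he'⟩
    refine ⟨g' * p + g * p', J.add_mem (J.mul_mem_left _ hp) (J.mul_mem_left _ hp'), g * g', ?_, ?_⟩
    · rw [map_mul]; exact hg.mul hg'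
    · simp only [map_add, map_mul, ← he, ← he']; ring
  · rintro r x _ ⟨p, hp, g, hg, he⟩
    obtain ⟨b, g', hg', hb⟩ := h.exists_num r
    refine ⟨b * p, J.mul_mem_left _ hp, g' * g, ?_, ?_⟩
    · rw [map_mul]; exact hg'.mul hg
    · simp only [map_mul, ← he, ← hb, smul_eq_mul]; ring

theorem IsFibreLoc.exists_mul_sub_mem (h : IsFibreLoc q ρ) {J : Ideal B} {b : B}
    (hx : ρ b ∈ J.map ρ) :
    ∃ g, IsUnit (ρ g) ∧ ∃ w ∈ q • (⊤ : Submodule A B), g * b - w ∈ J := by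
  obtain ⟨p, hp, g, hg, he⟩ := h.exists_num_mem_map hx
  obtain ⟨g', hg', hm⟩ := h.exists_smul (g * b - p) (by rw [map_sub, map_mul, he, sub_self])
  refine ⟨g' * g, by rw [map_mul]; exact hg'.mul hg, _, hm, ?_⟩
  have : g' * g * b - g' * (g * b - p) = g' * p := by ring
  rw [this]
  exact J.mul_mem_left _ hp

theorem mvPolynomial_mem_smul_top {σ : Type} {q : Ideal A} {b : MvPolynomial σ A}
    (h : ∀ s, b.coeff s ∈ q) : b ∈ q • (⊤ : Submodule A (MvPolynomial σ A)) := by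
  rw [b.as_sum]
  refine Submodule.sum_mem _ fun s _ => ?_
  rw [← mul_one (b.coeff s), ← smul_eq_mul, ← smul_monomial]
  exact Submodule.smul_mem_smul (h s) trivial

theorem isFibreLoc_map {σ L : Type} [Field L] {ev : A →+* L}
    (hev : ∀ y : L, ∃ a d, ev d ≠ 0 ∧ ev d * y = ev a) :
    IsFibreLoc (B := MvPolynomial σ A) (RingHom.ker ev) (MvPolynomial.map ev) where
  exists_num x := by
    have : ∃ (b : MvPolynomial σ A) (d : A), ev d ≠ 0 ∧ C (ev d) * x = MvPolynomial.map ev b := by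
      induction x using MvPolynomial.induction_on with
      | C y =>
        obtain ⟨a, d, hd, h⟩ := hev y
        exact ⟨C a, d, hd, by rw [map_C, ← h, C_mul]⟩
      | add x y hx hy =>
        obtain ⟨b, d, hd, h⟩ := hx
        obtain ⟨b', d', hd', h'⟩ := hy
        refine ⟨C d' * b + C d * b', d * d', by rw [map_mul]; exact mul_ne_zero hd hd', ?_⟩
        simp only [map_add, map_mul, ← h, ← h', map_C]; ring
      | mul_X x i hx =>
        obtain ⟨b, d, hd, h⟩ := hx
        exact ⟨b * X i, d, hd, by rw [map_mul, map_X, ← h]; ring⟩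
    obtain ⟨b, d, hd, h⟩ := this
    exact ⟨b, C d, by rw [map_C]; exact hd.isUnit.map C, by rw [map_C, h]⟩
  exists_smul b hb := by
    refine ⟨1, by simp, ?_⟩
    rw [one_mul]
    refine mvPolynomial_mem_smul_top fun s => ?_
    rw [RingHom.mem_ker, ← coeff_map, hb, coeff_zero]
  map_eq_zero a ha := by
    rw [algebraMap_eq, map_C, RingHom.mem_ker.1 ha, map_zero]
  isUnit_map a ha := by
    rw [algebraMap_eq, map_C]
    exact (Ne.isUnit (fun h => ha (RingHom.mem_ker.2 h))).map C

end FibreLoc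

section Unmixed

theorem eq_of_comap_eq_of_algebraic {A E : Type} [CommRing A] [CommRing E] {n : ℕ}
    (φ : E →+* MvPolynomial (Fin n) A) (hC : ∀ a, C a ∈ φ.range)
    {p' p : Ideal (MvPolynomial (Fin n) A)} [p'.IsPrime] [p.IsPrime] (hle : p' ≤ p)
    (heq : p.comap φ ≤ p'.comap φ) (f : Fin n → Polynomial E)
    (hf : ∀ i, ∃ j, (f i).coeff j ∉ p'.comap φ) (hfX : ∀ i, (f i).eval₂ φ (X i) ∈ p') :
    p' = p := by
  refine le_antisymm hle fun b hb => ?_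
  by_contra hb'
  let ψ : E ⧸ p'.comap φ →+* MvPolynomial (Fin n) A ⧸ p' := Ideal.quotientMap p' φ le_rfl
  have hψ : Function.Injective ψ := Ideal.quotientMap_injective
  algebraize [ψ]
  have halg : ∀ b : MvPolynomial (Fin n) A,
      IsAlgebraic (E ⧸ p'.comap φ) (Ideal.Quotient.mk p' b) := by
    intro b
    have hmem : ∀ b : MvPolynomial (Fin n) A, Ideal.Quotient.mk p' b ∈
        Subalgebra.algebraicClosure (E ⧸ p'.comap φ) (MvPolynomial (Fin n) A ⧸ p') := by
      intro b
      induction b using MvPolynomial.induction_on with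
      | C a =>
        obtain ⟨e, he⟩ := hC a
        rw [← he]
        exact Subalgebra.algebraMap_mem _ (Ideal.Quotient.mk (p'.comap φ) e)
      | add x y hx hy => rw [map_add]; exact add_mem hx hy
      | mul_X x i hx =>
        rw [map_mul]
        refine mul_mem hx ?_
        refine ⟨(f i).map (Ideal.Quotient.mk _), fun h0 => ?_, ?_⟩
        · obtain ⟨j, hj⟩ := hf i
          refine hj (Ideal.Quotient.eq_zero_iff_mem.1 ?_)
          rw [← Polynomial.coeff_map, h0, Polynomial.coeff_zero]
        · have := Ideal.Quotient.eq_zero_iff_mem.2 (hfX i)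
          rw [Polynomial.hom_eval₂] at this
          rw [Polynomial.aeval_def, Polynomial.eval₂_map]
          exact this
    exact hmem b
  have hne := Ideal.comap_ne_bot_of_algebraic_mem (I := p.map (Ideal.Quotient.mk p'))
    (fun h0 => hb' (Ideal.Quotient.eq_zero_iff_mem.1 h0)) (Ideal.mem_map_of_mem _ hb) (halg b)
  refine hne (eq_bot_iff.2 fun e he => ?_)
  obtain ⟨e, rfl⟩ := Ideal.Quotient.mk_surjective e
  refine Ideal.Quotient.eq_zero_iff_mem.2 (heq ?_)
  have h1 : Ideal.Quotient.mk p' (φ e) ∈ p.map (Ideal.Quotient.mk p') := he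
  have h2 := Ideal.mem_comap.2 h1
  rw [Ideal.comap_map_of_surjective _ Ideal.Quotient.mk_surjective, ← RingHom.ker_eq_comap_bot,
    Ideal.mk_ker, sup_eq_left.2 hle] at h2
  exact h2

/-- A generic polynomial subring over which the residue ring is algebraic. -/
theorem exists_algebraicIndependent {A : Type} [CommRing A] [IsDomain A] {n : ℕ}
    (J : Ideal (MvPolynomial (Fin n) A)) [J.IsPrime] (hJ : ∀ a, C a ∈ J → a = 0) :
    ∃ (τ : Type) (_ : Finite τ) (s : τ → Fin n),
      (∀ e : MvPolynomial τ A, rename s e ∈ J → e = 0) ∧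
      ∀ i, ∃ f : Polynomial (MvPolynomial τ A), f ≠ 0 ∧
        f.eval₂ (rename s : MvPolynomial τ A →ₐ[A] MvPolynomial (Fin n) A).toRingHom (X i) ∈ J := by
  let M := MvPolynomial (Fin n) A ⧸ J
  let x : Fin n → M := fun i => Ideal.Quotient.mk J (X i)
  have hinj : Function.Injective (algebraMap A M) := by
    rw [injective_iff_map_eq_zero]
    intro a ha
    exact hJ a (Ideal.Quotient.eq_zero_iff_mem.1 ha)
  have : FaithfulSMul A M := (faithfulSMul_iff_algebraMap_injective A M).2 hinj
  have hadj : Algebra.adjoin A (Set.range x) = ⊤ := by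
    rw [eq_top_iff]
    intro b _
    obtain ⟨b, rfl⟩ := Ideal.Quotient.mk_surjective b
    induction b using MvPolynomial.induction_on with
    | C a => exact Subalgebra.algebraMap_mem _ a
    | add p q hp hq => rw [map_add]; exact add_mem (hp trivial) (hq trivial)
    | mul_X p i hp => rw [map_mul]; exact mul_mem (hp trivial) (Algebra.subset_adjoin ⟨i, rfl⟩)
  have : Algebra.IsAlgebraic (Algebra.adjoin A (Set.range x)) M :=
    ⟨fun b => isAlgebraic_algebraMap (⟨b, hadj ▸ trivial⟩ : Algebra.adjoin A (Set.range x))⟩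
  obtain ⟨t, ht, hb⟩ := exists_isTranscendenceBasis_subset (R := A) (Set.range x)
  choose s hs using fun j : t => ht j.2
  have hcomp : ∀ e : MvPolynomial t A, Ideal.Quotient.mk J (rename s e) =
      aeval (fun j : t => (j : M)) e := by
    intro e
    have : (Ideal.Quotient.mkₐ A J).comp (rename s) = aeval (fun j : t => (j : M)) := by
      ext j
      simpa using hs j
    exact congrArg (fun g => g e) this
  refine ⟨t, (Set.finite_range x).subset ht, s, fun e he => ?_, fun i => ?_⟩
  · refine (injective_iff_map_eq_zero _).1 hb.1 e ?_
    rw [← hcomp]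
    exact Ideal.Quotient.eq_zero_iff_mem.2 he
  · obtain ⟨f, hf, hfx⟩ := hb.isAlgebraic.isAlgebraic (x i)
    refine ⟨f.map hb.1.aevalEquiv.symm.toRingEquiv.toRingHom, fun h0 => hf ?_, ?_⟩
    · exact (Polynomial.map_eq_zero_iff (by exact hb.1.aevalEquiv.symm.injective)).1 h0
    · rw [← Ideal.Quotient.eq_zero_iff_mem, Polynomial.hom_eval₂, Polynomial.eval₂_map]
      rw [Polynomial.aeval_def] at hfx
      have hmap : ((Ideal.Quotient.mk J).comp
          (rename s : MvPolynomial t A →ₐ[A] MvPolynomial (Fin n) A).toRingHom).comp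
            hb.1.aevalEquiv.symm.toRingEquiv.toRingHom =
          algebraMap (Algebra.adjoin A (Set.range ((↑) : t → M))) M := by
        refine RingHom.ext fun e => ?_
        obtain ⟨e, rfl⟩ := hb.1.aevalEquiv.surjective e
        refine Eq.trans ?_ ((hcomp e).trans (hb.1.algebraMap_aevalEquiv e).symm)
        exact congrArg (fun e => Ideal.Quotient.mk J (rename s e))
          (hb.1.aevalEquiv.symm_apply_apply e)
      exact (congrArg (fun h => f.eval₂ h (x i)) hmap).trans hfx

theorem exists_coeff_forall_map_ne_zero {A : Type} [CommRing A] {σ : Type} {e : MvPolynomial σ A}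
    (he : e ≠ 0) : ∃ c : A, c ≠ 0 ∧ ∀ (L : Type) [Field L] (ev : A →+* L), ev c ≠ 0 →
      MvPolynomial.map ev e ≠ 0 := by
  obtain ⟨s, hs⟩ := exists_coeff_ne_zero he
  refine ⟨_, hs, fun L _ ev h h0 => h ?_⟩
  rw [← coeff_map, h0, coeff_zero]

/-- The specializations of a prime ideal are generically unmixed. -/
theorem exists_unmixed {A : Type} [CommRing A] [IsDomain A] [IsNoetherianRing A] {n : ℕ}
    (J : Ideal (MvPolynomial (Fin n) A)) [J.IsPrime] (hJ : ∀ a, C a ∈ J → a = 0) :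
    ∃ c : A, c ≠ 0 ∧ ∀ (L : Type) [Field L] (ev : A →+* L),
      (∀ y : L, ∃ a d, ev d ≠ 0 ∧ ev d * y = ev a) → ev c ≠ 0 →
      ∀ p ∈ associatedPrimes (MvPolynomial (Fin n) L)
        (MvPolynomial (Fin n) L ⧸ J.map (MvPolynomial.map ev)),
      ∀ p' : Ideal (MvPolynomial (Fin n) L), p'.IsPrime → J.map (MvPolynomial.map ev) ≤ p' →
        p' ≤ p → p' = p := by
  classical
  obtain ⟨τ, _, s, hs, hf⟩ := exists_algebraicIndependent J hJ
  let φ : MvPolynomial τ A →+* MvPolynomial (Fin n) A := (rename s : _ →ₐ[A] _).toRingHom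
  have hφ : ∀ e, φ e = rename s e := fun _ => rfl
  have hφC : ∀ a, φ (C a) = C a := fun a => by rw [hφ, rename_C]
  choose f hf0 hfX using hf
  obtain ⟨e, he, hflat⟩ : ∃ e : MvPolynomial τ A, e ≠ 0 ∧
      ∀ (ι : Type) (_ : Fintype ι) (r : ι → MvPolynomial τ A) (x : ι → MvPolynomial (Fin n) A),
      ∑ i, φ (r i) * x i ∈ J → ∃ (j : ℕ) (κ : Type) (_ : Fintype κ)
        (a : ι → κ → MvPolynomial τ A) (y : κ → MvPolynomial (Fin n) A),
        (∀ i, φ (e ^ j) * x i - ∑ l, φ (a i l) * y l ∈ J) ∧ ∀ l, ∑ i, r i * a i l = 0 := by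
    let := φ.toAlgebra
    have hg : GenericallyFlat (MvPolynomial τ A) (MvPolynomial (Fin n) A) := by
      refine (genericallyFlat_mvPolynomial (MvPolynomial τ A) n).of_surjective
        (aeval (fun i => (X i : MvPolynomial (Fin n) A))) fun b => ?_
      induction b using MvPolynomial.induction_on with
      | C a => exact ⟨C (C a), by rw [aeval_C]; exact hφC a⟩
      | add p q hp hq =>
        obtain ⟨p, rfl⟩ := hp
        obtain ⟨q, rfl⟩ := hq
        exact ⟨p + q, map_add _ _ _⟩
      | mul_X p i hp =>
        obtain ⟨p, rfl⟩ := hp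
        exact ⟨p * X i, by rw [map_mul, aeval_X]⟩
    obtain ⟨e, he, h⟩ := hg (MvPolynomial (Fin n) A) J
    refine ⟨e, he, fun ι _ r x hx => ?_⟩
    obtain ⟨j, κ, _, a, y, _, h1, h2⟩ := h ι _ r x (fun _ => trivial) (by
      exact hx)
    refine ⟨j, κ, inferInstance, a, y, fun i => ?_, h2⟩
    exact h1 i
  obtain ⟨c1, hc1, hnzd⟩ := exists_nzd (genericallyFlat_mvPolynomial A n) J
    (p := φ e) (fun h => he (hs e h))
  choose c hc hcf using fun i => exists_coeff_forall_map_ne_zero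
    (Polynomial.leadingCoeff_ne_zero.2 (hf0 i))
  refine ⟨c1 * ∏ i, c i, mul_ne_zero hc1 (Finset.prod_ne_zero_iff.2 fun i _ => hc i), ?_⟩
  intro L _ ev hev hevc p hp p' hp'prime hJp' hp'p
  rw [map_mul, map_prod] at hevc
  have hev1 : ev c1 ≠ 0 := left_ne_zero_of_mul hevc
  have hev2 : ∀ i, ev (c i) ≠ 0 := fun i =>
    Finset.prod_ne_zero_iff.1 (right_ne_zero_of_mul hevc) i (Finset.mem_univ i)
  have hfib := isFibreLoc_map (σ := Fin n) hev
  set ρ : MvPolynomial (Fin n) A →+* MvPolynomial (Fin n) L := MvPolynomial.map ev with hρ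
  have hρφ : ∀ e, MvPolynomial.map ev e = 0 → ρ (φ e) = 0 := fun e he => by
    rw [hφ, hρ, map_rename, he, map_zero]
  obtain ⟨hpprime, x, hx⟩ := isAssociatedPrime_iff.1 hp
  obtain ⟨x, rfl⟩ := Ideal.Quotient.mk_surjective x
  obtain ⟨v, g0, hg0, hv⟩ := hfib.exists_num x
  have hann : ∀ r, r ∈ p ↔ r * ρ v ∈ J.map ρ := by
    intro r
    rw [hx, Submodule.mem_colon_singleton, Submodule.mem_bot, ← hv]
    change Ideal.Quotient.mk _ (r * x) = 0 ↔ _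
    rw [Ideal.Quotient.eq_zero_iff_mem, mul_left_comm]
    exact ⟨fun h => Ideal.mul_mem_left _ _ h, fun h => (Ideal.unit_mul_mem_iff_mem _ hg0).1 h⟩
  have hvn : ρ v ∉ J.map ρ := fun h => hpprime.ne_top
    ((Ideal.eq_top_iff_one _).2 ((hann 1).2 (by rwa [one_mul])))
  have htors : ∀ T : MvPolynomial τ A, MvPolynomial.map ev T ≠ 0 → ρ (φ T) ∉ p := by
    intro T hT hTp
    have h1 := (hann _).1 hTp
    rw [← map_mul] at h1
    obtain ⟨g, hg, w, hw, hgw⟩ := hfib.exists_mul_sub_mem h1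
    obtain ⟨ι, _, r, y, hr, rfl⟩ := exists_sum_of_mem_ideal_smul hw
    obtain ⟨j, κ, _, a, z, h2, h3⟩ := hflat (Option ι) inferInstance
      (fun i => i.elim T fun i => - C (r i)) (fun i => i.elim (g * v) y) (by
        simp only [Fintype.sum_option, Option.elim]
        convert hgw using 1
        simp only [map_neg, hφC, neg_mul, Finset.sum_neg_distrib, ← sub_eq_add_neg,
          MvPolynomial.smul_eq_C_mul]
        ring)
    have h4 : ∀ l, ρ (φ (a none l)) = 0 := fun l => by
      refine hρφ _ ?_
      have := congrArg (MvPolynomial.map ev) (h3 l)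
      simp only [Fintype.sum_option, Option.elim, map_add, map_sum, map_mul, map_neg, map_C,
        map_zero, RingHom.mem_ker.1 (hr _)] at this
      simpa [hT] using this
    have h5 := Ideal.mem_map_of_mem ρ (h2 none)
    simp only [Option.elim, map_sub, map_sum, map_mul, h4, zero_mul, Finset.sum_const_zero,
      sub_zero, map_pow] at h5
    have h6 : ∀ j : ℕ, ρ (φ e) ^ j * (ρ g * ρ v) ∈ J.map ρ → ρ g * ρ v ∈ J.map ρ := by
      intro j
      induction j with
      | zero => simp
      | succ j ih =>
        intro h
        rw [pow_succ', mul_assoc] at h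
        exact ih (hnzd _ _ ρ hfib (fun h => hev1 (RingHom.mem_ker.1 h)) _ h)
    exact hvn ((Ideal.unit_mul_mem_iff_mem _ hg).1 (h6 j h5))
  have hcomap : p'.comap ρ = p.comap ρ := by
    refine eq_of_comap_eq_of_algebraic φ (fun a => ⟨C a, hφC a⟩) (Ideal.comap_mono hp'p)
      (fun T hT => ?_) f (fun i => ⟨(f i).natDegree, fun h => ?_⟩)
      fun i => hJp' (Ideal.mem_map_of_mem ρ (hfX i))
    · rw [Ideal.mem_comap, Ideal.mem_comap] at hT ⊢
      rw [hρφ T (by_contra fun h => htors T h hT)]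
      exact zero_mem _
    · rw [Ideal.mem_comap, Ideal.mem_comap] at h
      exact htors _ (hcf i L ev (hev2 i)) (hp'p h)
  refine le_antisymm hp'p fun r hr => ?_
  obtain ⟨b, g, hg, hb⟩ := hfib.exists_num r
  have : b ∈ p'.comap ρ := by
    rw [hcomap, Ideal.mem_comap, ← hb]
    exact p.mul_mem_left _ hr
  rw [Ideal.mem_comap, ← hb] at this
  exact (Ideal.unit_mul_mem_iff_mem _ hg).1 this

end Unmixed

section ExtRep

open CategoryTheory Opposite

variable {S : Type} [CommRing S] {X : ModuleCat.{0} S}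

/-- The complex of morphisms from a projective resolution to `Y`, in the opposite category. -/
abbrev homComplex (P : ProjectiveResolution X) (Y : ModuleCat.{0} S) :
    ChainComplex (ModuleCat.{0} S)ᵒᵖ ℕ :=
  (((linearYoneda S (ModuleCat.{0} S)).obj Y).rightOp.mapHomologicalComplex _).obj P.complex

/-- The cocycle `f` represents the class `e`. -/
def ExtRep (P : ProjectiveResolution X) (i : ℕ) {Y : ModuleCat.{0} S} (f : P.complex.X i ⟶ Y)
    (e : ((Ext S (ModuleCat.{0} S) i).obj (op X)).obj Y) : Prop :=
  ∃ z : ((homComplex P Y).opcycles i).unop,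
    ((homComplex P Y).pOpcycles i).unop.hom z = f ∧
    ((homComplex P Y).homologyι i).unop.hom z =
      (P.isoLeftDerivedObj ((linearYoneda S (ModuleCat.{0} S)).obj Y).rightOp i).inv.unop.hom e

theorem ExtRep.exists_cocycle (P : ProjectiveResolution X) (i : ℕ) {Y : ModuleCat.{0} S}
    (e : ((Ext S (ModuleCat.{0} S) i).obj (op X)).obj Y) :
    ∃ f : P.complex.X i ⟶ Y, P.complex.d (i + 1) i ≫ f = 0 ∧ ExtRep P i f e := by
  have hs : Function.Surjective ((homComplex P Y).homologyι i).unop.hom :=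
    (ModuleCat.epi_iff_surjective _).1 inferInstance
  obtain ⟨z, hz⟩ := hs
    ((P.isoLeftDerivedObj ((linearYoneda S (ModuleCat.{0} S)).obj Y).rightOp i).inv.unop.hom e)
  refine ⟨_, ?_, z, rfl, hz⟩
  have := congrArg (fun g => g.unop.hom z) ((homComplex P Y).d_pOpcycles (i + 1) i)
  exact this

theorem ExtRep.smul {P : ProjectiveResolution X} {i : ℕ} {Y : ModuleCat.{0} S}
    {f : P.complex.X i ⟶ Y} {e : ((Ext S (ModuleCat.{0} S) i).obj (op X)).obj Y}
    (h : ExtRep P i f e) (a : S) : ExtRep P i (a • f) (a • e) := by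
  obtain ⟨z, hz, he⟩ := h
  exact ⟨a • z, by rw [map_smul, hz]; rfl, by
    rw [map_smul, he]
    exact (map_smul (P.isoLeftDerivedObj
      ((linearYoneda S (ModuleCat.{0} S)).obj Y).rightOp i).inv.unop.hom a e).symm⟩

theorem ExtRep.eq_zero_of_coboundary {P : ProjectiveResolution X} {i : ℕ} {Y : ModuleCat.{0} S}
    {g : P.complex.X i ⟶ Y} {e : ((Ext S (ModuleCat.{0} S) (i + 1)).obj (op X)).obj Y}
    (h : ExtRep P (i + 1) (P.complex.d (i + 1) i ≫ g) e) : e = 0 := by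
  obtain ⟨z, hz, he⟩ := h
  have hi : Function.Injective ((homComplex P Y).pOpcycles (i + 1)).unop.hom :=
    (ModuleCat.mono_iff_injective _).1 inferInstance
  have hi' : Function.Injective (P.isoLeftDerivedObj
      ((linearYoneda S (ModuleCat.{0} S)).obj Y).rightOp (i + 1)).inv.unop.hom :=
    (ModuleCat.mono_iff_injective _).1 inferInstance
  have hz' : z = ((homComplex P Y).fromOpcycles (i + 1) i).unop.hom g := by
    refine hi (hz.trans ?_)
    exact congrArg (fun h => h.unop.hom g)
      ((homComplex P Y).p_fromOpcycles (i + 1) i).symm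
  have h0 := congrArg (fun h => h.unop.hom g) ((homComplex P Y).homologyι_comp_fromOpcycles (i + 1) i)
  refine hi' (he.symm.trans (Eq.trans ?_ (map_zero _).symm))
  rw [hz']
  exact h0

theorem ExtRep.eq_zero_of_zero {P : ProjectiveResolution X} {i : ℕ} {Y : ModuleCat.{0} S}
    {e : ((Ext S (ModuleCat.{0} S) i).obj (op X)).obj Y}
    (h : ExtRep P i 0 e) : e = 0 := by
  obtain ⟨z, hz, he⟩ := h
  have hi : Function.Injective ((homComplex P Y).pOpcycles i).unop.hom :=
    (ModuleCat.mono_iff_injective _).1 inferInstance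
  have hi' : Function.Injective (P.isoLeftDerivedObj
      ((linearYoneda S (ModuleCat.{0} S)).obj Y).rightOp i).inv.unop.hom :=
    (ModuleCat.mono_iff_injective _).1 inferInstance
  have : z = 0 := hi (hz.trans (map_zero _).symm)
  rw [this, map_zero] at he
  exact hi' (he.symm.trans (map_zero _).symm)

theorem ExtRep.exists_of_comp_eq_zero (P : ProjectiveResolution X) {Y : ModuleCat.{0} S}
    (f : P.complex.X 0 ⟶ Y) (hf : P.complex.d 1 0 ≫ f = 0) :
    ∃ e : ((Ext S (ModuleCat.{0} S) 0).obj (op X)).obj Y, ExtRep P 0 f e := by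
  have hi' : Function.Surjective (P.isoLeftDerivedObj
      ((linearYoneda S (ModuleCat.{0} S)).obj Y).rightOp 0).inv.unop.hom :=
    (ModuleCat.epi_iff_surjective _).1 inferInstance
  let K := homComplex P Y
  let u : ModuleCat.of S S ⟶ (K.X 0).unop := ModuleCat.ofHom (LinearMap.toSpanSingleton S _ f)
  have hu : K.d 1 0 ≫ u.op = 0 := by
    refine Quiver.Hom.unop_inj (ModuleCat.hom_ext (LinearMap.ext_ring ?_))
    change P.complex.d 1 0 ≫ ((1 : S) • f) = 0
    rw [one_smul, hf]
  obtain ⟨e, he⟩ := hi' ((K.homologyι 0).unop.hom ((K.descOpcycles u.op 1 (by simp) hu).unop.hom 1))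
  refine ⟨e, (K.descOpcycles u.op 1 (by simp) hu).unop.hom 1, ?_, he.symm⟩
  have := congrArg (fun h => h.unop.hom (1 : S)) (K.p_descOpcycles u.op 1 (by simp) hu)
  refine Eq.trans this ?_
  exact one_smul S f

theorem ExtRep.eq_zero_of_degree_zero {P : ProjectiveResolution X} {Y : ModuleCat.{0} S}
    {f : P.complex.X 0 ⟶ Y} (h : ExtRep P 0 f 0) : f = 0 := by
  obtain ⟨z, hz, he⟩ := h
  have : IsIso ((homComplex P Y).homologyι 0) :=
    (homComplex P Y).isIso_homologyι 0 _ rfl (by simp)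
  have hi : Function.Injective ((homComplex P Y).homologyι 0).unop.hom :=
    (ModuleCat.mono_iff_injective _).1 inferInstance
  have h0 : z = 0 := hi (he.trans ((map_zero _).trans (map_zero _).symm))
  rw [← hz, h0, map_zero]
  rfl

theorem ExtRep.map {X' : ModuleCat.{0} S} {P : ProjectiveResolution X}
    {P' : ProjectiveResolution X'} {i : ℕ} {Y : ModuleCat.{0} S}
    {f : P.complex.X i ⟶ Y} {e : ((Ext S (ModuleCat.{0} S) i).obj (op X)).obj Y}
    (h : ExtRep P i f e) (w : X' ⟶ X) (φ : P'.complex ⟶ P.complex)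
    (hφ : φ.f 0 ≫ P.π.f 0 = P'.π.f 0 ≫ w) :
    ExtRep P' i (φ.f i ≫ f) ((((Ext S (ModuleCat.{0} S) i).map w.op).app Y).hom e) := by
  obtain ⟨z, hz, he⟩ := h
  let Φ : homComplex P' Y ⟶ homComplex P Y :=
    (((linearYoneda S (ModuleCat.{0} S)).obj Y).rightOp.mapHomologicalComplex _).map φ
  refine ⟨(HomologicalComplex.opcyclesMap Φ i).unop.hom z, ?_, ?_⟩
  · have := congrArg (fun g => g.unop.hom z) (HomologicalComplex.p_opcyclesMap Φ i)
    refine Eq.trans this ?_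
    exact congrArg (fun f => φ.f i ≫ f) hz
  · have := congrArg (fun g => g.unop.hom z) (HomologicalComplex.homologyι_naturality Φ i)
    refine Eq.trans this.symm ?_
    have h2 := congrArg (fun g => g.unop.hom e) (ProjectiveResolution.isoLeftDerivedObj_inv_naturality
      w P' P φ hφ ((linearYoneda S (ModuleCat.{0} S)).obj Y).rightOp i)
    refine Eq.trans ?_ h2.symm
    exact congrArg (fun e => (HomologicalComplex.homologyMap Φ i).unop.hom e) he

end ExtRep

section LocalCoh

open CategoryTheory Opposite Limits

variable {S : Type} [CommRing S]

/-- The augmentation of a projective resolution. -/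
def aug {X : ModuleCat.{0} S} (P : ProjectiveResolution X) : P.complex.X 0 ⟶ X := P.π.f 0

instance {X : ModuleCat.{0} S} (P : ProjectiveResolution X) : Epi (aug P) :=
  inferInstanceAs (Epi (P.π.f 0))

theorem d_comp_aug {X : ModuleCat.{0} S} (P : ProjectiveResolution X) :
    P.complex.d 1 0 ≫ aug P = 0 := P.complex_d_comp_π_f_zero

theorem exists_aug_comp {X Y : ModuleCat.{0} S} (P : ProjectiveResolution X)
    (f : P.complex.X 0 ⟶ Y) (hf : P.complex.d 1 0 ≫ f = 0) : ∃ g : X ⟶ Y, aug P ≫ g = f :=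
  ⟨P.exact₀.desc f hf, P.exact₀.g_desc f hf⟩

theorem exists_lift {X X' : ModuleCat.{0} S} (P : ProjectiveResolution X)
    (P' : ProjectiveResolution X') (w : X' ⟶ X) :
    ∃ φ : P'.complex ⟶ P.complex, φ.f 0 ≫ aug P = aug P' ≫ w :=
  ⟨ProjectiveResolution.lift w P' P, ProjectiveResolution.lift_commutes_zero _ _ _⟩

/-- The quotient by a power of `J`. -/
abbrev quotPow (J : Ideal S) (t : ℕ) : ModuleCat.{0} S := ModuleCat.of S (S ⧸ J ^ t)

/-- The projection between quotients by powers of `J`. -/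
def quotPowMap (J : Ideal S) {t t' : ℕ} (h : t ≤ t') : quotPow J t' ⟶ quotPow J t :=
  ModuleCat.ofHom (Submodule.mapQ _ _ LinearMap.id (Ideal.pow_le_pow_right h))

/-- The map from `Ext` to local cohomology. -/
def toLocalCoh (J : Ideal S) (i : ℕ) (M : ModuleCat.{0} S) (t : ℕ) :
    ((Ext S (ModuleCat.{0} S) i).obj (op (quotPow J t))).obj M ⟶ (localCohomology J i).obj M :=
  (colimit.ι (localCohomology.diagram (localCohomology.idealPowersDiagram J) i) (op (op t))).app M

/-- Local cohomology is a colimit. -/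
def isColimitLocalCoh (J : Ideal S) (i : ℕ) (M : ModuleCat.{0} S) :
    IsColimit (((evaluation _ _).obj M).mapCocone (colimit.cocone
      (localCohomology.diagram (localCohomology.idealPowersDiagram J) i))) :=
  isColimitOfPreserves _ (colimit.isColimit _)

theorem exists_toLocalCoh (J : Ideal S) (i : ℕ) (M : ModuleCat.{0} S)
    (x : (localCohomology J i).obj M) : ∃ t e, (toLocalCoh J i M t).hom e = x := by
  obtain ⟨⟨⟨t⟩⟩, e, he⟩ := Concrete.isColimit_exists_rep _ (isColimitLocalCoh J i M) x
  exact ⟨t, e, he⟩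

theorem toLocalCoh_map (J : Ideal S) (i : ℕ) (M : ModuleCat.{0} S) {t t' : ℕ} (h : t ≤ t') 
    (e : ((Ext S (ModuleCat.{0} S) i).obj (op (quotPow J t))).obj M) :
    (toLocalCoh J i M t').hom ((((Ext S (ModuleCat.{0} S) i).map (quotPowMap J h).op).app M).hom e)
      = (toLocalCoh J i M t).hom e := by
  have := colimit.w (localCohomology.diagram (localCohomology.idealPowersDiagram J) i)
    (homOfLE h).op.op
  exact congrArg (fun g => (g.app M).hom e) this

theorem exists_map_eq_zero (J : Ideal S) (i : ℕ) (M : ModuleCat.{0} S) {t : ℕ}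
    (e : ((Ext S (ModuleCat.{0} S) i).obj (op (quotPow J t))).obj M)
    (h : (toLocalCoh J i M t).hom e = 0) : ∃ t', ∃ h : t ≤ t',
      (((Ext S (ModuleCat.{0} S) i).map (quotPowMap J h).op).app M).hom e = 0 := by
  obtain ⟨⟨⟨t'⟩⟩, f, g, hfg⟩ := Concrete.isColimit_exists_of_rep_eq _ (isColimitLocalCoh J i M)
    (i := op (op t)) (j := op (op t)) e 0 (h.trans (map_zero (toLocalCoh J i M t).hom).symm)
  refine ⟨t', leOfHom f.unop.unop, ?_⟩
  refine Eq.trans ?_ (hfg.trans (map_zero _))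
  rfl

/-- The cochain `f` is a coboundary. -/
def IsCobound {X : ModuleCat.{0} S} (P : ProjectiveResolution X) {M : ModuleCat.{0} S} :
    (i : ℕ) → (P.complex.X i ⟶ M) → Prop
  | 0, f => f = 0
  | i + 1, f => ∃ g, f = P.complex.d (i + 1) i ≫ g

/-- `f` becomes a coboundary on a resolution of a smaller quotient. -/
def Dies (J : Ideal S) {t : ℕ} (P : ProjectiveResolution (quotPow J t)) {M : ModuleCat.{0} S}
    (i : ℕ) (f : P.complex.X i ⟶ M) : Prop :=
  ∃ t', ∃ h : t ≤ t', ∃ (P' : ProjectiveResolution (quotPow J t')) (φ : P'.complex ⟶ P.complex),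
    φ.f 0 ≫ aug P = aug P' ≫ quotPowMap J h ∧ IsCobound P' i (φ.f i ≫ f)

/-- Every cocycle dies after multiplication by `a`. -/
def Kills (J : Ideal S) (a : S) (i : ℕ) (M : ModuleCat.{0} S) : Prop :=
  ∀ (t : ℕ) (P : ProjectiveResolution (quotPow J t)) (f : P.complex.X i ⟶ M),
    P.complex.d (i + 1) i ≫ f = 0 → Dies J P i (a • f)

theorem Kills.smul_eq_zero {J : Ideal S} {a : S} {i : ℕ} {M : ModuleCat.{0} S}
    (h : Kills J a i M) (x : (localCohomology J i).obj M) : a • x = 0 := by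
  obtain ⟨t, e, rfl⟩ := exists_toLocalCoh J i M x
  let P : ProjectiveResolution (quotPow J t) := ProjectiveResolution.of _
  obtain ⟨f, hf, hfe⟩ := ExtRep.exists_cocycle P i e
  obtain ⟨t', ht, P', φ, hφ, hc⟩ := h t P f hf
  rw [← map_smul, ← toLocalCoh_map J i M ht]
  have hr := (hfe.smul a).map (quotPowMap J ht) φ hφ
  have h0 : (((Ext S (ModuleCat.{0} S) i).map (quotPowMap J ht).op).app M).hom (a • e) = 0 := by
    cases i with
    | zero =>
      change φ.f 0 ≫ (a • f) = 0 at hc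
      rw [hc] at hr
      exact hr.eq_zero_of_zero
    | succ i =>
      obtain ⟨g, hg⟩ := hc
      rw [hg] at hr
      exact hr.eq_zero_of_coboundary
  rw [h0, map_zero]

theorem smul_eq_zero_of_localCoh {J : Ideal S} {a : S} {M : ModuleCat.{0} S}
    (h : ∀ x : (localCohomology J 0).obj M, a • x = 0) (z : M) (t : ℕ)
    (hz : ∀ c ∈ J ^ t, c • z = 0) : a • z = 0 := by
  let P : ProjectiveResolution (quotPow J t) := ProjectiveResolution.of _
  let q : quotPow J t ⟶ M := ModuleCat.ofHom
    ((J ^ t).liftQ (LinearMap.toSpanSingleton S M z) fun c hc => hz c hc)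
  obtain ⟨e, he⟩ := ExtRep.exists_of_comp_eq_zero P (aug P ≫ q) (by
    rw [← Category.assoc, d_comp_aug, zero_comp])
  have h1 := h ((toLocalCoh J 0 M t).hom e)
  rw [← map_smul] at h1
  obtain ⟨t', ht, h2⟩ := exists_map_eq_zero J 0 M _ h1
  let P' : ProjectiveResolution (quotPow J t') := ProjectiveResolution.of _
  obtain ⟨φ, hφ⟩ := exists_lift P P' (quotPowMap J ht)
  have hr := (he.smul a).map (quotPowMap J ht) φ hφ
  rw [h2] at hr
  have h3 := hr.eq_zero_of_degree_zero
  rw [Linear.comp_smul, ← Category.assoc, hφ, Category.assoc, ← Linear.comp_smul] at h3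
  have h4 : a • (quotPowMap J ht ≫ q) = 0 := by
    rw [← cancel_epi (aug P'), h3, comp_zero]
  have h5 := congrArg (fun g => g.hom (Submodule.Quotient.mk 1)) h4
  have h6 : a • ((1 : S) • z) = 0 := h5
  rwa [one_smul] at h6

end LocalCoh

section TorsionInjective

variable {S : Type} [CommRing S]

/-- Every element is annihilated by a power of `J`. -/
def IsPowTors (J : Ideal S) (M : Type) [AddCommGroup M] [Module S M] : Prop :=
  ∀ z : M, ∃ t : ℕ, ∀ c ∈ J ^ t, c • z = 0

/-- The elements annihilated by a power of `J`. -/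
def powTors (J : Ideal S) (M : Type) [AddCommGroup M] [Module S M] : Submodule S M where
  carrier := {z | ∃ t : ℕ, ∀ c ∈ J ^ t, c • z = 0}
  add_mem' := by
    rintro z w ⟨t, hz⟩ ⟨t', hw⟩
    refine ⟨max t t', fun c hc => ?_⟩
    rw [smul_add, hz c (Ideal.pow_le_pow_right (le_max_left _ _) hc),
      hw c (Ideal.pow_le_pow_right (le_max_right _ _) hc), add_zero]
  zero_mem' := ⟨0, fun c _ => smul_zero c⟩
  smul_mem' := by
    rintro a z ⟨t, hz⟩
    exact ⟨t, fun c hc => by rw [smul_comm, hz c hc, smul_zero]⟩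

theorem isPowTors_powTors (J : Ideal S) (M : Type) [AddCommGroup M] [Module S M] :
    IsPowTors J (powTors J M) := fun z => by
  obtain ⟨t, ht⟩ := z.2
  exact ⟨t, fun c hc => Subtype.ext (ht c hc)⟩

theorem IsPowTors.of_surjective {J : Ideal S} {M M' : Type} [AddCommGroup M] [Module S M]
    [AddCommGroup M'] [Module S M'] (h : IsPowTors J M) (f : M →ₗ[S] M')
    (hf : Function.Surjective f) : IsPowTors J M' := fun z => by
  obtain ⟨z, rfl⟩ := hf z
  obtain ⟨t, ht⟩ := h z
  exact ⟨t, fun c hc => by rw [← map_smul, ht c hc, map_zero]⟩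

/-- A finitely generated submodule of torsion elements is annihilated by one power. -/
theorem exists_pow_smul_eq_zero {J : Ideal S} {M : Type} [AddCommGroup M] [Module S M]
    {N : Submodule S M} (hN : N.FG) (h : N ≤ powTors J M) :
    ∃ t : ℕ, ∀ c ∈ J ^ t, ∀ z ∈ N, c • z = 0 := by
  obtain ⟨F, rfl⟩ := hN
  have hF : ∀ z : F, ∃ t : ℕ, ∀ c ∈ J ^ t, c • (z : M) = 0 :=
    fun z => h (Submodule.subset_span z.2)
  choose t ht using hF
  refine ⟨F.attach.sup t, fun c hc z hz => ?_⟩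
  induction hz using Submodule.span_induction with
  | mem z hz =>
    exact ht ⟨z, hz⟩ c (Ideal.pow_le_pow_right
      (Finset.le_sup (f := t) (Finset.mem_attach F ⟨z, hz⟩)) hc)
  | zero => exact smul_zero c
  | add x y _ _ hx hy => rw [smul_add, hx, hy, add_zero]
  | smul a x _ hx => rw [smul_comm, hx, smul_zero]

/-- Over a Noetherian ring the torsion submodule of an injective module is injective. -/
theorem injective_powTors [IsNoetherianRing S] (J : Ideal S) (E : Type) [AddCommGroup E]
    [Module S E] [hE : Module.Injective S E] : Module.Injective S (powTors J E) := by
  refine Module.Baer.injective fun I g => ?_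
  obtain ⟨s, hs⟩ := exists_pow_smul_eq_zero (J := J) (N := LinearMap.range (Submodule.subtype _ ∘ₗ g))
    (by
      have := IsNoetherian.noetherian (⊤ : Submodule S I)
      rw [LinearMap.range_eq_map]
      exact this.map _) (by
      rintro _ ⟨x, rfl⟩
      exact (g x).2)
  obtain ⟨N, hN⟩ := Ideal.exists_pow_inf_eq_pow_smul (M := S) J (I : Submodule S S)
  have hker : ∀ x : I, (x : S) ∈ J ^ (N + s) → g x = 0 := by
    intro x hx
    have h1 : (x : S) ∈ J ^ s • (I : Submodule S S) := by
      have := hN (N + s) (Nat.le_add_right _ _)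
      rw [Nat.add_sub_cancel_left] at this
      have hx' : (x : S) ∈ J ^ (N + s) • (⊤ : Submodule S S) ⊓ I :=
        ⟨by simpa using hx, x.2⟩
      rw [this] at hx'
      exact Submodule.smul_mono le_rfl inf_le_right hx'
    have h2 : x ∈ J ^ s • (⊤ : Submodule S I) := by
      have h3 : J ^ s • (I : Submodule S S) = (J ^ s • (⊤ : Submodule S I)).map I.subtype := by
        rw [Submodule.map_smul'', Submodule.map_subtype_top]
      rw [h3] at h1
      obtain ⟨y, hy, hyx⟩ := h1
      rwa [← Subtype.ext hyx]
    refine Subtype.ext ?_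
    refine Submodule.smul_induction_on h2 (fun c hc y _ => ?_) (fun a b ha hb => ?_)
    · rw [map_smul]
      exact hs c hc _ ⟨y, rfl⟩
    · rw [map_add, Submodule.coe_add, ha, hb, ZeroMemClass.coe_zero, add_zero]
  let K : Submodule S I := Submodule.comap (Submodule.subtype I) (J ^ (N + s))
  let f : (I ⧸ K) →ₗ[S] S ⧸ J ^ (N + s) := K.mapQ _ (Submodule.subtype I) le_rfl
  have hf : Function.Injective f := by
    rw [← LinearMap.ker_eq_bot, Submodule.ker_mapQ]
    exact (Submodule.map_le_iff_le_comap.2 (by rw [← LinearMap.ker, Submodule.ker_mkQ])).antisymm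
      bot_le
  obtain ⟨h, hh⟩ := hE.out f hf (K.liftQ (Submodule.subtype _ ∘ₗ g) fun x hx => by
    rw [LinearMap.mem_ker, LinearMap.comp_apply, hker x hx, map_zero])
  have hmem : ∀ r : S, h (Submodule.Quotient.mk r) ∈ powTors J E := fun r => by
    refine ⟨N + s, fun c hc => ?_⟩
    rw [← map_smul, ← Submodule.Quotient.mk_smul, (Submodule.Quotient.mk_eq_zero _).2
      (show c • r ∈ J ^ (N + s) from (J ^ (N + s)).mul_mem_right r hc), map_zero]
  refine ⟨LinearMap.codRestrict _ (h ∘ₗ Submodule.mkQ _) hmem, fun x hx => Subtype.ext ?_⟩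
  exact hh (Submodule.Quotient.mk ⟨x, hx⟩)

end TorsionInjective

section KillStep

open CategoryTheory Opposite Limits

variable {S : Type} [CommRing S]

theorem quotPowMap_comp (J : Ideal S) {t t' t'' : ℕ} (h : t ≤ t') (h' : t' ≤ t'') :
    quotPowMap J h' ≫ quotPowMap J h = quotPowMap J (h.trans h') := by
  exact ModuleCat.hom_ext (Submodule.linearMap_qext _ (LinearMap.ext fun _ => rfl))

theorem IsCobound.comp {X X' : ModuleCat.{0} S} {P : ProjectiveResolution X}
    {P' : ProjectiveResolution X'} {M : ModuleCat.{0} S} {i : ℕ} {f : P.complex.X i ⟶ M}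
    (h : IsCobound P i f) (φ : P'.complex ⟶ P.complex) : IsCobound P' i (φ.f i ≫ f) := by
  cases i with
  | zero =>
    change f = 0 at h
    change _ = 0
    rw [h, comp_zero]
  | succ i =>
    obtain ⟨g, rfl⟩ := h
    exact ⟨φ.f i ≫ g, by rw [φ.comm_assoc]⟩

theorem IsCobound.smul {X : ModuleCat.{0} S} {P : ProjectiveResolution X} {M : ModuleCat.{0} S}
    {i : ℕ} {f : P.complex.X i ⟶ M} (h : IsCobound P i f) (a : S) : IsCobound P i (a • f) := by
  cases i with
  | zero =>
    change f = 0 at h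
    change _ = 0
    rw [h, smul_zero]
  | succ i =>
    obtain ⟨g, rfl⟩ := h
    exact ⟨a • g, by rw [Linear.comp_smul]⟩

theorem Dies.of_comp {J : Ideal S} {t t' : ℕ} {P : ProjectiveResolution (quotPow J t)}
    {P' : ProjectiveResolution (quotPow J t')} {M : ModuleCat.{0} S} {i : ℕ}
    {f : P.complex.X i ⟶ M} (h : t ≤ t') (φ : P'.complex ⟶ P.complex)
    (hφ : φ.f 0 ≫ aug P = aug P' ≫ quotPowMap J h) (hd : Dies J P' i (φ.f i ≫ f)) :
    Dies J P i f := by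
  obtain ⟨t'', h', P'', ψ, hψ, hc⟩ := hd
  refine ⟨t'', h.trans h', P'', ψ ≫ φ, ?_, ?_⟩
  · rw [HomologicalComplex.comp_f, Category.assoc, hφ, ← Category.assoc, hψ, Category.assoc,
      quotPowMap_comp]
  · rwa [HomologicalComplex.comp_f, Category.assoc]

theorem IsCobound.dies {J : Ideal S} {t : ℕ} {P : ProjectiveResolution (quotPow J t)}
    {M : ModuleCat.{0} S} {i : ℕ} {f : P.complex.X i ⟶ M} (h : IsCobound P i f) :
    Dies J P i f := by
  refine ⟨t, le_rfl, P, 𝟙 _, ?_, h.comp _⟩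
  have : quotPowMap J (le_refl t) = 𝟙 _ :=
    ModuleCat.hom_ext (Submodule.linearMap_qext _ (LinearMap.ext fun _ => rfl))
  rw [this, HomologicalComplex.id_f, Category.id_comp, Category.comp_id]

theorem exists_injective_isPowTors [IsNoetherianRing S] {J : Ideal S} (K : ModuleCat.{0} S)
    (hK : IsPowTors J K) : ∃ (G : ModuleCat.{0} S) (_ : Injective G) (_ : IsPowTors J G)
      (ι : K ⟶ G), Mono ι := by
  obtain ⟨E, hE, j, hj⟩ : ∃ E : ModuleCat.{0} S, Injective E ∧ ∃ j : K ⟶ E, Mono j :=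
    ⟨Injective.under K, inferInstance, Injective.ι K, inferInstance⟩
  have hE' : Injective (ModuleCat.of S E) := hE
  have : Module.Injective S E := Module.injective_module_of_injective_object S E
  have := injective_powTors J E
  refine ⟨ModuleCat.of S (powTors J E), Module.injective_object_of_injective_module S _,
    isPowTors_powTors J E, ModuleCat.ofHom (LinearMap.codRestrict _ j.hom
      fun z => ?_), (ModuleCat.mono_iff_injective _).2 fun x y hxy => ?_⟩
  · obtain ⟨t, ht⟩ := hK z
    exact ⟨t, fun c hc => by rw [← map_smul, ht c hc, map_zero]⟩
  · exact (ModuleCat.mono_iff_injective _).1 hj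
      (congrArg Subtype.val hxy)

theorem exists_extend {X : ModuleCat.{0} S} (P : ProjectiveResolution X) {i : ℕ}
    {K G : ModuleCat.{0} S} [Injective G] (f : P.complex.X (i + 1) ⟶ K)
    (hf : P.complex.d (i + 2) (i + 1) ≫ f = 0) (ι : K ⟶ G) :
    ∃ g : P.complex.X i ⟶ G, P.complex.d (i + 1) i ≫ g = f ≫ ι := by
  have h0 : P.complex.d (i + 2) (i + 1) ≫ f ≫ ι = 0 := by
    rw [← Category.assoc, hf, zero_comp]
  exact ⟨(P.exact_succ i).descToInjective (f ≫ ι) h0,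
    (P.exact_succ i).comp_descToInjective (f ≫ ι) h0⟩

theorem dies_of_isPowTors [IsNoetherianRing S] {J : Ideal S} (i : ℕ) :
    ∀ (K : ModuleCat.{0} S) (_ : IsPowTors J K) (t : ℕ) (P : ProjectiveResolution (quotPow J t))
      (f : P.complex.X (i + 1) ⟶ K), P.complex.d (i + 2) (i + 1) ≫ f = 0 → Dies J P (i + 1) f := by
  induction i with
  | zero =>
    intro K hK t P f hf
    obtain ⟨G, hG, hGt, ι, hι⟩ := exists_injective_isPowTors K hK
    obtain ⟨g, hg⟩ := exists_extend P f hf ι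
    let T := ShortComplex.mk ι (cokernel.π ι) (cokernel.condition ι)
    have hT : T.Exact := ShortComplex.exact_cokernel ι
    obtain ⟨w, hw⟩ := exists_aug_comp P (g ≫ cokernel.π ι) (by
      rw [← Category.assoc, hg, Category.assoc, cokernel.condition, comp_zero])
    have hsurj : Function.Surjective (cokernel.π ι).hom :=
      (ModuleCat.epi_iff_surjective _).1 inferInstance
    obtain ⟨y, hy⟩ := hsurj (w.hom (Submodule.Quotient.mk 1))
    obtain ⟨s, hs⟩ := hGt y
    let w' : quotPow J (max t s) ⟶ G := ModuleCat.ofHom ((J ^ (max t s)).liftQ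
      (LinearMap.toSpanSingleton S G y) fun c hc =>
        hs c (Ideal.pow_le_pow_right (le_max_right _ _) hc))
    have hw' : w' ≫ cokernel.π ι = quotPowMap J (le_max_left t s) ≫ w := by
      refine ModuleCat.hom_ext (Submodule.linearMap_qext _ (LinearMap.ext_ring ?_))
      change (cokernel.π ι).hom ((1 : S) • y) = w.hom (Submodule.Quotient.mk 1)
      rw [one_smul, hy]
    let P' : ProjectiveResolution (quotPow J (max t s)) := ProjectiveResolution.of _
    obtain ⟨φ, hφ⟩ := exists_lift P P' (quotPowMap J (le_max_left t s))
    have h0 : (φ.f 0 ≫ g - aug P' ≫ w') ≫ T.g = 0 := by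
      rw [Preadditive.sub_comp, Category.assoc, Category.assoc]
      change φ.f 0 ≫ g ≫ cokernel.π ι - aug P' ≫ w' ≫ cokernel.π ι = 0
      rw [← hw, hw', ← Category.assoc, ← Category.assoc, hφ, sub_self]
    have : Mono T.f := hι
    refine ⟨_, le_max_left t s, P', φ, hφ, hT.lift _ h0, ?_⟩
    rw [← cancel_mono T.f, Category.assoc, Category.assoc, hT.lift_f, Preadditive.comp_sub,
      ← Category.assoc, ← Category.assoc _ (aug P'), d_comp_aug, zero_comp, sub_zero]
    change φ.f 1 ≫ f ≫ ι = _
    rw [← hg, φ.comm_assoc]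
  | succ i ih =>
    intro K hK t P f hf
    obtain ⟨G, hG, hGt, ι, hι⟩ := exists_injective_isPowTors K hK
    obtain ⟨g, hg⟩ := exists_extend P f hf ι
    let T := ShortComplex.mk ι (cokernel.π ι) (cokernel.condition ι)
    have hT : T.Exact := ShortComplex.exact_cokernel ι
    have hsurj : Function.Surjective (cokernel.π ι).hom :=
      (ModuleCat.epi_iff_surjective _).1 inferInstance
    obtain ⟨t', ht, P', φ, hφ, h, hh⟩ := ih (cokernel ι)
      (hGt.of_surjective (cokernel.π ι).hom hsurj) t P (g ≫ cokernel.π ι) (by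
        rw [← Category.assoc, hg, Category.assoc, cokernel.condition, comp_zero])
    have : Projective (P'.complex.X i) := P'.projective i
    let h' := Projective.factorThru h (cokernel.π ι)
    have hh' : h' ≫ cokernel.π ι = h := Projective.factorThru_comp _ _
    have h0 : (φ.f (i + 1) ≫ g - P'.complex.d (i + 1) i ≫ h') ≫ T.g = 0 := by
      rw [Preadditive.sub_comp, Category.assoc, Category.assoc]
      change φ.f (i + 1) ≫ g ≫ cokernel.π ι - P'.complex.d (i + 1) i ≫ h' ≫ cokernel.π ι = 0
      rw [hh', hh, sub_self]
    have : Mono T.f := hι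
    refine ⟨t', ht, P', φ, hφ, hT.lift _ h0, ?_⟩
    rw [← cancel_mono T.f, Category.assoc, Category.assoc, hT.lift_f, Preadditive.comp_sub,
      ← Category.assoc, ← Category.assoc _ _ h', P'.complex.d_comp_d, zero_comp, sub_zero]
    change φ.f (i + 2) ≫ f ≫ ι = _
    rw [← hg, φ.comm_assoc]

end KillStep

section KillRecursion

open CategoryTheory Opposite Limits

variable {S : Type} [CommRing S]

theorem IsCobound.add {X : ModuleCat.{0} S} {P : ProjectiveResolution X} {M : ModuleCat.{0} S}
    {i : ℕ} {f g : P.complex.X i ⟶ M} (hf : IsCobound P i f) (hg : IsCobound P i g) :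
    IsCobound P i (f + g) := by
  cases i with
  | zero =>
    change f = 0 at hf
    change g = 0 at hg
    change _ = 0
    rw [hf, hg, add_zero]
  | succ i =>
    obtain ⟨u, rfl⟩ := hf
    obtain ⟨v, rfl⟩ := hg
    exact ⟨u + v, by rw [Preadditive.comp_add]⟩

theorem IsCobound.comp_right {X : ModuleCat.{0} S} {P : ProjectiveResolution X}
    {M M' : ModuleCat.{0} S} {i : ℕ} {f : P.complex.X i ⟶ M} (hf : IsCobound P i f) (g : M ⟶ M') :
    IsCobound P i (f ≫ g) := by
  cases i with
  | zero =>
    change f = 0 at hf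
    change _ = 0
    rw [hf, zero_comp]
  | succ i =>
    obtain ⟨u, rfl⟩ := hf
    exact ⟨u ≫ g, by rw [Category.assoc]⟩

theorem Dies.add_isCobound {J : Ideal S} {t : ℕ} {P : ProjectiveResolution (quotPow J t)}
    {M : ModuleCat.{0} S} {i : ℕ} {f g : P.complex.X i ⟶ M} (hf : Dies J P i f)
    (hg : IsCobound P i g) : Dies J P i (f + g) := by
  obtain ⟨t', ht, P', φ, hφ, hc⟩ := hf
  exact ⟨t', ht, P', φ, hφ, by
    rw [Preadditive.comp_add]
    exact hc.add (hg.comp φ)⟩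

theorem Dies.comp_right {J : Ideal S} {t : ℕ} {P : ProjectiveResolution (quotPow J t)}
    {M M' : ModuleCat.{0} S} {i : ℕ} {f : P.complex.X i ⟶ M} (hf : Dies J P i f) (g : M ⟶ M') :
    Dies J P i (f ≫ g) := by
  obtain ⟨t', ht, P', φ, hφ, hc⟩ := hf
  exact ⟨t', ht, P', φ, hφ, by
    rw [← Category.assoc]
    exact hc.comp_right g⟩

theorem kills_zero {J : Ideal S} {a : S} {M : ModuleCat.{0} S}
    (h : ∀ (z : M) (t : ℕ), (∀ c ∈ J ^ t, c • z = 0) → a • z = 0) : Kills J a 0 M := by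
  intro t P f hf
  apply IsCobound.dies
  obtain ⟨w, rfl⟩ := exists_aug_comp P f hf
  change _ = 0
  have : a • w = 0 := by
    refine ModuleCat.hom_ext (Submodule.linearMap_qext _ (LinearMap.ext_ring ?_))
    refine h (w.hom (Submodule.Quotient.mk 1)) t fun c hc => ?_
    rw [← map_smul, ← Submodule.Quotient.mk_smul, (Submodule.Quotient.mk_eq_zero _).2, map_zero]
    simpa using hc
  rw [← Linear.comp_smul, this, comp_zero]

/-- Scalars annihilating the resolved module send cocycles to coboundaries. -/
theorem isCobound_smul {J : Ideal S} {t : ℕ} (P : ProjectiveResolution (quotPow J t))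
    {M : ModuleCat.{0} S} {i : ℕ} (f : P.complex.X (i + 1) ⟶ M)
    (hf : P.complex.d (i + 2) (i + 1) ≫ f = 0) {c : S} (hc : c ∈ J ^ t) :
    IsCobound P (i + 1) (c • f) := by
  have h0 : (c • 𝟙 P.complex) ≫ P.π = 0 := by
    apply HomologicalComplex.to_single_hom_ext
    have h1 : aug P ≫ (c • 𝟙 (quotPow J t)) = 0 := by
      rw [show c • 𝟙 (quotPow J t) = 0 from ?_, comp_zero]
      refine ModuleCat.hom_ext (Submodule.linearMap_qext _ (LinearMap.ext_ring ?_))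
      change c • (Submodule.Quotient.mk 1 : S ⧸ J ^ t) = 0
      rw [← Submodule.Quotient.mk_smul, Submodule.Quotient.mk_eq_zero]
      simpa using hc
    rw [Linear.comp_smul, Category.comp_id] at h1
    rw [HomologicalComplex.comp_f, HomologicalComplex.smul_f_apply, HomologicalComplex.id_f,
      Linear.smul_comp, Category.id_comp]
    exact h1
  have H := ProjectiveResolution.liftHomotopyZero (c • 𝟙 P.complex) h0
  have hcomm := H.comm (i + 1)
  rw [Homotopy.dNext_succ_chainComplex, Homotopy.prevD_chainComplex] at hcomm
  refine ⟨H.hom i (i + 1) ≫ f, ?_⟩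
  have := congrArg (fun g => g ≫ f) hcomm
  simpa [hf] using this

theorem dies_smul_of_isCobound [IsNoetherianRing S] {J : Ideal S} {y a : S}
    {M M'' : ModuleCat.{0} S} (π : M ⟶ M'') [Epi π]
    (hπ : ∀ z, π.hom z = 0 ↔ ∃ w, z = y • w)
    (hy : ∀ z : M, y • z = 0 → ∃ t, ∀ c ∈ J ^ t, c • z = 0) {i : ℕ} (ha : Kills J a i M'')
    {t : ℕ} (P : ProjectiveResolution (quotPow J t)) (f : P.complex.X (i + 1) ⟶ M)
    (hf : P.complex.d (i + 2) (i + 1) ≫ f = 0) (hyf : IsCobound P (i + 1) (y • f)) :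
    Dies J P (i + 1) (a • f) := by
  obtain ⟨g, hg⟩ := hyf
  have hyπ : y • π = 0 := by
    refine ModuleCat.hom_ext (LinearMap.ext fun z => ?_)
    change y • π.hom z = 0
    rw [← map_smul, hπ]
    exact ⟨z, rfl⟩
  obtain ⟨t', ht, P', φ, hφ, hc⟩ := ha t P (g ≫ π) (by
    rw [← Category.assoc, ← hg, Linear.smul_comp, ← Linear.comp_smul, hyπ, comp_zero])
  have hproj : ∀ j, Projective (P'.complex.X j) := P'.projective
  obtain ⟨c, hdc, hcπ⟩ : ∃ c : P'.complex.X i ⟶ M, P'.complex.d (i + 1) i ≫ c = 0 ∧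
      (a • (φ.f i ≫ g)) ≫ π = c ≫ π := by
    cases i with
    | zero =>
      change _ = 0 at hc
      refine ⟨0, comp_zero, ?_⟩
      rw [zero_comp, ← hc]
      simp
    | succ i =>
      obtain ⟨h, hh⟩ := hc
      refine ⟨P'.complex.d (i + 1) i ≫ Projective.factorThru h π, ?_, ?_⟩
      · rw [← Category.assoc, P'.complex.d_comp_d, zero_comp]
      · rw [Category.assoc, Projective.factorThru_comp, ← hh]
        simp
  let T := ShortComplex.mk (y • 𝟙 M) π (by rw [Linear.smul_comp, Category.id_comp, hyπ])
  have hT : T.Exact := by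
    rw [ShortComplex.moduleCat_exact_iff]
    intro z hz
    obtain ⟨w, hw⟩ := (hπ z).1 hz
    exact ⟨w, hw.symm⟩
  have h1 : (a • (φ.f i ≫ g) - c) ≫ T.g = 0 := by
    rw [Preadditive.sub_comp]
    exact sub_eq_zero.2 hcπ
  let l : P'.complex.X i ⟶ M := hT.liftFromProjective _ h1
  have hl : y • l = a • (φ.f i ≫ g) - c := by
    have : l ≫ (y • 𝟙 M) = _ := hT.liftFromProjective_comp _ h1
    rwa [Linear.comp_smul, Category.comp_id] at this
  let U := ShortComplex.mk (kernel.ι (y • 𝟙 M)) (y • 𝟙 M) (kernel.condition _)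
  have hU : U.Exact := ShortComplex.exact_kernel _
  have hmono : Mono U.f := inferInstanceAs (Mono (kernel.ι _))
  have h2 : (a • (φ.f (i + 1) ≫ f) - P'.complex.d (i + 1) i ≫ l) ≫ U.g = 0 := by
    change _ ≫ (y • 𝟙 M) = 0
    rw [Linear.comp_smul, Category.comp_id, smul_sub, ← Linear.comp_smul _ _ _ _ _ l, hl,
      Preadditive.comp_sub, hdc, sub_zero, Linear.comp_smul, ← φ.comm_assoc, ← hg,
      Linear.comp_smul, smul_comm, sub_self]
  have htors : IsPowTors J (kernel (y • 𝟙 M) : ModuleCat.{0} S) := by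
    intro z
    obtain ⟨s, hs⟩ := hy ((kernel.ι (y • 𝟙 M)).hom z) (by
      have := congrArg (fun q => q.hom z) (kernel.condition (y • 𝟙 M))
      exact this)
    refine ⟨s, fun c hc => (ModuleCat.mono_iff_injective _).1 hmono ?_⟩
    change (kernel.ι (y • 𝟙 M)).hom (c • z) = (kernel.ι (y • 𝟙 M)).hom 0
    rw [map_smul, hs c hc, map_zero]
  let u : P'.complex.X (i + 1) ⟶ kernel (y • 𝟙 M) := hU.lift _ h2
  have hu : u ≫ kernel.ι (y • 𝟙 M) = a • (φ.f (i + 1) ≫ f) - P'.complex.d (i + 1) i ≫ l :=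
    hU.lift_f _ h2
  have hdu : P'.complex.d (i + 2) (i + 1) ≫ u = 0 := by
    rw [← cancel_mono (kernel.ι (y • 𝟙 M)), Category.assoc, hu, Preadditive.comp_sub,
      ← Category.assoc _ _ l, P'.complex.d_comp_d, Linear.comp_smul, ← φ.comm_assoc, hf]
    simp
  have h3 := ((dies_of_isPowTors i _ htors t' P' u hdu).comp_right
    (kernel.ι (y • 𝟙 M))).add_isCobound (⟨l, rfl⟩ : IsCobound P' (i + 1) (P'.complex.d (i + 1) i ≫ l))
  rw [hu, sub_add_cancel, ← Linear.comp_smul] at h3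
  exact h3.of_comp ht φ hφ

theorem Kills.succ [IsNoetherianRing S] {J : Ideal S} {x a : S}
    {M M'' : ModuleCat.{0} S} (π : M ⟶ M'') [Epi π]
    (hπ : ∀ z, π.hom z = 0 ↔ ∃ w, z = x ^ 2 • w) (hxJ : x ∈ J)
    (hy : ∀ z : M, x ^ 2 • z = 0 → ∃ t, ∀ c ∈ J ^ t, c • z = 0) {i : ℕ} (hx : Kills J x i M'')
    (ha : Kills J a i M'') : Kills J a (i + 1) M := by
  have key : ∀ (N t : ℕ) (P : ProjectiveResolution (quotPow J t)) (f : P.complex.X (i + 1) ⟶ M),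
      P.complex.d (i + 2) (i + 1) ≫ f = 0 → IsCobound P (i + 1) (x ^ (N + 2) • f) →
      Dies J P (i + 1) (a • f) := by
    intro N
    induction N with
    | zero => exact fun t P f hf hc => dies_smul_of_isCobound π hπ hy ha P f hf hc
    | succ N ih =>
      intro t P f hf hc
      obtain ⟨t', ht, P', φ, hφ, hd⟩ := dies_smul_of_isCobound π hπ hy hx P (x ^ (N + 1) • f)
        (by rw [Linear.comp_smul, hf, smul_zero]) (by
          rw [smul_smul, ← pow_add, show 2 + (N + 1) = N + 1 + 2 by omega]
          exact hc)
      refine Dies.of_comp ht φ hφ ?_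
      rw [Linear.comp_smul]
      refine ih t' P' (φ.f (i + 1) ≫ f) (by rw [← φ.comm_assoc, hf, comp_zero]) ?_
      rwa [smul_smul, ← pow_succ', Linear.comp_smul] at hd
  intro t P f hf
  refine key t t P f hf ?_
  rw [pow_add, mul_comm, mul_smul]
  exact (isCobound_smul P f hf (Ideal.pow_mem_pow hxJ t)).smul _

end KillRecursion

section KillReal

open CategoryTheory

variable {S L : Type} [CommRing S] [IsLocalRing S] [AddCommGroup L] [Module S L]
  {𝔞 : Ideal S}

open IsLocalRing

theorem le_maximalIdeal_of_radical_eq (h : 𝔞.radical = maximalIdeal S) : 𝔞 ≤ maximalIdeal S :=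
  h ▸ Ideal.le_radical

variable [IsNoetherianRing S]

theorem exists_pow_le_of_radical_eq (h : 𝔞.radical = maximalIdeal S) (N : ℕ) :
    ∃ t, maximalIdeal S ^ t ≤ 𝔞 ^ N := by
  obtain ⟨r, hr⟩ := Ideal.exists_radical_pow_le_of_fg 𝔞 (IsNoetherian.noetherian _)
  rw [h] at hr
  exact ⟨r * N, by rw [pow_mul]; exact Ideal.pow_right_mono hr N⟩

theorem HT.kills (h𝔞 : 𝔞.radical = maximalIdeal S) {ι : Type} {x : ι → S} (i : ℕ) :
    ∀ {e : ℕ} {I : Finset ι} {Q : Submodule S L}, i < e → Rich 𝔞 x e I →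
      HT 𝔞 x (GoodPos 𝔞) e I Q →
      ∀ a ∈ 𝔞, Kills (maximalIdeal S) a i (ModuleCat.of S (L ⧸ Q)) := by
  classical
  induction i with
  | zero =>
    intro e I Q hi _ hQ a ha
    refine kills_zero fun z t hz => ?_
    obtain ⟨z, rfl⟩ := Submodule.Quotient.mk_surjective _ z
    change Submodule.Quotient.mk (a • z) = 0
    rw [Submodule.Quotient.mk_eq_zero]
    refine hQ.head hi z ⟨t, fun c hc => ?_⟩ a ha
    exact (Submodule.Quotient.mk_eq_zero _).1
      (hz c (Ideal.pow_right_mono (le_maximalIdeal_of_radical_eq h𝔞) t hc))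
  | succ i ih =>
    intro e I Q hi hI hQ a ha
    obtain ⟨e, rfl⟩ : ∃ e', e = e' + 1 := ⟨e - 1, by omega⟩
    obtain rfl | ⟨j, hj⟩ := I.eq_empty_or_nonempty
    · have : a = 0 := by simpa using hI.le_span ha
      subst this
      intro t P f _
      exact IsCobound.dies ⟨0, by simp⟩
    · obtain ⟨hx, hFR, -, hQ'⟩ := hQ.2 j hj
      let π : ModuleCat.of S (L ⧸ Q) ⟶ ModuleCat.of S (L ⧸ Spl.adj Q (x j ^ 2)) :=
        ModuleCat.ofHom (Submodule.factor (le_adj Q _))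
      have : Epi π := (ModuleCat.epi_iff_surjective _).2 (Submodule.factor_surjective (le_adj Q _))
      refine Kills.succ (x := x j) π (fun z => ?_) (le_maximalIdeal_of_radical_eq h𝔞 hx)
        (fun z hz => ?_) (ih (by omega) (hI.erase j) hQ' _ hx) (ih (by omega) (hI.erase j) hQ' _ ha)
      · obtain ⟨z, rfl⟩ := Submodule.Quotient.mk_surjective _ z
        have h1 : π.hom (Submodule.Quotient.mk z) = 0 ↔ z ∈ Spl.adj Q (x j ^ 2) :=
          Submodule.Quotient.mk_eq_zero _
        rw [h1, mem_adj]
        constructor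
        · rintro ⟨l, hl⟩
          exact ⟨Submodule.Quotient.mk l, (Submodule.Quotient.eq _).2 hl⟩
        · rintro ⟨w, hw⟩
          obtain ⟨w, rfl⟩ := Submodule.Quotient.mk_surjective _ w
          exact ⟨w, (Submodule.Quotient.eq _).1 hw⟩
      · obtain ⟨z, rfl⟩ := Submodule.Quotient.mk_surjective _ z
        obtain ⟨N, hN⟩ := FR.sq hFR z ((Submodule.Quotient.mk_eq_zero _).1 hz)
        obtain ⟨t, ht⟩ := exists_pow_le_of_radical_eq h𝔞 N
        exact ⟨t, fun c hc => (Submodule.Quotient.mk_eq_zero _).2 (hN c (ht hc))⟩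

/-- A tower of good quotients forces all systems of parameters in the ideal to be standard. -/
theorem Real.isStandardIdeal [Module.Finite S L] (h𝔞 : 𝔞.radical = maximalIdeal S) {d : ℕ}
    (hd : moduleDim S L ≤ (d : ℕ∞)) (h : Real 𝔞 d (⊥ : Submodule S L)) :
    IsStandardIdeal S L 𝔞 := by
  refine ⟨h𝔞, fun e b hb hsop => ⟨hsop, fun i j hij => ?_⟩⟩
  have hed : e ≤ d := by
    rw [hsop.2.1] at hd
    exact_mod_cast hd
  obtain ⟨ι, x, I, hI, hQ⟩ := (h.of_le hed).sop (le_maximalIdeal_of_radical_eq h𝔞) b hb hsop.2.2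
    j (by omega)
  rw [Ideal.span_le]
  rintro _ ⟨l, rfl⟩
  rw [SetLike.mem_coe, Module.mem_annihilator]
  exact (hQ.kills h𝔞 i (by omega) hI _ (hb l)).smul_eq_zero

theorem IsStandardIdeal.exists_rich [Module.Finite S L] (h : IsStandardIdeal S L 𝔞) :
    ∃ d : ℕ, moduleDim S L ≤ (d : ℕ∞) ∧ ∃ I : Finset (ℕ × S), Rich 𝔞 Prod.snd d I ∧
      HT 𝔞 Prod.snd (GoodPos 𝔞) d I (⊥ : Submodule S L) := by
  obtain ⟨d, hd, hd'⟩ : ∃ d : ℕ, moduleDim S L ≤ (d : ℕ∞) ∧ (d ≠ 0 → moduleDim S L = (d : ℕ∞)) := by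
    have hfin : moduleDim S L ≤ ringKrullDim S := ringKrullDim_quotient_le _
    have : ringKrullDim S < ⊤ := ringKrullDim_lt_top
    induction hm : moduleDim S L with
    | bot => exact ⟨0, bot_le, by simp⟩
    | coe a =>
      induction a with
      | top =>
        rw [hm] at hfin
        exact absurd this (not_lt.2 hfin)
      | coe d => exact ⟨d, le_rfl, fun _ => rfl⟩
  refine ⟨d, hd, exists_rich_of_parameters h.1 hd fun a ha h0 j hj z hz i => ?_⟩
  have hsop := h.2 d a ha ⟨fun i => le_maximalIdeal_of_radical_eq h.1 (ha i), hd' (by omega), h0⟩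
  have h1 := hsop.2 0 j (by omega)
  obtain ⟨N, hN⟩ := hz
  obtain ⟨t, ht⟩ := exists_pow_le_of_radical_eq h.1 N
  rw [← Submodule.Quotient.mk_eq_zero, Submodule.Quotient.mk_smul]
  exact smul_eq_zero_of_localCoh (M := ModuleCat.of S (L ⧸ _)) (fun y =>
    Module.mem_annihilator.1 (h1 (Ideal.subset_span ⟨i, rfl⟩)) y) (Submodule.Quotient.mk z) t
      fun c hc => (Submodule.Quotient.mk_eq_zero _).2 (hN c (ht hc))

end KillReal

section HTComap

variable {S F L : Type} [CommRing S] [AddCommGroup F] [Module S F] [AddCommGroup L] [Module S L]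
  {𝔞 : Ideal S} {π : F →ₗ[S] L}

theorem comap_sat (Q : Submodule S L) : sat 𝔞 (Q.comap π) = (sat 𝔞 Q).comap π := by
  ext z
  simp [mem_sat]

theorem comap_adj (hπ : Function.Surjective π) (Q : Submodule S L) (y : S) :
    adj (Q.comap π) y = (adj Q y).comap π := by
  ext z
  simp only [Submodule.mem_comap, mem_adj, map_sub, map_smul]
  exact ⟨fun ⟨l, hl⟩ => ⟨π l, hl⟩, fun ⟨l, hl⟩ => by
    obtain ⟨l, rfl⟩ := hπ l
    exact ⟨l, hl⟩⟩

theorem good_comap (hπ : Function.Surjective π) (Q : Submodule S L) :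
    Good 𝔞 (Q.comap π) ↔ Good 𝔞 Q := by
  simp only [Good, comap_sat, Submodule.mem_comap, map_smul]
  exact ⟨fun h z hz c hc => by
    obtain ⟨z, rfl⟩ := hπ z
    exact h z hz c hc, fun h z hz c hc => h (π z) hz c hc⟩

theorem FR_comap (hπ : Function.Surjective π) (Q : Submodule S L) (y : S) :
    FR 𝔞 y (Q.comap π) ↔ FR 𝔞 y Q := by
  simp only [FR, comap_sat, Submodule.mem_comap, map_smul]
  exact ⟨fun h z hz => by
    obtain ⟨z, rfl⟩ := hπ z
    exact h z hz, fun h z hz => h (π z) hz⟩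

theorem HT_comap (hπ : Function.Surjective π) {ι : Type} {x : ι → S} {d : ℕ} :
    ∀ {I : Finset ι} {Q : Submodule S L},
      HT 𝔞 x (GoodPos 𝔞) d I (Q.comap π) ↔ HT 𝔞 x (GoodPos 𝔞) d I Q := by
  induction d with
  | zero =>
    intro I Q
    simp [HT, GoodPos]
  | succ d ih =>
    intro I Q
    simp only [HT, GoodPos, good_comap hπ, FR_comap hπ, comap_adj hπ]
    simp only [← GoodPos.eq_1, ih]

end HTComap

section AsympHom

open Filter Matrix

/-- A family of maps that is asymptotically a ring homomorphism along a filter and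
asymptotically preserves exactness of complexes of free modules. -/
structure IsAsympHom (S : Type) [CommRing S] {Ω : Type*} (𝓕 : Filter Ω) (T : Ω → Type)
    [∀ ω, CommRing (T ω)] (σ : ∀ ω, S → T ω) : Prop where
  map_zero : ∀ᶠ ω in 𝓕, σ ω 0 = 0
  map_one : ∀ᶠ ω in 𝓕, σ ω 1 = 1
  map_add : ∀ a b, ∀ᶠ ω in 𝓕, σ ω (a + b) = σ ω a + σ ω b
  map_mul : ∀ a b, ∀ᶠ ω in 𝓕, σ ω (a * b) = σ ω a * σ ω b
  exists_ker : ∀ {ι κ : Type} [Fintype ι] [Fintype κ] (D : Matrix ι κ S),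
    ∃ (l : ℕ) (C : Matrix κ (Fin l) S), D * C = 0 ∧
      ∀ᶠ ω in 𝓕, ∀ v, (D.map (σ ω)).mulVec v = 0 → ∃ z, v = (C.map (σ ω)).mulVec z

variable {S : Type} [CommRing S] {Ω : Type*} {𝓕 : Filter Ω} {T : Ω → Type}
  [∀ ω, CommRing (T ω)] {σ : ∀ ω, S → T ω}

namespace IsAsympHom

theorem map_sum (h : IsAsympHom S 𝓕 T σ) {κ : Type*} (s : Finset κ) (f : κ → S) :
    ∀ᶠ ω in 𝓕, σ ω (∑ i ∈ s, f i) = ∑ i ∈ s, σ ω (f i) := by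
  classical
  induction s using Finset.induction_on with
  | empty => simpa using h.map_zero
  | insert i s hi ih =>
    filter_upwards [ih, h.map_add (f i) (∑ i ∈ s, f i)] with ω h1 h2
    rw [Finset.sum_insert hi, Finset.sum_insert hi, h2, h1]

theorem map_pow (h : IsAsympHom S 𝓕 T σ) (a : S) (n : ℕ) :
    ∀ᶠ ω in 𝓕, σ ω (a ^ n) = σ ω a ^ n := by
  induction n with
  | zero => simpa using h.map_one
  | succ n ih =>
    filter_upwards [ih, h.map_mul (a ^ n) a] with ω h1 h2
    rw [pow_succ, h2, h1, pow_succ]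

variable {ι κ l : Type}

theorem matrix_mul (h : IsAsympHom S 𝓕 T σ) [Finite ι] [Fintype κ] [Finite l] (M : Matrix ι κ S)
    (N : Matrix κ l S) : ∀ᶠ ω in 𝓕, (M * N).map (σ ω) = M.map (σ ω) * N.map (σ ω) := by
  have h1 : ∀ᶠ ω in 𝓕, ∀ i j, σ ω (∑ k, M i k * N k j) = ∑ k, σ ω (M i k * N k j) :=
    eventually_all.2 fun i => eventually_all.2 fun j => h.map_sum _ _
  have h2 : ∀ᶠ ω in 𝓕, ∀ i j k, σ ω (M i k * N k j) = σ ω (M i k) * σ ω (N k j) :=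
    eventually_all.2 fun i => eventually_all.2 fun j => eventually_all.2 fun k => h.map_mul _ _
  filter_upwards [h1, h2] with ω h1 h2
  ext i j
  simp only [Matrix.map_apply, Matrix.mul_apply, h1, h2]

theorem matrix_add (h : IsAsympHom S 𝓕 T σ) [Finite ι] [Finite κ] (M N : Matrix ι κ S) :
    ∀ᶠ ω in 𝓕, (M + N).map (σ ω) = M.map (σ ω) + N.map (σ ω) := by
  filter_upwards [eventually_all.2 fun i => eventually_all.2 fun j =>
    h.map_add (M i j) (N i j)] with ω h1
  ext i j
  simpa using h1 i j

theorem matrix_smul (h : IsAsympHom S 𝓕 T σ) [Finite ι] [Finite κ] (y : S) (M : Matrix ι κ S) :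
    ∀ᶠ ω in 𝓕, (y • M).map (σ ω) = σ ω y • M.map (σ ω) := by
  filter_upwards [eventually_all.2 fun i => eventually_all.2 fun j =>
    h.map_mul y (M i j)] with ω h1
  ext i j
  simpa using h1 i j

theorem matrix_one (h : IsAsympHom S 𝓕 T σ) [DecidableEq ι] :
    ∀ᶠ ω in 𝓕, (1 : Matrix ι ι S).map (σ ω) = 1 := by
  filter_upwards [h.map_zero, h.map_one] with ω h0 h1
  ext i j
  by_cases hij : i = j <;> simp [Matrix.one_apply, hij, h0, h1]

theorem matrix_sum (h : IsAsympHom S 𝓕 T σ) [Finite ι] [Finite κ] {l : Type*} (s : Finset l)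
    (M : l → Matrix ι κ S) :
    ∀ᶠ ω in 𝓕, (∑ i ∈ s, M i).map (σ ω) = ∑ i ∈ s, (M i).map (σ ω) := by
  filter_upwards [eventually_all.2 fun i => eventually_all.2 fun j =>
    h.map_sum s (fun l => M l i j)] with ω h1
  ext i j
  simpa [Matrix.sum_apply] using h1 i j

/-- Membership in finitely generated ideals specializes. -/
theorem mem_span (h : IsAsympHom S 𝓕 T σ) {ι : Type} {y : ι → S} {G : Finset ι} {s : S}
    (hs : s ∈ Ideal.span (y '' G)) :
    ∀ᶠ ω in 𝓕, σ ω s ∈ Ideal.span ((fun i => σ ω (y i)) '' G) := by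
  obtain ⟨c, rfl⟩ := (Submodule.mem_span_image_finset_iff_exists_fun' S).1 hs
  have h2 : ∀ᶠ ω in 𝓕, ∀ i ∈ G, σ ω (c i • y i) = σ ω (c i) * σ ω (y i) :=
    (eventually_all_finset G).2 fun i _ => h.map_mul _ _
  filter_upwards [h.map_sum G (fun i => c i • y i), h2] with ω h1 h2
  rw [h1]
  exact Ideal.sum_mem _ fun i hi => by
    rw [h2 i hi]
    exact Ideal.mul_mem_left _ _ (Ideal.subset_span ⟨i, hi, rfl⟩)

theorem mem_span_range (h : IsAsympHom S 𝓕 T σ) {ι : Type} [Fintype ι] {y : ι → S} {s : S}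
    (hs : s ∈ Ideal.span (Set.range y)) :
    ∀ᶠ ω in 𝓕, σ ω s ∈ Ideal.span (Set.range fun i => σ ω (y i)) := by
  have := h.mem_span (y := y) (G := Finset.univ) (s := s) (by simpa using hs)
  simpa using this

/-- Inclusions of colon modules specialize. -/
theorem colon (h : IsAsympHom S 𝓕 T σ) {r : ℕ} {κ : Type} [Fintype κ] (E : Matrix (Fin r) κ S)
    {y w : S} (hyw : ∀ z, y • z ∈ LinearMap.range E.mulVecLin → w • z ∈ LinearMap.range E.mulVecLin) :
    ∀ᶠ ω in 𝓕, ∀ z : Fin r → T ω, σ ω y • z ∈ LinearMap.range (E.map (σ ω)).mulVecLin →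
      σ ω w • z ∈ LinearMap.range (E.map (σ ω)).mulVecLin := by
  obtain ⟨l, C, hDC, hC⟩ := h.exists_ker (fromCols (y • (1 : Matrix (Fin r) (Fin r) S)) E)
  obtain ⟨C₁, C₂, rfl⟩ : ∃ C₁ C₂, C = fromRows C₁ C₂ := ⟨_, _, (fromRows_toRows C).symm⟩
  rw [fromCols_mul_fromRows, smul_mul, Matrix.one_mul] at hDC
  have hV : ∃ V : Matrix κ (Fin l) S, w • C₁ = E * V := by
    have : ∀ j, ∃ v, E.mulVec v = w • C₁.col j := by
      intro j
      refine hyw _ ⟨-C₂.col j, ?_⟩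
      rw [mulVecLin_apply, mulVec_neg, neg_eq_iff_add_eq_zero, add_comm]
      ext i
      exact congrFun (congrFun hDC i) j
    choose V hV using this
    refine ⟨of fun i j => V j i, ?_⟩
    ext i j
    exact (congrFun (hV j) i).symm
  obtain ⟨V, hV⟩ := hV
  filter_upwards [hC, h.matrix_mul E V, h.matrix_smul w C₁, h.matrix_smul y
    (1 : Matrix (Fin r) (Fin r) S), h.matrix_one (ι := Fin r)] with ω hC hEV hwC hy1 h1
  rintro z ⟨u, hu⟩
  rw [mulVecLin_apply] at hu
  obtain ⟨s, hs⟩ := hC (Sum.elim z (-u)) (by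
    rw [fromCols_map, hy1, h1, fromCols_mulVec, smul_mulVec, one_mulVec, Sum.elim_comp_inl,
      Sum.elim_comp_inr, mulVec_neg, hu, add_neg_cancel])
  rw [fromRows_map, fromRows_mulVec] at hs
  have hz : z = (C₁.map (σ ω)).mulVec s := by
    simpa using congrArg (fun f => f ∘ Sum.inl) hs
  refine ⟨(V.map (σ ω)).mulVec s, ?_⟩
  rw [mulVecLin_apply, mulVec_mulVec, ← hEV, ← hV, hwC, smul_mulVec, ← hz]

end IsAsympHom

theorem range_fromCols {S : Type} [CommRing S] {r : ℕ} {κ : Type} [Fintype κ]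
    (E : Matrix (Fin r) κ S) (y : S) :
    LinearMap.range (fromCols E (y • (1 : Matrix (Fin r) (Fin r) S))).mulVecLin =
      adj (LinearMap.range E.mulVecLin) y := by
  ext z
  rw [mem_adj]
  constructor
  · rintro ⟨v, rfl⟩
    refine ⟨v ∘ Sum.inr, v ∘ Sum.inl, ?_⟩
    rw [mulVecLin_apply, mulVecLin_apply, fromCols_mulVec, smul_mulVec, one_mulVec,
      add_sub_cancel_right]
  · rintro ⟨l, v, hv⟩
    refine ⟨Sum.elim v l, ?_⟩
    rw [mulVecLin_apply] at hv ⊢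
    rw [fromCols_mulVec, smul_mulVec, one_mulVec, Sum.elim_comp_inl, Sum.elim_comp_inr, hv,
      sub_add_cancel]

theorem IsAsympHom.range_adj (h : IsAsympHom S 𝓕 T σ) {r : ℕ} {κ : Type} [Fintype κ]
    (E : Matrix (Fin r) κ S) (y : S) :
    ∀ᶠ ω in 𝓕, LinearMap.range
      ((fromCols E (y • (1 : Matrix (Fin r) (Fin r) S))).map (σ ω)).mulVecLin =
      adj (LinearMap.range (E.map (σ ω)).mulVecLin) (σ ω y) := by
  filter_upwards [h.matrix_smul y (1 : Matrix (Fin r) (Fin r) S), h.matrix_one (ι := Fin r)]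
    with ω h1 h2
  rw [fromCols_map, h1, h2, range_fromCols]

end AsympHom

section AsympTower

open Filter Matrix IsLocalRing

variable {S : Type} [CommRing S] {Ω : Type*} {𝓕 : Filter Ω} {T : Ω → Type}
  [∀ ω, CommRing (T ω)] {σ : ∀ ω, S → T ω}

/-- If `x² z ∈ Q` implies `𝔞 z ⊆ Q`, then `x` is filter regular and `Q` is good. -/
theorem FR.of_sq {S L : Type} [CommRing S] [AddCommGroup L] [Module S L] {𝔞 : Ideal S}
    {Q : Submodule S L} {x : S} (h : ∀ z : L, x ^ 2 • z ∈ Q → ∀ c ∈ 𝔞, c • z ∈ Q) : FR 𝔞 x Q :=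
  fun z hz => ⟨1, fun c hc => h z (by rw [_root_.sq, mul_smul]; exact Q.smul_mem _ hz) c
    (by simpa using hc)⟩

theorem Good.of_sq {S L : Type} [CommRing S] [AddCommGroup L] [Module S L] {𝔞 : Ideal S}
    {Q : Submodule S L} {x : S} (hx : x ∈ 𝔞)
    (h : ∀ z : L, x ^ 2 • z ∈ Q → ∀ c ∈ 𝔞, c • z ∈ Q) : Good 𝔞 Q := by
  rintro z ⟨N, hN⟩
  have key : ∀ M : ℕ, x ^ (M + 2) • z ∈ Q → x ^ 2 • z ∈ Q := by
    intro M
    induction M with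
    | zero => exact id
    | succ M ih =>
      intro hM
      refine ih ?_
      have := h (x ^ (M + 1) • z) (by
        rw [smul_smul, ← pow_add, show 2 + (M + 1) = M + 1 + 2 by omega]
        exact hM) x hx
      rwa [smul_smul, ← pow_succ'] at this
  refine h z (key N ?_)
  rw [pow_add, mul_comm, mul_smul]
  exact Q.smul_mem _ (hN _ (Ideal.pow_mem_pow hx N))

theorem FR.smul_mem_of_good {S L : Type} [CommRing S] [IsNoetherianRing S] [AddCommGroup L]
    [Module S L] {𝔞 : Ideal S} {Q : Submodule S L} {x : S} (h : FR 𝔞 x Q) (hQ : Good 𝔞 Q) {z : L}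
    (hz : x ^ 2 • z ∈ Q) {c : S} (hc : c ∈ 𝔞) : c • z ∈ Q :=
  hQ z (FR.sq h z hz) c hc

theorem IsAsympHom.eventually_sq [IsNoetherianRing S] (h : IsAsympHom S 𝓕 T σ) {t : ℕ}
    (a : Fin t → S) {r : ℕ} {κ : Type} [Fintype κ] (E : Matrix (Fin r) κ S) {x : S}
    (hx : FR (Ideal.span (Set.range a)) x (LinearMap.range E.mulVecLin))
    (hE : Good (Ideal.span (Set.range a)) (LinearMap.range E.mulVecLin)) :
    ∀ᶠ ω in 𝓕, ∀ z : Fin r → T ω, σ ω x ^ 2 • z ∈ LinearMap.range (E.map (σ ω)).mulVecLin →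
      ∀ c ∈ Ideal.span (Set.range fun j => σ ω (a j)),
        c • z ∈ LinearMap.range (E.map (σ ω)).mulVecLin := by
  have h1 : ∀ᶠ ω in 𝓕, ∀ j, ∀ z : Fin r → T ω,
      σ ω (x ^ 2) • z ∈ LinearMap.range (E.map (σ ω)).mulVecLin →
      σ ω (a j) • z ∈ LinearMap.range (E.map (σ ω)).mulVecLin :=
    eventually_all.2 fun j => h.colon E fun z hz =>
      hx.smul_mem_of_good hE hz (Ideal.subset_span ⟨j, rfl⟩)
  filter_upwards [h1, h.map_pow x 2] with ω h1 h2 z hz c hc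
  rw [h2] at h1
  refine Submodule.span_induction (p := fun c _ => c • z ∈ _) ?_ (by simp)
    (fun _ _ _ _ h h' => ?_) (fun s _ _ h => ?_) hc
  · rintro _ ⟨j, rfl⟩
    exact h1 j z hz
  · rw [add_smul]; exact Submodule.add_mem _ h h'
  · rw [smul_assoc]; exact Submodule.smul_mem _ s h

theorem IsAsympHom.hT [IsNoetherianRing S] (h : IsAsympHom S 𝓕 T σ) {t : ℕ}
    (a : Fin t → S) {r : ℕ} {ι : Type} (x : ι → S) {d : ℕ} :
    ∀ {κ : Type} [Fintype κ] (E : Matrix (Fin r) κ S) (I : Finset ι),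
      Rich (Ideal.span (Set.range a)) x d I →
      HT (Ideal.span (Set.range a)) x (GoodPos (Ideal.span (Set.range a))) d I
        (LinearMap.range E.mulVecLin) →
      ∀ᶠ ω in 𝓕, HT (Ideal.span (Set.range fun j => σ ω (a j))) (fun i => σ ω (x i))
        (GoodPos (Ideal.span (Set.range fun j => σ ω (a j)))) d I
        (LinearMap.range (E.map (σ ω)).mulVecLin) := by
  classical
  induction d with
  | zero => exact fun E I _ _ => Eventually.of_forall fun ω h => absurd h (by norm_num)
  | succ d ih =>
    intro κ _ E I hI hE
    have hgood := hE.1 (by omega)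
    have hsq : ∀ᶠ ω in 𝓕, ∀ i ∈ I, ∀ z : Fin r → T ω,
        σ ω (x i) ^ 2 • z ∈ LinearMap.range (E.map (σ ω)).mulVecLin →
        ∀ c ∈ Ideal.span (Set.range fun j => σ ω (a j)),
          c • z ∈ LinearMap.range (E.map (σ ω)).mulVecLin :=
      (eventually_all_finset I).2 fun i hi => h.eventually_sq a E (hE.2 i hi).2.1 hgood
    have hmem : ∀ᶠ ω in 𝓕, ∀ i ∈ I, σ ω (x i) ∈ Ideal.span (Set.range fun j => σ ω (a j)) :=
      (eventually_all_finset I).2 fun i hi => h.mem_span_range (hE.2 i hi).1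
    have h1 : ∀ᶠ ω in 𝓕, ∀ i ∈ I, HT (Ideal.span (Set.range fun j => σ ω (a j)))
        (fun i => σ ω (x i)) (GoodPos (Ideal.span (Set.range fun j => σ ω (a j)))) d (I.erase i)
        (adj (LinearMap.range (E.map (σ ω)).mulVecLin) (σ ω (x i))) :=
      (eventually_all_finset I).2 fun i hi => by
        have := ih (fromCols E (x i • (1 : Matrix (Fin r) (Fin r) S))) (I.erase i) (hI.erase i) (by
          rw [range_fromCols]
          exact (hE.2 i hi).2.2.1)
        filter_upwards [this, h.range_adj E (x i)] with ω h1 h2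
        rwa [← h2]
    have h2 : ∀ᶠ ω in 𝓕, ∀ i ∈ I, HT (Ideal.span (Set.range fun j => σ ω (a j)))
        (fun i => σ ω (x i)) (GoodPos (Ideal.span (Set.range fun j => σ ω (a j)))) d (I.erase i)
        (adj (LinearMap.range (E.map (σ ω)).mulVecLin) (σ ω (x i) ^ 2)) :=
      (eventually_all_finset I).2 fun i hi => by
        have := ih (fromCols E (x i ^ 2 • (1 : Matrix (Fin r) (Fin r) S))) (I.erase i)
          (hI.erase i) (by
            rw [range_fromCols]
            exact (hE.2 i hi).2.2.2)
        filter_upwards [this, h.range_adj E (x i ^ 2), h.map_pow (x i) 2] with ω h1 h2 h3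
        rwa [← h3, ← h2]
    have h0 : ∀ᶠ ω in 𝓕, Good (Ideal.span (Set.range fun j => σ ω (a j)))
        (LinearMap.range (E.map (σ ω)).mulVecLin) := by
      obtain rfl | ⟨i, hi⟩ := I.eq_empty_or_nonempty
      · have ha : ∀ j, a j = 0 := fun j => by
          simpa using hI.le_span (Ideal.subset_span ⟨j, rfl⟩)
        filter_upwards [h.map_zero] with ω h0 z _ c hc
        have hbot : Ideal.span (Set.range fun j => σ ω (a j)) = ⊥ :=
          Ideal.span_eq_bot.2 (by
            rintro _ ⟨j, rfl⟩
            simp only [ha, h0])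
        have : c = 0 := by simpa [hbot] using hc
        rw [this, zero_smul]
        exact zero_mem _
      · filter_upwards [hsq, hmem] with ω h1 h2
        exact Good.of_sq (h2 i hi) (h1 i hi)
    filter_upwards [h0, h1, h2, hsq, hmem] with ω h0 h1 h2 h3 h4
    exact ⟨fun _ => h0, fun i hi => ⟨h4 i hi, FR.of_sq (h3 i hi), h1 i hi, h2 i hi⟩⟩

theorem IsAsympHom.rich (h : IsAsympHom S 𝓕 T σ) {t : ℕ} (a : Fin t → S) {ι : Type} (x : ι → S)
    {d : ℕ} {I : Finset ι} (hI : Rich (Ideal.span (Set.range a)) x d I) :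
    ∀ᶠ ω in 𝓕, Rich (Ideal.span (Set.range fun j => σ ω (a j))) (fun i => σ ω (x i)) d I := by
  classical
  have h1 : ∀ᶠ ω in 𝓕, ∀ G ∈ I.powerset, Ideal.span (Set.range a) ≤ Ideal.span (x '' G) →
      Ideal.span (Set.range fun j => σ ω (a j)) ≤ Ideal.span ((fun i => σ ω (x i)) '' G) := by
    refine (eventually_all_finset _).2 fun G _ => ?_
    by_cases hG : Ideal.span (Set.range a) ≤ Ideal.span (x '' G)
    · have := eventually_all.2 fun j => h.mem_span (hG (Ideal.subset_span ⟨j, rfl⟩))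
      filter_upwards [this] with ω hω _
      rw [Ideal.span_le]
      rintro _ ⟨j, rfl⟩
      exact hω j
    · exact Eventually.of_forall fun ω hω => absurd hω hG
  filter_upwards [h1] with ω hω F hF
  have := hω (I \ F) (by simp) (by simpa using hI F hF)
  simpa using this

theorem IsAsympHom.moduleDim_le [IsNoetherianRing S] [IsLocalRing S] [∀ ω, IsNoetherianRing (T ω)]
    [∀ ω, IsLocalRing (T ω)] (h : IsAsympHom S 𝓕 T σ) {L : Type} [AddCommGroup L] [Module S L]
    [Module.Finite S L] {r s : ℕ} (pL : Present S r s L) {t : ℕ} (a : Fin t → S)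
    (hrad : (Ideal.span (Set.range a)).radical = maximalIdeal S)
    (hrad' : ∀ᶠ ω in 𝓕, (Ideal.span (Set.range fun j => σ ω (a j))).radical = maximalIdeal (T ω))
    {d : ℕ} (hd : moduleDim S L ≤ (d : ℕ∞)) :
    ∀ᶠ ω in 𝓕, moduleDim (T ω) (MatCoker (pL.A.map (σ ω))) ≤ (d : ℕ∞) := by
  have h0 : DimLE L (fun _ : ℕ => (0 : S)) 0 d := fun p hp hann _ =>
    (ringKrullDim_le_of_surjective (Ideal.Quotient.factor hann)
      (Ideal.Quotient.factor_surjective hann)).trans hd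
  obtain ⟨y, hy, -, hdim⟩ := h0.exists_extend hrad (fun _ => zero_mem _)
  rw [zero_add] at hdim
  have hpow : ∀ j, ∃ N : ℕ, ∃ (V : Fin d → Matrix (Fin r) (Fin r) S)
      (U : Matrix (Fin s) (Fin r) S),
      a j ^ N • (1 : Matrix (Fin r) (Fin r) S) = ∑ i : Fin d, y i • V i + pL.A * U := by
    intro j
    have : a j ∈ (Module.annihilator S
        (L ⧸ (Ideal.span (Set.range fun i : Fin d => y i) • (⊤ : Submodule S L)))).radical := by
      rw [Ideal.radical_eq_sInf, Ideal.mem_sInf]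
      rintro q ⟨hq, hqp⟩
      rw [moduleDim_le_zero_iff.1 hdim.moduleDim_le q hqp hq]
      exact le_maximalIdeal_of_radical_eq hrad (Ideal.subset_span ⟨j, rfl⟩)
    obtain ⟨N, hN⟩ := this
    have key : ∀ v : Fin r → S, ∃ (V : Fin d → Fin r → S) (u : Fin s → S),
        a j ^ N • v = ∑ i : Fin d, y i • V i + pL.A.mulVec u := by
      intro v
      have h1 : a j ^ N • pL.π v ∈
          Ideal.span (Set.range fun i : Fin d => y i) • (⊤ : Submodule S L) := by
        rw [← Submodule.Quotient.mk_eq_zero, Submodule.Quotient.mk_smul]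
        exact Module.mem_annihilator.1 hN _
      have h2 : ∃ V : Fin d → L, a j ^ N • pL.π v = ∑ i : Fin d, y i • V i := by
        refine Submodule.smul_induction_on h1 ?_ ?_
        · intro c hc z _
          obtain ⟨e, rfl⟩ := Submodule.mem_span_range_iff_exists_fun _ |>.1 hc
          exact ⟨fun i => e i • z, by
            rw [Finset.sum_smul]
            exact Finset.sum_congr rfl fun i _ => by rw [smul_eq_mul, mul_comm, mul_smul]⟩
        · rintro _ _ ⟨V, rfl⟩ ⟨V', rfl⟩
          exact ⟨V + V', by simp [Finset.sum_add_distrib]⟩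
      obtain ⟨V, hV⟩ := h2
      choose V' hV' using fun i => pL.surj (V i)
      have h3 : a j ^ N • v - ∑ i : Fin d, y i • V' i ∈ LinearMap.ker pL.π := by
        simp [hV', hV]
      rw [pL.ker_eq] at h3
      obtain ⟨u, hu⟩ := h3
      exact ⟨V', u, by rw [← mulVecLin_apply, hu]; abel⟩
    choose V U hVU using fun l : Fin r => key (Pi.single l 1)
    refine ⟨N, fun i => of fun p l => V l i p, of fun p l => U l p, ?_⟩
    ext p l
    have := congrFun (hVU l) p
    simp only [Pi.smul_apply, Pi.add_apply, Finset.sum_apply, smul_eq_mul] at this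
    simp only [Matrix.smul_apply, Matrix.add_apply, Matrix.sum_apply, smul_eq_mul, of_apply]
    rw [Matrix.one_apply, ← Pi.single_apply, this]
    rfl
  have hcert : ∀ᶠ ω in 𝓕, ∀ j, ∃ N : ℕ, ∃ (V : Fin d → Matrix (Fin r) (Fin r) (T ω))
      (U : Matrix (Fin s) (Fin r) (T ω)), σ ω (a j) ^ N • (1 : Matrix (Fin r) (Fin r) (T ω)) =
        ∑ i : Fin d, σ ω (y i) • V i + pL.A.map (σ ω) * U := by
    refine eventually_all.2 fun j => ?_
    obtain ⟨N, V, U, hj⟩ := hpow j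
    have hs : ∀ᶠ ω in 𝓕, ∀ i : Fin d, (y i • V i).map (σ ω) = σ ω (y i) • (V i).map (σ ω) :=
      eventually_all.2 fun i => h.matrix_smul _ _
    filter_upwards [h.matrix_smul (a j ^ N) (1 : Matrix (Fin r) (Fin r) S), h.matrix_one (ι := Fin r),
      h.map_pow (a j) N, h.matrix_add (∑ i : Fin d, y i • V i) (pL.A * U), h.matrix_mul pL.A U,
      h.matrix_sum Finset.univ (fun i : Fin d => y i • V i), hs] with ω h1 h2 h3 h4 h5 h6 h7
    refine ⟨N, fun i => (V i).map (σ ω), U.map (σ ω), ?_⟩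
    rw [← h3]
    nth_rewrite 1 [← h2]
    rw [← h1, hj, h4, h5, h6]
    congr 1
    exact Finset.sum_congr rfl fun i _ => h7 i
  have hmem : ∀ᶠ ω in 𝓕, ∀ i : Fin d,
      σ ω (y i) ∈ Ideal.span (Set.range fun j => σ ω (a j)) :=
    eventually_all.2 fun i => h.mem_span_range (hy i)
  filter_upwards [hcert, hmem, hrad'] with ω h1 h2 h3
  have := ringKrullDim_quotient_le_card (Finset.univ : Finset (Fin d)) (fun i => σ ω (y i))
    (fun i _ => le_maximalIdeal_of_radical_eq h3 (h2 i))
    (Module.annihilator (T ω) (MatCoker (pL.A.map (σ ω)))) (fun q hq hann hyq => ?_)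
  · rw [Finset.card_univ, Fintype.card_fin] at this
    exact this
  · refine le_antisymm (le_maximalIdeal hq.ne_top) ?_
    rw [← h3, hq.radical_le_iff, Ideal.span_le]
    rintro _ ⟨j, rfl⟩
    obtain ⟨N, V, U, hj⟩ := h1 j
    refine hq.mem_of_pow_mem N ?_
    have hle := annihilator_quotient_smul_le_iff.2 ⟨hann, (Ideal.span_le.2 (by
      rintro _ ⟨i, rfl⟩
      exact hyq i (Finset.mem_univ i)) :
      Ideal.span (Set.range fun i : Fin d => σ ω (y i)) ≤ q)⟩
    refine hle (Module.mem_annihilator.2 fun z => ?_)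
    obtain ⟨z, rfl⟩ := Submodule.Quotient.mk_surjective _ z
    obtain ⟨z, rfl⟩ := Submodule.Quotient.mk_surjective _ z
    rw [← Submodule.Quotient.mk_smul, Submodule.Quotient.mk_eq_zero, ← Submodule.Quotient.mk_smul]
    have hz := congrArg (fun M => M.mulVec z) hj
    simp only [smul_mulVec, one_mulVec, add_mulVec, sum_mulVec, ← mulVec_mulVec] at hz
    rw [hz, Submodule.Quotient.mk_add,
      show (Submodule.Quotient.mk ((pL.A.map (σ ω)).mulVec (U.mulVec z)) :
        MatCoker (pL.A.map (σ ω))) = 0 from (Submodule.Quotient.mk_eq_zero _).2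
        ⟨U.mulVec z, mulVecLin_apply _ _⟩,
      add_zero, ← Submodule.mkQ_apply, _root_.map_sum]
    refine Submodule.sum_mem _ fun i _ => ?_
    rw [map_smul]
    exact Submodule.smul_mem_smul (Ideal.subset_span ⟨i, rfl⟩) Submodule.mem_top

/-- Standard ideals are preserved under asymptotic homomorphisms. -/
theorem IsAsympHom.isStandardIdeal [IsNoetherianRing S] [IsLocalRing S]
    [∀ ω, IsNoetherianRing (T ω)] [∀ ω, IsLocalRing (T ω)] (h : IsAsympHom S 𝓕 T σ) {L : Type}
    [AddCommGroup L] [Module S L] [Module.Finite S L] {r s : ℕ} (pL : Present S r s L) {t : ℕ}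
    (a : Fin t → S) (hstd : IsStandardIdeal S L (Ideal.span (Set.range a)))
    (hrad : ∀ᶠ ω in 𝓕, (Ideal.span (Set.range fun j => σ ω (a j))).radical = maximalIdeal (T ω)) :
    ∀ᶠ ω in 𝓕, IsStandardIdeal (T ω) (MatCoker (pL.A.map (σ ω)))
      (Ideal.span (Set.range fun j => σ ω (a j))) := by
  obtain ⟨d, hd, I, hI, hHT⟩ := hstd.exists_rich
  rw [← HT_comap pL.surj, Submodule.comap_bot, pL.ker_eq] at hHT
  filter_upwards [h.moduleDim_le pL a hstd.1 hrad hd, h.rich a Prod.snd hI,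
    h.hT a Prod.snd pL.A I hI hHT, hrad] with ω h1 h2 h3 h4
  refine Real.isStandardIdeal h4 h1 ⟨_, _, I, h2, ?_⟩
  rw [← HT_comap (Submodule.mkQ_surjective _), Submodule.comap_bot, Submodule.ker_mkQ]
  exact h3

end AsympTower

section LocSpec

open Filter IsLocalRing

variable {B S : Type} [CommRing B] [CommRing S]

/-- `S` is, via the injection `ι`, the localization of `B` at the complement of `J`. -/
structure IsLocEmb (J : Ideal B) (ι : B →+* S) : Prop where
  inj : Function.Injective ι
  isUnit_iff : ∀ g, IsUnit (ι g) ↔ g ∉ J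
  surj : ∀ a, ∃ p g, IsUnit (ι g) ∧ ι g * a = ι p

variable {J : Ideal B} {ι : B →+* S}

namespace IsLocEmb

/-- The numerator of a chosen representation as a fraction. -/
def num (h : IsLocEmb J ι) (a : S) : B := (h.surj a).choose

/-- The denominator of a chosen representation as a fraction. -/
def den (h : IsLocEmb J ι) (a : S) : B := (h.surj a).choose_spec.choose

theorem den_mul (h : IsLocEmb J ι) (a : S) : ι (h.den a) * a = ι (h.num a) :=
  (h.surj a).choose_spec.choose_spec.2

theorem den_notMem (h : IsLocEmb J ι) (a : S) : h.den a ∉ J :=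
  (h.isUnit_iff _).1 (h.surj a).choose_spec.choose_spec.1

/-- The specialization of `a` along `ρ`, computed from the chosen fraction. -/
def spec (h : IsLocEmb J ι) {T : Type} [CommRing T] (ρ : B →+* T) (a : S) : T :=
  ρ (h.num a) * Ring.inverse (ρ (h.den a))

theorem den_mul_spec (h : IsLocEmb J ι) {T : Type} [CommRing T] (ρ : B →+* T) (a : S)
    (hu : IsUnit (ρ (h.den a))) : ρ (h.den a) * h.spec ρ a = ρ (h.num a) := by
  rw [spec, mul_left_comm, Ring.mul_inverse_cancel _ hu, mul_one]

theorem den_mul_eq (h : IsLocEmb J ι) {a : S} {p g : B} (e : ι g * a = ι p) :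
    h.den a * p = g * h.num a := by
  apply h.inj
  rw [map_mul, map_mul, ← e, ← h.den_mul]
  ring

theorem mul_spec (h : IsLocEmb J ι) {T : Type} [CommRing T] (ρ : B →+* T) {a : S} {p g : B}
    (hu : IsUnit (ρ (h.den a))) (e : ι g * a = ι p) : ρ g * h.spec ρ a = ρ p := by
  have := congrArg ρ (h.den_mul_eq e)
  rw [map_mul, map_mul, ← h.den_mul_spec ρ a hu] at this
  exact hu.mul_left_cancel (by rw [this]; ring)

theorem eq_spec (h : IsLocEmb J ι) {T : Type} [CommRing T] (ρ : B →+* T) {a : S} {p g : B} {x : T}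
    (hu : IsUnit (ρ (h.den a))) (e : ι g * a = ι p) (hg : IsUnit (ρ g)) (hx : ρ g * x = ρ p) :
    x = h.spec ρ a :=
  hg.mul_left_cancel (by rw [hx, h.mul_spec ρ hu e])

variable {Ω : Type*} {𝓕 : Filter Ω} {T : Ω → Type} [∀ ω, CommRing (T ω)] {ρ : ∀ ω, B →+* T ω}

theorem eventually_mul_spec (h : IsLocEmb J ι) (hu : ∀ g ∉ J, ∀ᶠ ω in 𝓕, IsUnit (ρ ω g))
    {a : S} {p g : B} (e : ι g * a = ι p) :
    ∀ᶠ ω in 𝓕, ρ ω g * h.spec (ρ ω) a = ρ ω p := by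
  filter_upwards [hu _ (h.den_notMem a)] with ω hω
  exact h.mul_spec _ hω e

theorem eventually_spec_map (h : IsLocEmb J ι) (hu : ∀ g ∉ J, ∀ᶠ ω in 𝓕, IsUnit (ρ ω g))
    (b : B) : ∀ᶠ ω in 𝓕, h.spec (ρ ω) (ι b) = ρ ω b := by
  filter_upwards [h.eventually_mul_spec hu (a := ι b) (p := b) (g := 1) (by simp)] with ω hω
  simpa using hω

theorem isAsympHom (h : IsLocEmb J ι) (hu : ∀ g ∉ J, ∀ᶠ ω in 𝓕, IsUnit (ρ ω g))
    (hker : ∀ {κ κ' : Type} [Fintype κ] [Fintype κ'] (D : Matrix κ κ' B),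
      ∃ (l : ℕ) (C : Matrix κ' (Fin l) B), D * C = 0 ∧ ∀ᶠ ω in 𝓕, ∀ v,
        (D.map (ρ ω)).mulVec v = 0 → ∃ z, v = (C.map (ρ ω)).mulVec z) :
    IsAsympHom S 𝓕 T fun ω => h.spec (ρ ω) where
  map_zero := by simpa using h.eventually_spec_map hu 0
  map_one := by simpa using h.eventually_spec_map hu 1
  map_add a b := by
    filter_upwards [hu _ (h.den_notMem a), hu _ (h.den_notMem b), hu _ (h.den_notMem (a + b))]
      with ω ha hb hab
    refine (h.eq_spec (ρ ω) (p := h.den b * h.num a + h.den a * h.num b)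
      (g := h.den a * h.den b) hab ?_ ?_ ?_).symm
    · simp only [map_add, map_mul, ← h.den_mul]
      ring
    · rw [map_mul]
      exact ha.mul hb
    · simp only [map_add, map_mul, ← h.den_mul_spec _ _ ha, ← h.den_mul_spec _ _ hb]
      ring
  map_mul a b := by
    filter_upwards [hu _ (h.den_notMem a), hu _ (h.den_notMem b), hu _ (h.den_notMem (a * b))]
      with ω ha hb hab
    refine (h.eq_spec (ρ ω) (p := h.num a * h.num b) (g := h.den a * h.den b) hab ?_ ?_ ?_).symm
    · simp only [map_mul, ← h.den_mul]
      ring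
    · rw [map_mul]
      exact ha.mul hb
    · simp only [map_mul, ← h.den_mul_spec _ _ ha, ← h.den_mul_spec _ _ hb]
      ring
  exists_ker := by
    intro κ κ' _ _ D
    obtain ⟨D', G, hG, hD'⟩ := exists_common_num h.surj fun x : κ × κ' => D x.1 x.2
    obtain ⟨l, C, hDC, hC⟩ := hker (Matrix.of fun i j => D' (i, j))
    have hmap : (Matrix.of fun i j => D' (i, j)).map ι = ι G • D := by
      ext i j
      simp [hD' (i, j)]
    refine ⟨l, C.map ι, ?_, ?_⟩
    · have : ι G • (D * C.map ι) = 0 := by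
        rw [← Matrix.smul_mul, ← hmap, ← Matrix.map_mul, hDC]
        ext; simp
      ext i j
      have := congrFun (congrFun this i) j
      simpa [hG.mul_right_eq_zero] using this
    · have h1 : ∀ᶠ ω in 𝓕, ∀ x : κ × κ', ρ ω G * h.spec (ρ ω) (D x.1 x.2) = ρ ω (D' x) :=
        eventually_all.2 fun x => h.eventually_mul_spec hu (hD' x)
      have h2 : ∀ᶠ ω in 𝓕, ∀ x : κ' × Fin l, h.spec (ρ ω) (ι (C x.1 x.2)) = ρ ω (C x.1 x.2) :=
        eventually_all.2 fun x => h.eventually_spec_map hu _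
      filter_upwards [hC, h1, h2] with ω h3 h1 h2 v hv
      have e1 : (Matrix.of fun i j => D' (i, j)).map (ρ ω) = ρ ω G • D.map (h.spec (ρ ω)) := by
        ext i j
        simp [h1 (i, j)]
      have e2 : (C.map ι).map (h.spec (ρ ω)) = C.map (ρ ω) := by
        ext i j
        exact h2 (i, j)
      rw [e2]
      exact h3 v (by rw [e1, Matrix.smul_mulVec, hv, smul_zero])

theorem eventually_radical_eq [IsNoetherianRing B] [IsLocalRing S] [∀ ω, IsLocalRing (T ω)]
    (h : IsLocEmb J ι) (hu : ∀ g ∉ J, ∀ᶠ ω in 𝓕, IsUnit (ρ ω g))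
    (hσ : IsAsympHom S 𝓕 T fun ω => h.spec (ρ ω))
    (hJ : ∀ᶠ ω in 𝓕, (J.map (ρ ω)).radical = maximalIdeal (T ω)) {t : ℕ} (a : Fin t → S)
    (ha : (Ideal.span (Set.range a)).radical = maximalIdeal S) :
    ∀ᶠ ω in 𝓕, (Ideal.span (Set.range fun j => h.spec (ρ ω) (a j))).radical =
      maximalIdeal (T ω) := by
  obtain ⟨r, w, hw⟩ := Submodule.fg_iff_exists_fin_generating_family.1
    (IsNoetherian.noetherian J)
  have h1 : ∀ j, h.num (a j) ∈ J := fun j => by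
    by_contra hn
    have := (h.isUnit_iff _).2 hn
    rw [← h.den_mul] at this
    exact (mem_maximalIdeal _).1 (le_maximalIdeal_of_radical_eq ha (Ideal.subset_span ⟨j, rfl⟩))
      (isUnit_of_mul_isUnit_right this)
  have h2 : ∀ᶠ ω in 𝓕, ∀ j, IsUnit (ρ ω (h.den (a j))) :=
    eventually_all.2 fun j => hu _ (h.den_notMem _)
  have h3 : ∀ᶠ ω in 𝓕, ∀ i, ∃ N : ℕ,
      ρ ω (w i) ^ N ∈ Ideal.span (Set.range fun j => h.spec (ρ ω) (a j)) := by
    refine eventually_all.2 fun i => ?_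
    have hi : w i ∈ J := by rw [← hw]; exact Submodule.subset_span ⟨i, rfl⟩
    have : ι (w i) ∈ maximalIdeal S := fun hn => (h.isUnit_iff _).1 hn hi
    rw [← ha] at this
    obtain ⟨N, hN⟩ := this
    rw [← map_pow] at hN
    filter_upwards [hσ.mem_span_range hN, h.eventually_spec_map hu (w i ^ N)] with ω h1 h2
    exact ⟨N, by rwa [h2, map_pow] at h1⟩
  filter_upwards [h2, h3, hJ] with ω h2 h3 h4
  refine le_antisymm ?_ ?_
  · refine (Ideal.IsPrime.radical_le_iff inferInstance).2 (Ideal.span_le.2 ?_)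
    rintro _ ⟨j, rfl⟩
    rw [SetLike.mem_coe, ← Ideal.unit_mul_mem_iff_mem _ (h2 j), h.den_mul_spec _ _ (h2 j)]
    exact le_maximalIdeal_of_radical_eq h4 (Ideal.mem_map_of_mem _ (h1 j))
  · rw [← h4, ← Ideal.radical_idem (Ideal.span _)]
    refine Ideal.radical_mono (Ideal.map_le_iff_le_comap.2 ?_)
    refine hw.ge.trans (Ideal.span_le.2 ?_)
    rintro _ ⟨i, rfl⟩
    exact h3 i

end IsLocEmb

end LocSpec

section Specialization

open Filter IsLocalRing

/-- The filter of sets containing almost all points of `K^m`. -/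
def almostAllFilter (K : Type) [Field K] (m : ℕ) : Filter (Fin m → K) where
  sets := {s | AlmostAll K m (· ∈ s)}
  univ_sets := ⟨1, one_ne_zero, fun _ _ => trivial⟩
  sets_of_superset := fun ⟨c, hc, h⟩ hst => ⟨c, hc, fun α hα => hst (h α hα)⟩
  inter_sets := fun ⟨c, hc, h⟩ ⟨c', hc', h'⟩ => ⟨c * c', mul_ne_zero hc hc', fun α hα => by
    rw [map_mul] at hα
    exact ⟨h α (left_ne_zero_of_mul hα), h' α (right_ne_zero_of_mul hα)⟩⟩

variable {k K : Type} [Field k] [Field K] [Algebra k K] {m n : ℕ}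

theorem coe_evalα (α : Fin m → K) (c : MvPolynomial (Fin m) k) :
    (evalα k K α c : K) = aeval α c := by
  have : (kA k K α).val.comp (aeval fun i => (⟨α i, IntermediateField.subset_adjoin k
      (Set.range α) ⟨i, rfl⟩⟩ : kA k K α)) = aeval α := by
    ext i
    simp
  exact congrArg (fun f => f c) this

theorem eventually_evalα_ne_zero {c : MvPolynomial (Fin m) k} (hc : c ≠ 0) :
    ∀ᶠ α in almostAllFilter K m, evalα k K α c ≠ 0 := by
  refine ⟨MvPolynomial.map (algebraMap k K) c, fun h => hc ?_, fun α hα h => hα ?_⟩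
  · exact MvPolynomial.map_injective _ (algebraMap k K).injective (by rw [h, map_zero])
  · rw [eval_map, ← aeval_def, ← coe_evalα, h]
    rfl

theorem exists_evalα_mul_eq (α : Fin m → K) (y : kA k K α) :
    ∃ a d, evalα k K α d ≠ 0 ∧ evalα k K α d * y = evalα k K α a := by
  obtain ⟨r, s, h⟩ := (IntermediateField.mem_adjoin_range_iff k α (y : K)).1 y.2
  rw [← coe_evalα, ← coe_evalα] at h
  by_cases hs : evalα k K α s = 0
  · refine ⟨0, 1, by simp, ?_⟩
    rw [hs, ZeroMemClass.coe_zero, div_zero] at h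
    rw [map_one, one_mul, map_zero]
    exact Subtype.ext h
  · refine ⟨r, s, hs, Subtype.ext ?_⟩
    rw [MulMemClass.coe_mul, h, mul_div_cancel₀]
    exact fun h' => hs (Subtype.ext h')

theorem exists_algebraMap_kU_mul_eq (y : kU k m) :
    ∃ a d, algebraMap (MvPolynomial (Fin m) k) (kU k m) d ≠ 0 ∧
      algebraMap (MvPolynomial (Fin m) k) (kU k m) d * y =
        algebraMap (MvPolynomial (Fin m) k) (kU k m) a := by
  obtain ⟨⟨a, d⟩, h⟩ := IsLocalization.surj (nonZeroDivisors (MvPolynomial (Fin m) k)) y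
  exact ⟨a, d, IsFractionRing.to_map_ne_zero_of_mem_nonZeroDivisors d.2, by rw [mul_comm, h]⟩

theorem isLocEmb_toR (P : Ideal (Rg k m n)) [P.IsPrime] (S : Type) [CommRing S]
    [Algebra (Rg k m n) S] [IsLocalization.AtPrime S P] :
    IsLocEmb (P.comap (toR k m n)) ((algebraMap (Rg k m n) S).comp (toR k m n)) where
  inj := (IsLocalization.injective S P.primeCompl_le_nonZeroDivisors).comp
    (MvPolynomial.map_injective _ (IsFractionRing.injective _ _))
  isUnit_iff _ := IsLocalization.AtPrime.isUnit_to_map_iff S P _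
  surj := ((isFibreLoc_map exists_algebraMap_kU_mul_eq).localization P.primeCompl
    (T' := S)).exists_num

theorem idealSpec_eq_map (α : Fin m → K) (P : Ideal (Rg k m n)) :
    idealSpec k K n α P = (P.comap (toR k m n)).map (toRa k K n α) := rfl

theorem isFibreLoc_toRa (α : Fin m → K) :
    IsFibreLoc (RingHom.ker (evalα k K α)) (toRa k K n α) :=
  isFibreLoc_map (exists_evalα_mul_eq α)

theorem eq_zero_of_C_mem_comap_toR (P : Ideal (Rg k m n)) [hP : P.IsPrime]
    (a : MvPolynomial (Fin m) k) (ha : C a ∈ P.comap (toR k m n)) : a = 0 := by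
  by_contra h
  rw [Ideal.mem_comap, toR, map_C] at ha
  have : IsUnit (algebraMap (MvPolynomial (Fin m) k) (kU k m) a) :=
    isUnit_iff_ne_zero.2 (by simpa using h)
  exact hP.ne_top (Ideal.eq_top_of_isUnit_mem _ ha (this.map C))

theorem IsAssociatedPrime.idealSpec_le {α : Fin m → K} {P : Ideal (Rg k m n)}
    {℘ : Ideal (Ra k K n α)} (h : IsAssociatedPrime ℘ (Ra k K n α ⧸ idealSpec k K n α P)) :
    idealSpec k K n α P ≤ ℘ := by
  have := h.annihilator_le
  rwa [Submodule.annihilator_top, Ideal.annihilator_quotient] at this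

theorem eventually_notMem (P : Ideal (Rg k m n)) [P.IsPrime]
    {g : MvPolynomial (Fin n) (MvPolynomial (Fin m) k)} (hg : g ∉ P.comap (toR k m n)) :
    ∀ᶠ α in almostAllFilter K m, ∀ ℘ : Ideal (Ra k K n α),
      IsAssociatedPrime ℘ (Ra k K n α ⧸ idealSpec k K n α P) → toRa k K n α g ∉ ℘ := by
  obtain ⟨c, hc, H⟩ := exists_nzd (genericallyFlat_mvPolynomial _ n) (P.comap (toR k m n)) hg
  filter_upwards [eventually_evalα_ne_zero hc] with α hα ℘ h℘ hmem
  obtain ⟨hp, x, hx⟩ := isAssociatedPrime_iff.1 h℘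
  obtain ⟨y, rfl⟩ := Ideal.Quotient.mk_surjective x
  rw [hx, Submodule.mem_colon_singleton, Submodule.mem_bot] at hmem
  have := H _ _ _ (isFibreLoc_toRa α) hα y (Ideal.Quotient.eq_zero_iff_mem.1 hmem)
  refine hp.ne_top ((Ideal.eq_top_iff_one _).2 ?_)
  rw [hx, Submodule.mem_colon_singleton, Submodule.mem_bot, one_smul]
  exact Ideal.Quotient.eq_zero_iff_mem.2 this

/-- A local ring at an associated prime of a specialization of the ideal `P`. -/
structure SpecPoint (K : Type) [Field K] [Algebra k K] (P : Ideal (Rg k m n)) where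
  α : Fin m → K
  ideal : Ideal (Ra k K n α)
  isAssociatedPrime : IsAssociatedPrime ideal (Ra k K n α ⧸ idealSpec k K n α P)
  isPrime : ideal.IsPrime
  T : Type
  commRing : CommRing T
  algebra : Algebra (Ra k K n α) T
  isLocalization : IsLocalization.AtPrime T ideal

namespace SpecPoint

attribute [instance] isPrime commRing algebra isLocalization

variable {P : Ideal (Rg k m n)} (ω : SpecPoint K P)

instance : IsLocalRing ω.T := IsLocalization.AtPrime.isLocalRing ω.T ω.ideal

instance : IsNoetherianRing ω.T :=
  IsLocalization.isNoetherianRing ω.ideal.primeCompl ω.T inferInstance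

/-- Specialization of polynomials, composed with the localization map. -/
def map : MvPolynomial (Fin n) (MvPolynomial (Fin m) k) →+* ω.T :=
  (algebraMap (Ra k K n ω.α) ω.T).comp (toRa k K n ω.α)

/-- The filter of almost all specializations. -/
def filter (K : Type) [Field K] [Algebra k K] (P : Ideal (Rg k m n)) : Filter (SpecPoint K P) :=
  (almostAllFilter K m).comap SpecPoint.α

theorem eventually_evalα_ne_zero {c : MvPolynomial (Fin m) k} (hc : c ≠ 0) :
    ∀ᶠ ω in filter K P, evalα k K ω.α c ≠ 0 :=
  (Spl.eventually_evalα_ne_zero hc).comap _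

theorem eventually_isUnit [P.IsPrime] (g) (hg : g ∉ P.comap (toR k m n)) :
    ∀ᶠ ω in filter K P, IsUnit (ω.map g) := by
  filter_upwards [(eventually_notMem P hg).comap SpecPoint.α] with ω hω
  exact (IsLocalization.AtPrime.isUnit_to_map_iff ω.T ω.ideal _).2 (hω _ ω.isAssociatedPrime)

theorem eventually_exists_ker {κ κ' : Type} [Fintype κ] [Fintype κ']
    (D : Matrix κ κ' (MvPolynomial (Fin n) (MvPolynomial (Fin m) k))) :
    ∃ (l : ℕ) (C : Matrix κ' (Fin l) _), D * C = 0 ∧ ∀ᶠ ω in filter K P, ∀ v,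
      (D.map ω.map).mulVec v = 0 → ∃ z, v = (C.map ω.map).mulVec z := by
  obtain ⟨l, C, c, hc, hDC, H⟩ := exists_ker_matrix (genericallyFlat_mvPolynomial _ n) D
  refine ⟨l, C, hDC, ?_⟩
  filter_upwards [eventually_evalα_ne_zero hc] with ω hω
  exact H _ _ _ ((isFibreLoc_toRa ω.α).localization ω.ideal.primeCompl) hω

theorem eventually_radical_eq [P.IsPrime] :
    ∀ᶠ ω in filter K P, ((P.comap (toR k m n)).map ω.map).radical = maximalIdeal ω.T := by
  obtain ⟨c, hc, H⟩ := exists_unmixed (P.comap (toR k m n)) (eq_zero_of_C_mem_comap_toR P)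
  filter_upwards [eventually_evalα_ne_zero hc] with ω hω
  have hmap : (P.comap (toR k m n)).map ω.map =
      (idealSpec k K n ω.α P).map (algebraMap _ ω.T) := by
    rw [idealSpec_eq_map, Ideal.map_map]
    rfl
  rw [hmap]
  refine le_antisymm ?_ ?_
  · refine (Ideal.IsPrime.radical_le_iff inferInstance).2 ?_
    rw [← IsLocalization.AtPrime.map_eq_maximalIdeal ω.ideal ω.T]
    exact Ideal.map_mono (IsAssociatedPrime.idealSpec_le ω.isAssociatedPrime)
  · rw [Ideal.radical_eq_sInf]
    refine le_sInf fun q ⟨hle, hq⟩ => ?_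
    have hq' : q.comap (algebraMap (Ra k K n ω.α) ω.T) ≤ ω.ideal := fun x hx => by
      by_contra h
      exact hq.ne_top (Ideal.eq_top_of_isUnit_mem _ hx
        ((IsLocalization.AtPrime.isUnit_to_map_iff ω.T ω.ideal x).2 h))
    have := H _ (evalα k K ω.α) (exists_evalα_mul_eq ω.α) hω ω.ideal ω.isAssociatedPrime _
      (hq.comap _) (Ideal.map_le_iff_le_comap.1 hle) hq'
    rw [← IsLocalization.AtPrime.map_eq_maximalIdeal ω.ideal ω.T, ← this]
    exact Ideal.map_comap_le

theorem eq_spec_of_locElemSpec [P.IsPrime] {S : Type} [CommRing S] [Algebra (Rg k m n) S]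
    [IsLocalization.AtPrime S P] {a : S} {x : ω.T}
    (hu : IsUnit (ω.map ((isLocEmb_toR P S).den a))) (hx : LocElemSpec P ω.ideal a x) :
    x = (isLocEmb_toR P S).spec ω.map a := by
  obtain ⟨f, g, fα, gα, hg, hgα, ⟨p, q, hq, h1, h2⟩, ⟨p', q', hq', h1', h2'⟩, rfl, rfl⟩ := hx
  have hunit : ∀ {q}, evalα k K ω.α q ≠ 0 → IsUnit (ω.map (C q)) := fun hq => by
    rw [map, RingHom.comp_apply, toRa, map_C]
    exact ((isUnit_iff_ne_zero.2 hq).map C).map _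
  refine (isLocEmb_toR P S).eq_spec ω.map (p := p * C q') (g := p' * C q) hu ?_ ?_ ?_
  · have e : toR k m n (p' * C q) * f = toR k m n (p * C q') * g := by
      rw [map_mul, map_mul, ← h1, ← h1']
      simp only [toR, map_C]
      ring
    rw [RingHom.comp_apply, RingHom.comp_apply, IsLocalization.mul_mk'_eq_mk'_of_mul,
      IsLocalization.mk'_eq_iff_eq_mul, ← map_mul, ← e]
  · rw [map_mul]
    refine IsUnit.mul ?_ (hunit hq)
    rw [map, RingHom.comp_apply, ← h2']
    exact (((isUnit_iff_ne_zero.2 hq').map C).map _ |>.mul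
      ((IsLocalization.AtPrime.isUnit_to_map_iff ω.T ω.ideal _).2 hgα)) |> fun h => by
        rwa [map_mul]
  · have e : toRa k K n ω.α (p' * C q) * fα = toRa k K n ω.α (p * C q') * gα := by
      rw [map_mul, map_mul, ← h2, ← h2']
      simp only [toRa, map_C]
      ring
    rw [map, RingHom.comp_apply, RingHom.comp_apply, IsLocalization.mul_mk'_eq_mk'_of_mul,
      IsLocalization.mk'_eq_iff_eq_mul, ← map_mul, ← e]

end SpecPoint

end Specialization

/-- if `𝔞 = (a_1, …, a_t)` is a standard ideal for a finitely
generated `S`-module `L` (an `𝔪`-primary ideal all of whose systems of parameters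
for `L` are standard), then for almost all `α` the specialized ideal
`𝔞_α = ((a_1)_α, …, (a_t)_α)` is a standard ideal for `L_α`. -/
theorem specialization_preserves_standard_ideals
    (k K : Type) [Field k] [Field K] [Algebra k K] [Infinite K] {m n : ℕ}
    (P : Ideal (Rg k m n)) [P.IsPrime]
    (S : Type) [CommRing S] [Algebra (Rg k m n) S] [IsLocalization.AtPrime S P]
    (L : Type) [AddCommGroup L] [Module S L] [Module.Finite S L]
    {rL sL : ℕ} (pL : Present S rL sL L)
    (𝔞 : Ideal S) {t : ℕ} (a : Fin t → S) (ha : Ideal.span (Set.range a) = 𝔞)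
    (hstd : letI : IsLocalRing S := IsLocalization.AtPrime.isLocalRing S P
      IsStandardIdeal S L 𝔞) :
    AlmostAll K m fun α =>
      ∀ (℘ : Ideal (Ra k K n α))
        (h℘ : IsAssociatedPrime ℘ ((Ra k K n α) ⧸ idealSpec k K n α P)),
        haveI := h℘.isPrime
        ∀ (Sα : Type) [CommRing Sα] [Algebra (Ra k K n α) Sα]
          [IsLocalization.AtPrime Sα ℘],
          haveI : IsLocalRing Sα := IsLocalization.AtPrime.isLocalRing Sα ℘
          ∀ (B : Matrix (Fin rL) (Fin sL) Sα) (b : Fin t → Sα),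
          MatSpec (LocElemSpec P ℘) pL.A B →
          (∀ j, LocElemSpec P ℘ (a j) (b j)) →
          IsStandardIdeal Sα (MatCoker B) (Ideal.span (Set.range b)) := by
  let _ : IsLocalRing S := IsLocalization.AtPrime.isLocalRing S P
  let _ : IsNoetherianRing S := IsLocalization.isNoetherianRing P.primeCompl S inferInstance
  subst ha
  have hι := isLocEmb_toR P S
  have hu := SpecPoint.eventually_isUnit (K := K) (P := P)
  have hσ := hι.isAsympHom hu SpecPoint.eventually_exists_ker
  have hrad := hι.eventually_radical_eq hu hσ SpecPoint.eventually_radical_eq a hstd.1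
  have hA : ∀ᶠ ω in SpecPoint.filter K P, ∀ x : Fin rL × Fin sL,
      IsUnit (ω.map (hι.den (pL.A x.1 x.2))) :=
    Filter.eventually_all.2 fun x => hu _ (hι.den_notMem _)
  have ha : ∀ᶠ ω in SpecPoint.filter K P, ∀ j, IsUnit (ω.map (hι.den (a j))) :=
    Filter.eventually_all.2 fun x => hu _ (hι.den_notMem _)
  have key := (hσ.isStandardIdeal pL a hstd hrad).and (hA.and ha)
  refine (Filter.eventually_comap.1 key).mono fun α hα ℘ h℘ Sα _ _ _ B b hB hb => ?_
  let ω : SpecPoint K P := ⟨α, ℘, h℘, h℘.isPrime, Sα, _, _, ‹_›⟩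
  obtain ⟨h1, h2, h3⟩ := hα ω rfl
  obtain rfl : B = pL.A.map (hι.spec ω.map) := by
    ext i j
    exact ω.eq_spec_of_locElemSpec (h2 (i, j)) (hB i j)
  obtain rfl : b = fun j => hι.spec ω.map (a j) := by
    ext j
    exact ω.eq_spec_of_locElemSpec (h3 j) (hb j)
  exact h1

end Spl
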